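/- Let G be a smallest counterexample, let v be a vertex of G of degree four, and let P1, P2, P3, P4 be the four strings having v as an end. If P1 and P2 have length at least two and P3 and P4 have length at least three, then the path P1 ∪ P2 is contained either in a 5-cycle or in a 7-cycle of G. -/

import Mathlib

open SimpleGraph

/-- The degree of a vertex, as the cardinality of its neighbor set. -/
noncomputable def deg {V : Type} (G : SimpleGraph V) (v : V) : ℕ :=
  (G.neighborSet v).ncard

/-- The potential of a finite graph: `5 n(G) - 4 e(G)`. -/
noncomputable def pot {V : Type} [Fintype V] (G : SimpleGraph V) : ℤ :=
  5 * (Fintype.card V : ℤ) - 4 * (G.edgeSet.ncard : ℤ)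

/-- A graph is 5/2-critical if it has no homomorphism to the 5-cycle
but every proper subgraph has one. -/
def Critical52 {V : Type} (G : SimpleGraph V) : Prop :=
  IsEmpty (G →g cycleGraph 5) ∧
  ∀ H : G.Subgraph, H ≠ ⊤ → Nonempty (H.coe →g cycleGraph 5)

/-- The exceptional graph `E₁`: a 9-cycle `0 1 2 3 4 5 6 7 8` together
with a vertex `9` adjacent to `0`, `3` and `6`. -/
def E1 : SimpleGraph (Fin 10) := SimpleGraph.fromEdgeSet
  {s(0,1), s(1,2), s(2,3), s(3,4), s(4,5), s(5,6), s(6,7), s(7,8), s(8,0),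
   s(9,0), s(9,3), s(9,6)}

/-- The exceptional graph `E₂`: two 5-cycles `0 1 2 3 4` and `0 1 5 6 7`
sharing exactly the edge `01`, together with a path `3 8 9 6`. -/
def E2 : SimpleGraph (Fin 10) := SimpleGraph.fromEdgeSet
  {s(0,1), s(1,2), s(2,3), s(3,4), s(4,0),
   s(1,5), s(5,6), s(6,7), s(7,0),
   s(3,8), s(8,9), s(9,6)}

/-- A smallest counterexample: a 5/2-critical graph, not isomorphic to `C₃`, `E₁`, `E₂`,
with potential at least 2, such that every smaller 5/2-critical graph not isomorphic
to `C₃`, `E₁`, `E₂` has potential at most 1. -/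
def SmallestCex {V : Type} [Fintype V] (G : SimpleGraph V) : Prop :=
  Critical52 G ∧ IsEmpty (G ≃g cycleGraph 3) ∧ IsEmpty (G ≃g E1) ∧ IsEmpty (G ≃g E2) ∧
  2 ≤ pot G ∧
  ∀ (m : ℕ) (H : SimpleGraph (Fin m)), Critical52 H →
    IsEmpty (H ≃g cycleGraph 3) → IsEmpty (H ≃g E1) → IsEmpty (H ≃g E2) →
    m < Fintype.card V → pot H ≤ 1

/-- A string: a path of positive length whose endvertices have degree at least 3
and whose internal vertices have degree 2. A `k`-string is a string of length `k+1`. -/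
def IsString {V : Type} (G : SimpleGraph V) {u v : V} (p : G.Walk u v) : Prop :=
  p.IsPath ∧ 0 < p.length ∧ 3 ≤ deg G u ∧ 3 ≤ deg G v ∧
  ∀ w ∈ p.support, w ≠ u → w ≠ v → deg G w = 2

/-- `v` lies on a 5-cycle of `G`. -/
def InFiveCycle {V : Type} (G : SimpleGraph V) (v : V) : Prop :=
  ∃ (w : V) (c : G.Walk w w), c.IsCycle ∧ c.length = 5 ∧ v ∈ c.support

/-- `v` is a `(k₁,k₂,k₃)`-vertex: it has degree 3 and is the end of a `k₁`-string,
a `k₂`-string and a `k₃`-string leaving `v` through its three distinct edges. -/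
def IsVertex3 {V : Type} (G : SimpleGraph V) (v : V) (k1 k2 k3 : ℕ) : Prop :=
  deg G v = 3 ∧ ∃ (u1 u2 u3 : V) (p1 : G.Walk v u1) (p2 : G.Walk v u2) (p3 : G.Walk v u3),
    IsString G p1 ∧ IsString G p2 ∧ IsString G p3 ∧
    p1.getVert 1 ≠ p2.getVert 1 ∧ p1.getVert 1 ≠ p3.getVert 1 ∧ p2.getVert 1 ≠ p3.getVert 1 ∧
    p1.length = k1 + 1 ∧ p2.length = k2 + 1 ∧ p3.length = k3 + 1

/-- `v` is a `(k₁,k₂,k₃,k₄)`-vertex: it has degree 4 and is the end of strings of the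
corresponding lengths leaving `v` through its four distinct edges. -/
def IsVertex4 {V : Type} (G : SimpleGraph V) (v : V) (k1 k2 k3 k4 : ℕ) : Prop :=
  deg G v = 4 ∧ ∃ (u1 u2 u3 u4 : V) (p1 : G.Walk v u1) (p2 : G.Walk v u2)
    (p3 : G.Walk v u3) (p4 : G.Walk v u4),
    IsString G p1 ∧ IsString G p2 ∧ IsString G p3 ∧ IsString G p4 ∧
    p1.getVert 1 ≠ p2.getVert 1 ∧ p1.getVert 1 ≠ p3.getVert 1 ∧ p1.getVert 1 ≠ p4.getVert 1 ∧
    p2.getVert 1 ≠ p3.getVert 1 ∧ p2.getVert 1 ≠ p4.getVert 1 ∧ p3.getVert 1 ≠ p4.getVert 1 ∧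
    p1.length = k1 + 1 ∧ p2.length = k2 + 1 ∧ p3.length = k3 + 1 ∧ p4.length = k4 + 1

/-- `H` contains at least two distinct cycles, where cycles are counted as subgraphs,
i.e. two cycles are distinct if their edge sets differ. -/
def TwoDistinctCycles {V : Type} (H : SimpleGraph V) : Prop :=
  ∃ (v1 v2 : V) (c1 : H.Walk v1 v1) (c2 : H.Walk v2 v2),
    c1.IsCycle ∧ c2.IsCycle ∧ {e | e ∈ c1.edges} ≠ {e | e ∈ c2.edges}

/-- The degree of a 5-cycle (cell) `c` in `G`: the number of strings not contained in `c`
that intersect `c`, strings being counted by their edge sets. -/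
noncomputable def cellDegree {V : Type} (G : SimpleGraph V) {w : V} (c : G.Walk w w) : ℕ :=
  {S : Set (Sym2 V) | ∃ (u v : V) (p : G.Walk u v), IsString G p ∧ S = {e | e ∈ p.edges} ∧
    ¬ S ⊆ {e | e ∈ c.edges} ∧ ∃ x ∈ p.support, x ∈ c.support}.ncard

/-! ### Finite facts: colours, the auxiliary graph on six vertices, and `E₁`, `E₂` -/

/-- Adjacency in the 5-cycle. -/
def adj5 (x y : Fin 5) : Prop := x = y + 1 ∨ y = x + 1

instance (x y : Fin 5) : Decidable (adj5 x y) := by unfold adj5; infer_instance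

lemma cycle5_adj : ∀ x y : Fin 5, (cycleGraph 5).Adj x y ↔ adj5 x y := by decide

lemma adj5_symm : ∀ {x y : Fin 5}, adj5 x y → adj5 y x := by decide

/-- Adjacency (on natural numbers) in the 5-cycle `0 1 2 3 4` with a pendant vertex `5`
attached to `4`. -/
def adjN (x y : ℕ) : Bool :=
  (decide (x < 5) && decide (y < 5) && (((x + 1) % 5 == y) || ((y + 1) % 5 == x)))
    || (x == 4 && y == 5) || (x == 5 && y == 4)

/-- The 5-cycle with a pendant vertex. -/
def adj6 (x y : Fin 6) : Prop := adjN x.val y.val = true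

instance (x y : Fin 6) : Decidable (adj6 x y) := by unfold adj6; infer_instance

lemma adj6_symm : ∀ {x y : Fin 6}, adj6 x y → adj6 y x := by decide

lemma adj6_irrefl : ∀ {x : Fin 6}, ¬ adj6 x x := by decide

lemma adj6_castSucc : ∀ {x y : Fin 5}, adj5 x y → adj6 x.castSucc y.castSucc := by decide

lemma adj5_of_adj6 : ∀ {x y : Fin 5}, adj6 x.castSucc y.castSucc → adj5 x y := by decide

/-- Potential of the subgraph of the auxiliary graph induced by `A`. -/
def pY (A : Finset (Fin 6)) : ℤ :=
  5 * (A.card : ℤ) - 2 * (((A ×ˢ A).filter (fun q => adj6 q.1 q.2)).card : ℤ)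

lemma pY_nonempty : ∀ A : Finset (Fin 6), A.Nonempty → 5 ≤ pY A := by decide +kernel

lemma pY_two : ∀ A : Finset (Fin 6), 5 ∈ A → ∀ y ∈ A, y ≠ 5 → 6 ≤ pY A := by decide +kernel

lemma pY_three : ∀ A : Finset (Fin 6), 5 ∈ A → ∀ y ∈ A, y ≠ 5 → y ≠ 4 →
    7 ≤ pY A ∨ (6 ≤ pY A ∧ A.card = 6) := by decide +kernel

/-- Edge list of `E₁` (`true`) or `E₂` (`false`). -/
def elist (i : Bool) : List (ℕ × ℕ) :=
  bif i then [(0,1), (1,2), (2,3), (3,4), (4,5), (5,6), (6,7), (7,8), (8,0), (9,0), (9,3), (9,6)]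
  else [(0,1), (1,2), (2,3), (3,4), (4,0), (1,5), (5,6), (6,7), (7,0), (3,8), (8,9), (9,6)]

/-- Symmetric adjacency from an edge list. -/
def ladj (l : List (ℕ × ℕ)) (x y : ℕ) : Bool :=
  l.any (fun e => (e.1 == x && e.2 == y) || (e.1 == y && e.2 == x))

/-- `E₁` or `E₂`. -/
def EE (i : Bool) : SimpleGraph (Fin 10) := bif i then E1 else E2

lemma EE_adj (i : Bool) (x y : Fin 10) : (EE i).Adj x y ↔ ladj (elist i) x.val y.val = true := by
  cases i
  · simp only [EE, cond_false, E2, SimpleGraph.fromEdgeSet_adj, Set.mem_insert_iff,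
      Set.mem_singleton_iff]
    revert x y
    decide +kernel
  · simp only [EE, cond_true, E1, SimpleGraph.fromEdgeSet_adj, Set.mem_insert_iff,
      Set.mem_singleton_iff]
    revert x y
    decide +kernel

/-- Edge list of `E_i` with the edge `aw` replaced by the path `a 10 11 12 13 w`. -/
def qlist (i : Bool) (a w : ℕ) : List (ℕ × ℕ) :=
  (elist i).filter (fun e => !((e.1 == a && e.2 == w) || (e.1 == w && e.2 == a))) ++
    [(a, 10), (10, 11), (11, 12), (12, 13), (13, w)]

/-- Certificates for `E₁`: for every ordered edge, colourings of the 14-vertex graph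
written in decimal, the digit at place `i` being the colour of vertex `i`. -/
def cert1 : List ((ℕ × ℕ) × List ℕ × List ℕ) :=
  [((0, 1), [45400234321231, 45402043401231], [40120234321231, 10431340432122, 40102043401231]),
   ((1, 0), [45434123210120, 45431432340120], [10431340432122, 10434123210120, 10433104012122]),
   ((1, 2), [45430234321021, 45432043401021], [10430234321221, 40121340432312, 10432043401021]),
   ((2, 1), [45430234321201, 45432043401201], [10430234321221, 40121340432132, 10432043401201]),
   ((2, 3), [45434123210210, 45431432340210], [10431340432212, 10434123210210, 10433104012212]),
   ((3, 2), [45400234321321, 45402043401321], [40120234321321, 10431340432212, 40102043401321]),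
   ((3, 4), [45433012102104, 45431432102340], [40124123233210, 10430234324321, 10122043403401]),
   ((4, 3), [45404123213210, 45402043213401], [40124123213210, 40122043213401, 10431340120432]),
   ((4, 5), [45403012312104, 45401432312340], [10434123223210, 40120234334321, 10432043223401]),
   ((5, 4), [45403012132104, 45401432132340], [10434123223210, 40120234334321, 10432043223401]),
   ((5, 6), [45404123123210, 45402043123401], [40124123123210, 40122043123401, 10431340210432]),
   ((6, 5), [45433012012104, 45431432012340], [40124123323210, 10430234234321, 40122043323401]),
   ((6, 7), [45400231234321, 45402231043401], [40120231234321, 10431122340432, 40102231043401]),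
   ((7, 6), [45434120123210, 45431120432340], [10431122340432, 10434120123210, 10433122104012]),
   ((7, 8), [45430021234321, 45432021043401], [10430221234321, 40121312340432, 10432021043401]),
   ((8, 7), [45430201234321, 45432201043401], [10430221234321, 40121132340432, 10432201043401]),
   ((8, 0), [45434210123210, 45431210432340], [10431212340432, 10434210123210, 10433212104012]),
   ((0, 8), [45400321234321, 45402321043401], [40120321234321, 10431212340432, 40102321043401]),
   ((9, 0), [45432123401010, 45432101043210], [10432123401212, 10434340123212, 10432101043210]),
   ((0, 9), [45403234012101, 45403012104321], [40123234012121, 40123212104321, 10430104321012]),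
   ((9, 3), [45401432123210, 45432043210101], [40121432123210, 10432043212121, 40101340123212]),
   ((3, 9), [45430234012101, 45430321012104], [10432043212121, 40123104321212, 10430234012101]),
   ((9, 6), [45401123212340, 45432010123401], [10434432123210, 10432212123401, 10123340104012]),
   ((6, 9), [45430012104321, 45403321012104], [10432212123401, 40123121234012, 10430012104321])]

/-- Certificates for `E₂`. -/
def cert2 : List ((ℕ × ℕ) × List ℕ × List ℕ) :=
  [((0, 1), [45404023201231, 45400401223231], [40124023221231, 40120421223231, 10433412110102]),
   ((1, 0), [45433412110120, 45434310112120], [10433412110122, 10434310112122, 10430134312122]),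
   ((1, 2), [45402143212310, 45433204301021], [40122143212310, 10433204321221, 40100134012312]),
   ((2, 1), [45431032101204, 45434023401201], [10433204321221, 40124310412132, 10434023401201]),
   ((2, 3), [45432143210210, 45403204323121], [10432143212210, 40123204323121, 10430134010212]),
   ((3, 2), [45432143212010, 45403204301321], [10432143212210, 40123204321321, 10430134012012]),
   ((3, 4), [45432123402101, 45430104302121], [10432123422101, 40123234031212, 10430104302121]),
   ((4, 3), [45432123420101, 45430104320121], [10432123422101, 40123234013212, 10430104320121]),
   ((4, 0), [45431012321040, 45434043221010], [10433234021212, 10431210421232, 10434043221010]),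
   ((0, 4), [45402123432101, 45400104332121], [40122123432101, 10433234021212, 40100104332121]),
   ((1, 5), [45401212343210, 45432301004321], [40121212343210, 10432321204321, 40101012334012]),
   ((5, 1), [45430101232104, 45430401223401], [10432321204321, 40123412110432, 10430401223401]),
   ((5, 6), [45431210243210, 45404023104321], [10431212243210, 40122323104321, 10431010234012]),
   ((6, 5), [45431212043210, 45402301304321], [10431212243210, 40122321304321, 10431012034012]),
   ((6, 7), [45431202123401, 45431002104321], [10431222123401, 40122331234012, 10431002104321]),
   ((7, 6), [45431220123401, 45431020104321], [10431222123401, 40122313234012, 10431020104321]),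
   ((7, 0), [45430121012340, 45430421043210], [10432321234012, 10432121210432, 10430421043210]),
   ((0, 7), [45401232123401, 45401032104321], [40121232123401, 10432321234012, 40101032104321]),
   ((3, 8), [45431012312340, 45431032132104], [40122343243210, 40122323423401, 10103204304321]),
   ((8, 3), [45402143243210, 45402123423401], [40122143243210, 40122123423401, 10431210410432]),
   ((8, 9), [45403112312340, 45403132132104], [10432243243210, 10432223423401, 10120304304321]),
   ((9, 8), [45401312312340, 45401332132104], [10432243243210, 10432223423401, 10123004304321]),
   ((9, 6), [45401243243210, 45401223423401], [40121243243210, 40121223423401, 10432110410432]),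
   ((6, 9), [45430112312340, 45430132132104], [40123243243210, 40123223423401, 10102304304321])]

/-- The `i`-th decimal digit. -/
def dig (n i : ℕ) : ℕ := n / 10 ^ i % 10

/-- The digits of `n` are a homomorphism to the auxiliary graph. -/
def okcol (l : List (ℕ × ℕ)) (n : ℕ) : Bool :=
  l.all (fun e => adjN (dig n e.1) (dig n e.2))

/-- Verification of one certificate. -/
def chk (i : Bool) (c : (ℕ × ℕ) × List ℕ × List ℕ) : Bool :=
  let l := qlist i c.1.1 c.1.2
  (c.2.1.all (fun n => okcol l n && dig n 12 == 5 && dig n 11 == 4 && dig n 13 == 4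
      && (List.range 14).all (fun j => j == 12 || decide (dig n j < 5)))) &&
  ((List.range 11).all (fun y => c.2.1.any (fun n => dig n y != 4))) &&
  (c.2.2.all (fun n => okcol l n && (List.range 14).all (fun j => decide (dig n j < 5)))) &&
  ((List.range 11).all (fun y => (List.range 11).all (fun z => c.2.2.any (fun n =>
      dig n y != dig n 12 && dig n z != dig n 12))))

/-- The certificates. -/
def cert (i : Bool) : List ((ℕ × ℕ) × List ℕ × List ℕ) := bif i then cert1 else cert2

lemma chk_all (i : Bool) : (cert i).all (chk i) = true := by
  cases i <;> decide +kernel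

lemma cert_dom : ∀ (i : Bool) (a w : Fin 10), ladj (elist i) a.val w.val = true →
    (cert i).any (fun c => c.1.1 == a.val && c.1.2 == w.val) = true := by decide +kernel

lemma qcount : ∀ (i : Bool) (a w : Fin 10), ladj (elist i) a.val w.val = true →
    ((Finset.univ : Finset (Fin 14 × Fin 14)).filter
      (fun q => ladj (qlist i a.val w.val) q.1.val q.2.val = true)).card = 32 := by
  decide +kernel

lemma ecount : ∀ (i : Bool), ((Finset.univ : Finset (Fin 10 × Fin 10)).filter
      (fun q => ladj (elist i) q.1.val q.2.val = true)).card = 24 := by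
  decide +kernel

lemma edeg : ∀ (i : Bool) (w : Fin 10), ((Finset.univ : Finset (Fin 10)).filter
      (fun q => ladj (elist i) w.val q.val = true)).card ≤ 3 := by
  decide +kernel

lemma okcol_spec {l : List (ℕ × ℕ)} {n : ℕ} (h : okcol l n = true) {x y : ℕ}
    (hxy : ladj l x y = true) : adjN (dig n x) (dig n y) = true := by
  simp only [okcol, List.all_eq_true] at h
  simp only [ladj, List.any_eq_true, Bool.or_eq_true, Bool.and_eq_true, beq_iff_eq] at hxy
  obtain ⟨e, he, h1 | h1⟩ := hxy
  · have := h e he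
    rwa [h1.1, h1.2] at this
  · have := h e he
    rw [h1.1, h1.2] at this
    have hs : ∀ p q : ℕ, adjN p q = adjN q p := by
      intro p q
      simp only [adjN]
      grind
    rwa [hs]

lemma get_cert (i : Bool) (a w : Fin 10) (h : (EE i).Adj a w) :
    ∃ c ∈ cert i, c.1.1 = a.val ∧ c.1.2 = w.val ∧ chk i c = true := by
  have h1 := cert_dom i a w ((EE_adj i a w).1 h)
  simp only [List.any_eq_true, Bool.and_eq_true, beq_iff_eq] at h1
  obtain ⟨c, hc, h2, h3⟩ := h1
  exact ⟨c, hc, h2, h3, (List.all_eq_true.1 (chk_all i)) c hc⟩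

/-- Pendant colourings of the 14-vertex graph. -/
lemma col_pendant (i : Bool) (a w : Fin 10) (h : (EE i).Adj a w) (y : Fin 14) (hy : y.val < 11) :
    ∃ χ : Fin 14 → Fin 6,
      (∀ x z : Fin 14, ladj (qlist i a.val w.val) x.val z.val = true → adj6 (χ x) (χ z)) ∧
      χ 12 = 5 ∧ χ 11 = 4 ∧ χ 13 = 4 ∧ (∀ j, j ≠ 12 → χ j ≠ 5) ∧ χ y ≠ 4 := by
  obtain ⟨c, -, h1, h2, h3⟩ := get_cert i a w h
  simp only [chk, Bool.and_eq_true, h1, h2] at h3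
  obtain ⟨⟨⟨h3, h4⟩, -⟩, -⟩ := h3
  have h5 := (List.all_eq_true.1 h4) y.val (List.mem_range.2 hy)
  simp only [List.any_eq_true, bne_iff_ne] at h5
  obtain ⟨n, hn, h6⟩ := h5
  have h7 := (List.all_eq_true.1 h3) n hn
  simp only [Bool.and_eq_true, beq_iff_eq, List.all_eq_true, List.mem_range, Bool.or_eq_true,
    decide_eq_true_eq] at h7
  obtain ⟨⟨⟨⟨h8, h9⟩, h10⟩, h11⟩, h12⟩ := h7
  have hlt : ∀ j : Fin 14, dig n j.val < 6 := by
    intro j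
    rcases h12 j.val j.isLt with h | h
    · rw [h, h9]; norm_num
    · omega
  refine ⟨fun j => ⟨dig n j.val, hlt j⟩, ?_, ?_, ?_, ?_, ?_, ?_⟩
  · intro x z hxz
    exact okcol_spec h8 hxz
  · exact Fin.ext h9
  · exact Fin.ext h10
  · exact Fin.ext h11
  · intro j hj h
    have h' : dig n j.val = 5 := congrArg Fin.val h
    rcases h12 j.val j.isLt with h | h
    · exact hj (Fin.ext h)
    · omega
  · intro h
    exact h6 (congrArg Fin.val h)

/-- 5-colourings of the 14-vertex graph. -/
lemma col_full (i : Bool) (a w : Fin 10) (h : (EE i).Adj a w) (y z : Fin 14) (hy : y.val < 11)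
    (hz : z.val < 11) :
    ∃ χ : Fin 14 → Fin 5,
      (∀ x z : Fin 14, ladj (qlist i a.val w.val) x.val z.val = true → adj5 (χ x) (χ z)) ∧
      χ 12 ≠ χ y ∧ χ 12 ≠ χ z := by
  obtain ⟨c, -, h1, h2, h3⟩ := get_cert i a w h
  simp only [chk, Bool.and_eq_true, h1, h2] at h3
  obtain ⟨⟨-, h3⟩, h4⟩ := h3
  have h5 := (List.all_eq_true.1 ((List.all_eq_true.1 h4) y.val (List.mem_range.2 hy)))
    z.val (List.mem_range.2 hz)
  simp only [List.any_eq_true, bne_iff_ne, Bool.and_eq_true] at h5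
  obtain ⟨n, hn, h6, h6'⟩ := h5
  have h7 := (List.all_eq_true.1 h3) n hn
  simp only [Bool.and_eq_true, List.all_eq_true, List.mem_range,
    decide_eq_true_eq] at h7
  obtain ⟨h8, h12⟩ := h7
  refine ⟨fun j => ⟨dig n j.val, h12 j.val j.isLt⟩, ?_, ?_, ?_⟩
  · intro x z hxz
    exact adj5_of_adj6 (x := ⟨dig n x.val, h12 x.val x.isLt⟩) (y := ⟨dig n z.val, h12 z.val z.isLt⟩)
      (okcol_spec h8 hxz)
  · intro h
    exact h6 (congrArg Fin.val h).symm
  · intro h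
    exact h6' (congrArg Fin.val h).symm

lemma norm_col : ∀ x y : Fin 5, x ≠ y → ¬ adj5 x y →
    ∃ k l : Fin 5, (∀ p q : Fin 5, adj5 p q → adj5 (k * p + l) (k * q + l)) ∧
      k * x + l = 0 ∧ k * y + l = 2 := by decide +kernel

lemma rot_col : ∀ x y : Fin 5, ∃ l : Fin 5,
    (∀ p q : Fin 5, adj5 p q → adj5 (p + l) (q + l)) ∧ x + l = y := by decide +kernel

lemma mid2 : ∀ x y : Fin 5, ¬ adj5 x y → ∃ m : Fin 5, adj5 x m ∧ adj5 m y := by decide +kernel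

lemma mid3 : ∀ x y : Fin 5, x ≠ y → ∃ m n : Fin 5, adj5 x m ∧ adj5 m n ∧ adj5 n y := by
  decide +kernel

lemma mid4 : ∀ x y : Fin 5, ∃ m n k : Fin 5, adj5 x m ∧ adj5 m n ∧ adj5 n k ∧ adj5 k y := by
  decide +kernel

lemma exists_adj5 : ∀ x : Fin 5, ∃ m : Fin 5, adj5 m x := by decide +kernel

lemma no_tri : ∀ x y z : Fin 5, adj5 x y → adj5 y z → adj5 x z → False := by decide +kernel

lemma c3_adj : ∀ x y : Fin 3, (cycleGraph 3).Adj x y ↔ x ≠ y := by decide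

lemma c3count : ((Finset.univ : Finset (Fin 3 × Fin 3)).filter
      (fun q => q.1 ≠ q.2)).card = 6 := by decide
section machinery

open scoped Classical

variable {V Z : Type} [Fintype V] [Fintype Z]

/-- Colourability by the 5-cycle. -/
def Colb {Z : Type} (K : SimpleGraph Z) : Prop :=
  ∃ c : Z → Fin 5, ∀ a b, K.Adj a b → adj5 (c a) (c b)

/-- `c` is a 5-cycle colouring of `G` restricted to `S`. -/
def ColOn {V : Type} (G : SimpleGraph V) (S : Set V) (c : V → Fin 5) : Prop :=
  ∀ a ∈ S, ∀ b ∈ S, G.Adj a b → adj5 (c a) (c b)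

lemma colb_iff {Z : Type} (K : SimpleGraph Z) : Nonempty (K →g cycleGraph 5) ↔ Colb K := by
  constructor
  · rintro ⟨f⟩
    exact ⟨f, fun a b h => (cycle5_adj _ _).1 (f.map_adj h)⟩
  · rintro ⟨c, hc⟩
    exact ⟨⟨c, fun h => (cycle5_adj _ _).2 (hc _ _ h)⟩⟩

lemma crit_not_colb {V : Type} {G : SimpleGraph V} (h : Critical52 G) : ¬ Colb G := by
  intro hc
  exact h.1.false ((colb_iff G).2 hc).some

lemma crit_colOn {V : Type} {G : SimpleGraph V} (h : Critical52 G) (S : Set V)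
    (hS : S ≠ Set.univ) : ∃ c, ColOn G S c := by
  have h1 : (⊤ : G.Subgraph).induce S ≠ ⊤ := by
    intro h2
    apply hS
    have := congrArg Subgraph.verts h2
    simpa using this
  obtain ⟨f⟩ := h.2 _ h1
  refine ⟨fun x => if hx : x ∈ S then f ⟨x, hx⟩ else 0, ?_⟩
  intro a ha b hb hab
  simp only [ha, hb, dif_pos]
  apply (cycle5_adj _ _).1
  apply f.map_adj
  simp [ha, hb, hab]

/-- Ordered adjacent pairs inside `S`. -/
noncomputable def prs {V : Type} (G : SimpleGraph V) (S : Finset V) : Finset (V × V) :=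
  (S ×ˢ S).filter (fun q => G.Adj q.1 q.2)

lemma mem_prs {V : Type} {G : SimpleGraph V} {S : Finset V} {q : V × V} :
    q ∈ prs G S ↔ (q.1 ∈ S ∧ q.2 ∈ S) ∧ G.Adj q.1 q.2 := by
  simp [prs]

/-- Potential of the subgraph of `G` induced by `S`. -/
noncomputable def PP {V : Type} (G : SimpleGraph V) (S : Finset V) : ℤ :=
  5 * (S.card : ℤ) - 2 * ((prs G S).card : ℤ)

lemma prs_univ_card (K : SimpleGraph Z) :
    (prs K Finset.univ).card = 2 * K.edgeSet.ncard := by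
  have h1 : K.edgeSet.ncard = K.edgeFinset.card := by
    rw [← SimpleGraph.coe_edgeFinset, Set.ncard_coe_finset]
  rw [h1, ← K.dart_card_eq_twice_card_edges, ← Finset.card_univ]
  symm
  apply Finset.card_bij (fun d _ => d.toProd)
  · intro d _
    simp [mem_prs, d.adj]
  · intro d _ d' _ h
    exact SimpleGraph.Dart.ext _ _ h
  · intro q hq
    exact ⟨⟨q, (mem_prs.1 hq).2⟩, by simp, rfl⟩

lemma pot_eq (G : SimpleGraph V) : pot G = PP G Finset.univ := by
  simp only [pot, PP, prs_univ_card, Finset.card_univ]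
  push_cast
  ring

lemma count_lift [Nonempty V] {G : SimpleGraph V} (f : V → Z) (K : SimpleGraph Z) (S S' : Finset V)
    (B : Finset (Z × Z)) (hS : S ⊆ S')
    (hl : ∀ z z', K.Adj z z' → (z, z') ∉ B → ∃ a b, G.Adj a b ∧ f a = z ∧ f b = z' ∧
      a ∈ S' ∧ b ∈ S' ∧ ¬ (a ∈ S ∧ b ∈ S))
    (T : Finset (V × V)) (hT : ∀ q ∈ T, q ∈ prs G S' ∧ ¬ (q.1 ∈ S ∧ q.2 ∈ S) ∧
      ¬ K.Adj (f q.1) (f q.2)) :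
    (prs G S).card + (prs K Finset.univ).card + T.card ≤ (prs G S').card + B.card := by
  have hl' : ∀ q : Z × Z, ∃ r : V × V, q ∈ prs K Finset.univ \ B →
      r ∈ prs G S' ∧ f r.1 = q.1 ∧ f r.2 = q.2 ∧ ¬ (r.1 ∈ S ∧ r.2 ∈ S) := by
    intro q
    by_cases hq : q ∈ prs K Finset.univ \ B
    · rw [Finset.mem_sdiff, mem_prs] at hq
      obtain ⟨a, b, h1, h2, h3, h4, h5, h6⟩ := hl q.1 q.2 hq.1.2 hq.2
      exact ⟨(a, b), fun _ => ⟨mem_prs.2 ⟨⟨h4, h5⟩, h1⟩, h2, h3, h6⟩⟩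
    · exact ⟨Classical.arbitrary (V × V), fun h => absurd h hq⟩
  choose g hg using hl'
  set L := (prs K Finset.univ \ B).image g with hL
  have hLc : L.card = (prs K Finset.univ \ B).card := by
    apply Finset.card_image_of_injOn
    intro q hq q' hq' h
    have h1 := hg q hq
    have h2 := hg q' hq'
    rw [h] at h1
    ext1
    · rw [← h1.2.1, h2.2.1]
    · rw [← h1.2.2.1, h2.2.2.1]
  have hLm : ∀ r ∈ L, r ∈ prs G S' ∧ K.Adj (f r.1) (f r.2) ∧ ¬ (r.1 ∈ S ∧ r.2 ∈ S) := by
    intro r hr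
    rw [hL, Finset.mem_image] at hr
    obtain ⟨q, hq, rfl⟩ := hr
    have h1 := hg q hq
    refine ⟨h1.1, ?_, h1.2.2.2⟩
    rw [h1.2.1, h1.2.2.1]
    rw [Finset.mem_sdiff, mem_prs] at hq
    exact hq.1.2
  have hd1 : Disjoint (prs G S) L := by
    rw [Finset.disjoint_left]
    intro r h1 h2
    exact (hLm r h2).2.2 (mem_prs.1 h1).1
  have hd2 : Disjoint (prs G S ∪ L) T := by
    rw [Finset.disjoint_left]
    intro r h1 h2
    rcases Finset.mem_union.1 h1 with h1 | h1
    · exact (hT r h2).2.1 (mem_prs.1 h1).1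
    · exact (hT r h2).2.2 (hLm r h1).2.1
  have hsub : prs G S ∪ L ∪ T ⊆ prs G S' := by
    intro r hr
    rcases Finset.mem_union.1 hr with hr | hr
    · rcases Finset.mem_union.1 hr with hr | hr
      · rw [mem_prs] at hr ⊢
        exact ⟨⟨hS hr.1.1, hS hr.1.2⟩, hr.2⟩
      · exact (hLm r hr).1
    · exact (hT r hr).1
  have h1 := Finset.card_le_card hsub
  rw [Finset.card_union_of_disjoint hd2, Finset.card_union_of_disjoint hd1, hLc] at h1
  have h2 := Finset.le_card_sdiff B (prs K Finset.univ)
  omega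

/-- Vertices of positive degree. -/
noncomputable def supp {Z : Type} [Fintype Z] (K : SimpleGraph Z) : Finset Z :=
  Finset.univ.filter (fun z => ∃ z', K.Adj z z')

lemma mem_supp {K : SimpleGraph Z} {z : Z} : z ∈ supp K ↔ ∃ z', K.Adj z z' := by
  simp [supp]

/-- Minimal non-colourable graphs (up to isolated vertices). -/
def MinU {Z : Type} (K : SimpleGraph Z) : Prop := ¬ Colb K ∧ ∀ K' < K, Colb K'

lemma exists_minU (K : SimpleGraph Z) (h : ¬ Colb K) : ∃ K' ≤ K, MinU K' := by
  obtain ⟨K', h1, h2⟩ := exists_minimal_le_of_wellFoundedLT (fun K : SimpleGraph Z => ¬ Colb K) K h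
  refine ⟨K', h1, h2.1, ?_⟩
  intro K'' h3
  by_contra h4
  exact absurd (h2.2 h4 h3.le) (not_le_of_gt h3)

lemma minU_deg {K : SimpleGraph Z} (h : MinU K) {x y : Z} (hxy : K.Adj x y) :
    ∃ z, z ≠ y ∧ K.Adj x z := by
  by_contra hcon
  push Not at hcon
  have hlt : K.deleteEdges {s(x, y)} < K := by
    refine lt_of_le_of_ne (K.deleteEdges_le _) ?_
    intro h1
    have : (K.deleteEdges {s(x, y)}).Adj x y := by rw [h1]; exact hxy
    simp at this
  obtain ⟨c, hc⟩ := h.2 _ hlt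
  obtain ⟨m, hm⟩ := exists_adj5 (c y)
  apply h.1
  have hx : ∀ b, K.Adj x b → b = y := fun b hb => by
    by_contra h2
    exact hcon b h2 hb
  refine ⟨fun z => if z = x then m else c z, ?_⟩
  intro a b hab
  by_cases ha : a = x
  · subst ha
    have := hx b hab
    subst this
    have hb : b ≠ a := hab.ne'
    simp [hb, hm]
  · by_cases hb : b = x
    · subst hb
      have := hx a hab.symm
      subst this
      simp [ha, adj5_symm hm]
    · simp only [ha, hb, if_false]
      apply hc
      simp [hab, ha, hb]

/-- Critical graphs smaller than a smallest counterexample. -/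
lemma apply_min {G : SimpleGraph V} (h : SmallestCex G) {K : SimpleGraph Z} (hK : MinU K)
    (hn : (supp K).card < Fintype.card V) :
    5 * ((supp K).card : ℤ) - 2 * ((prs K Finset.univ).card : ℤ) ≤ 1 ∨
    ((supp K).card = 3 ∧ (prs K Finset.univ).card = 6 ∧
      ∃ e : Fin 3 → Z, Function.Injective e ∧ (∀ z, z ∈ supp K ↔ ∃ i, e i = z) ∧
        ∀ i j, i ≠ j → K.Adj (e i) (e j)) ∨
    ((supp K).card = 10 ∧ (prs K Finset.univ).card = 24 ∧
      ∃ (i : Bool) (e : Fin 10 → Z), Function.Injective e ∧ (∀ z, z ∈ supp K ↔ ∃ i, e i = z) ∧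
        ∀ a b, K.Adj (e a) (e b) ↔ (EE i).Adj a b) := by
  set n := (supp K).card with hndef
  let g : Fin n ≃ supp K := (supp K).equivFin.symm
  let H : SimpleGraph (Fin n) := K.comap (fun i => (g i : Z))
  have hHadj : ∀ i j, H.Adj i j ↔ K.Adj (g i) (g j) := fun i j => Iff.rfl
  have hgsurj : ∀ z, z ∈ supp K → ∃ i, (g i : Z) = z := by
    intro z hz
    exact ⟨g.symm ⟨z, hz⟩, by simp⟩
  have hginj : Function.Injective (fun i => (g i : Z)) := fun i j hij =>
    g.injective (Subtype.ext hij)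
  have hcrit : Critical52 H := by
    constructor
    · constructor
      intro f
      apply hK.1
      refine ⟨fun z => if hz : z ∈ supp K then f (g.symm ⟨z, hz⟩) else 0, ?_⟩
      intro a b hab
      have ha : a ∈ supp K := mem_supp.2 ⟨b, hab⟩
      have hb : b ∈ supp K := mem_supp.2 ⟨a, hab.symm⟩
      simp only [ha, hb, dif_pos]
      apply (cycle5_adj _ _).1
      apply f.map_adj
      rw [hHadj]
      simpa using hab
    · intro M hM
      let K' : SimpleGraph Z :=
        { Adj := fun a b => ∃ i j, (g i : Z) = a ∧ (g j : Z) = b ∧ M.Adj i j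
          symm := ⟨fun a b ⟨i, j, h1, h2, h3⟩ => ⟨j, i, h2, h1, h3.symm⟩⟩
          loopless := ⟨fun a ⟨i, j, h1, h2, h3⟩ => h3.ne (hginj (h1.trans h2.symm))⟩ }
      have hle : K' ≤ K := by
        rintro a b ⟨i, j, rfl, rfl, h3⟩
        exact (hHadj i j).1 h3.adj_sub
      have hne : K' ≠ K := by
        intro heq
        apply hM
        have hadj : ∀ i j, H.Adj i j → M.Adj i j := by
          intro i j hij
          have : K'.Adj (g i) (g j) := by rw [heq]; exact hij
          obtain ⟨i', j', h1, h2, h3⟩ := this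
          rw [← hginj h1, ← hginj h2]
          exact h3
        apply Subgraph.ext
        · ext i
          simp only [Subgraph.verts_top, Set.mem_univ, iff_true]
          obtain ⟨z, hz⟩ := mem_supp.1 (g i).2
          obtain ⟨j, rfl⟩ := hgsurj z (mem_supp.2 ⟨_, hz.symm⟩)
          exact (hadj i j hz).fst_mem
        · ext i j
          exact ⟨fun h => h.adj_sub, fun h => hadj i j h⟩
      obtain ⟨c, hc⟩ := hK.2 K' (lt_of_le_of_ne hle hne)
      refine ⟨⟨fun i => c (g i.1), ?_⟩⟩
      intro i j hij
      exact (cycle5_adj _ _).2 (hc _ _ ⟨i, j, rfl, rfl, hij⟩)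
  have hcnt : (prs K Finset.univ).card = (prs H Finset.univ).card := by
    symm
    apply Finset.card_bij (fun q _ => ((g q.1 : Z), (g q.2 : Z)))
    · intro q hq
      rw [mem_prs] at hq ⊢
      exact ⟨by simp, hq.2⟩
    · intro q _ q' _ hqq
      rw [Prod.mk.injEq] at hqq
      exact Prod.ext (hginj hqq.1) (hginj hqq.2)
    · intro q hq
      have hq := (mem_prs.1 hq).2
      obtain ⟨i, hi⟩ := hgsurj q.1 (mem_supp.2 ⟨_, hq⟩)
      obtain ⟨j, hj⟩ := hgsurj q.2 (mem_supp.2 ⟨_, hq.symm⟩)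
      refine ⟨(i, j), ?_, ?_⟩
      · rw [mem_prs]
        refine ⟨by simp, ?_⟩
        rw [hHadj]
        simp only [hi, hj]
        exact hq
      · simp [hi, hj]
  have hiso : ∀ (k : ℕ) (J : SimpleGraph (Fin k)), Nonempty (H ≃g J) →
      n = k ∧ (prs K Finset.univ).card = (prs J Finset.univ).card ∧
      ∃ e : Fin k → Z, Function.Injective e ∧ (∀ z, z ∈ supp K ↔ ∃ i, e i = z) ∧
        ∀ a b, K.Adj (e a) (e b) ↔ J.Adj a b := by
    rintro k J ⟨φ⟩
    refine ⟨?_, ?_, fun i => (g (φ.symm i) : Z), ?_, ?_, ?_⟩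
    · have := Fintype.card_congr φ.toEquiv
      simpa using this
    · rw [hcnt]
      apply Finset.card_bij (fun q _ => (φ q.1, φ q.2))
      · intro q hq
        rw [mem_prs] at hq ⊢
        exact ⟨by simp, φ.map_adj_iff.2 hq.2⟩
      · intro q _ q' _ hqq
        rw [Prod.mk.injEq] at hqq
        exact Prod.ext (φ.injective hqq.1) (φ.injective hqq.2)
      · intro q hq
        refine ⟨(φ.symm q.1, φ.symm q.2), ?_, by simp⟩
        rw [mem_prs] at hq ⊢
        exact ⟨by simp, φ.symm.map_adj_iff.2 hq.2⟩
    · intro i j hij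
      exact φ.symm.injective (hginj hij)
    · intro z
      constructor
      · intro hz
        obtain ⟨i, rfl⟩ := hgsurj z hz
        exact ⟨φ i, by simp⟩
      · rintro ⟨i, rfl⟩
        exact (g _).2
    · intro a b
      rw [← hHadj]
      exact φ.symm.map_adj_iff
  by_cases h3 : IsEmpty (H ≃g cycleGraph 3)
  · by_cases h1 : IsEmpty (H ≃g E1)
    · by_cases h2 : IsEmpty (H ≃g E2)
      · left
        have := h.2.2.2.2.2 n H hcrit h3 h1 h2 hn
        rw [pot_eq, PP] at this
        rw [hcnt]
        simpa using this
      · right; right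
        rw [not_isEmpty_iff] at h2
        obtain ⟨a1, a2, e, a3, a4, a5⟩ := hiso 10 E2 h2
        refine ⟨a1, ?_, false, e, a3, a4, a5⟩
        rw [a2, ← ecount false]
        congr 1
        ext q
        simp only [mem_prs, Finset.mem_univ, Finset.mem_filter, true_and]
        exact EE_adj false q.1 q.2
    · right; right
      rw [not_isEmpty_iff] at h1
      obtain ⟨a1, a2, e, a3, a4, a5⟩ := hiso 10 E1 h1
      refine ⟨a1, ?_, true, e, a3, a4, a5⟩
      rw [a2, ← ecount true]
      congr 1
      ext q
      simp only [mem_prs, Finset.mem_univ, Finset.mem_filter, true_and]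
      exact EE_adj true q.1 q.2
  · right; left
    rw [not_isEmpty_iff] at h3
    obtain ⟨a1, a2, e, a3, a4, a5⟩ := hiso 3 _ h3
    refine ⟨a1, ?_, e, a3, a4, ?_⟩
    · rw [a2, ← c3count]
      congr 1
      ext q
      simp only [mem_prs, Finset.mem_univ, Finset.mem_filter, true_and]
      exact c3_adj _ _
    · intro i j hij
      rw [a5, c3_adj]
      exact hij

end machinery
section folding

open scoped Classical

variable {V Z : Type} [Fintype V] [Fintype Z]

lemma PP_insert {V : Type} (G : SimpleGraph V) (S N : Finset V) (x : V) (hx : x ∉ S) (hN : N ⊆ S)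
    (hadj : ∀ a ∈ N, G.Adj x a) : PP G (insert x S) ≤ PP G S + 5 - 4 * (N.card : ℤ) := by
  have hd1 : Disjoint (prs G S) (N.image (fun a => (x, a))) := by
    rw [Finset.disjoint_left]
    intro r h1 h2
    obtain ⟨a, ha, rfl⟩ := Finset.mem_image.1 h2
    exact hx (mem_prs.1 h1).1.1
  have hd2 : Disjoint (prs G S ∪ N.image (fun a => (x, a))) (N.image (fun a => (a, x))) := by
    rw [Finset.disjoint_left]
    intro r h1 h2
    obtain ⟨a, ha, rfl⟩ := Finset.mem_image.1 h2
    rcases Finset.mem_union.1 h1 with h1 | h1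
    · exact hx (mem_prs.1 h1).1.2
    · obtain ⟨b, hb, h3⟩ := Finset.mem_image.1 h1
      rw [Prod.mk.injEq] at h3
      exact hx (h3.1 ▸ hN ha)
  have hsub : prs G S ∪ N.image (fun a => (x, a)) ∪ N.image (fun a => (a, x)) ⊆
      prs G (insert x S) := by
    intro r hr
    rw [mem_prs]
    rcases Finset.mem_union.1 hr with hr | hr
    · rcases Finset.mem_union.1 hr with hr | hr
      · have := mem_prs.1 hr
        exact ⟨⟨Finset.mem_insert_of_mem this.1.1, Finset.mem_insert_of_mem this.1.2⟩, this.2⟩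
      · obtain ⟨a, ha, rfl⟩ := Finset.mem_image.1 hr
        exact ⟨⟨Finset.mem_insert_self _ _, Finset.mem_insert_of_mem (hN ha)⟩, hadj a ha⟩
    · obtain ⟨a, ha, rfl⟩ := Finset.mem_image.1 hr
      exact ⟨⟨Finset.mem_insert_of_mem (hN ha), Finset.mem_insert_self _ _⟩, (hadj a ha).symm⟩
  have h1 := Finset.card_le_card hsub
  rw [Finset.card_union_of_disjoint hd2, Finset.card_union_of_disjoint hd1,
    Finset.card_image_of_injective _ (fun a b h => (Prod.mk.injEq _ _ _ _ ▸ h).2),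
    Finset.card_image_of_injective _ (fun a b h => (Prod.mk.injEq _ _ _ _ ▸ h).1)] at h1
  simp only [PP, Finset.card_insert_of_notMem hx]
  push_cast
  omega

lemma PP_insert1 {V : Type} {G : SimpleGraph V} {S : Finset V} {x a : V} (hx : x ∉ S) (ha : a ∈ S)
    (h1 : G.Adj x a) : PP G (insert x S) ≤ PP G S + 1 := by
  have := PP_insert G S {a} x hx (by simpa using ha) (by simpa using h1)
  simp at this
  omega

lemma PP_insert2 {V : Type} {G : SimpleGraph V} {S : Finset V} {x a b : V} (hx : x ∉ S)
    (ha : a ∈ S) (hb : b ∈ S)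
    (hab : a ≠ b) (h1 : G.Adj x a) (h2 : G.Adj x b) : PP G (insert x S) ≤ PP G S - 3 := by
  have := PP_insert G S {a, b} x hx (by simp [Finset.insert_subset_iff, ha, hb])
    (by simp [h1, h2])
  rw [Finset.card_pair hab] at this
  push_cast at this
  omega

/-- Image of a graph under a map (loops are not allowed to appear). -/
def imgG {V Z : Type} (R : V → V → Prop) (hR : ∀ a b, R a b → R b a) (f : V → Z)
    (hf : ∀ a b, R a b → f a ≠ f b) : SimpleGraph Z where
  Adj z z' := ∃ a b, R a b ∧ f a = z ∧ f b = z'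
  symm := ⟨fun _ _ ⟨a, b, h1, h2, h3⟩ => ⟨b, a, hR a b h1, h3, h2⟩⟩
  loopless := ⟨fun _ ⟨a, b, h1, h2, h3⟩ => hf a b h1 (h2.trans h3.symm)⟩

/-- Folding a set along a map to the 5-cycle with a pendant vertex. -/
lemma fold {G : SimpleGraph V} (h : SmallestCex G) (S : Finset V) (hS : S.Nonempty)
    (φ : V → Fin 6) (hφ : ∀ a ∈ S, ∀ b ∈ S, G.Adj a b → adj6 (φ a) (φ b))
    (hni : ∃ a ∈ S, ∃ b ∈ S, a ≠ b ∧ φ a = φ b) :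
    ∃ (O : Finset V) (A : Finset (Fin 6)) (p : ℤ), Disjoint S O ∧ A.Nonempty ∧
      (p ≤ 1 ∨ (p = 3 ∧ O.card + A.card = 3) ∨ (p = 2 ∧ O.card + A.card = 10)) ∧
      PP G (S ∪ O) ≤ PP G S + p - pY A ∧
      (∀ y ∈ S, ∀ o ∈ O, G.Adj y o → φ y ∉ A → PP G (S ∪ O) + 4 ≤ PP G S + p - pY A) := by
  let f : V → V ⊕ Fin 6 := fun x => if x ∈ S then Sum.inr (φ x) else Sum.inl x
  have fS : ∀ x, x ∈ S → f x = Sum.inr (φ x) := fun x hx => by simp [f, hx]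
  have fO : ∀ x, x ∉ S → f x = Sum.inl x := fun x hx => by simp [f, hx]
  have hloop : ∀ a b, G.Adj a b → f a ≠ f b := by
    intro a b hab heq
    by_cases ha : a ∈ S <;> by_cases hb : b ∈ S
    · rw [fS a ha, fS b hb] at heq
      have := hφ a ha b hb hab
      rw [Sum.inr.inj heq] at this
      exact adj6_irrefl this
    · rw [fS a ha, fO b hb] at heq; cases heq
    · rw [fO a ha, fS b hb] at heq; cases heq
    · rw [fO a ha, fO b hb] at heq
      exact hab.ne (Sum.inl.inj heq)
  let K := imgG G.Adj (fun a b h => h.symm) f hloop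
  have hK : ¬ Colb K := by
    rintro ⟨c, hc⟩
    exact crit_not_colb h.1 ⟨fun x => c (f x), fun a b hab => hc _ _ ⟨a, b, hab, rfl, rfl⟩⟩
  obtain ⟨K', hle, hmin⟩ := exists_minU K hK
  obtain ⟨a0, ha0, b0, hb0, hab0, hφ0⟩ := hni
  haveI : Nonempty V := ⟨a0⟩
  let O : Finset V := Finset.univ.filter (fun x => x ∉ S ∧ Sum.inl x ∈ supp K')
  let A : Finset (Fin 6) := Finset.univ.filter (fun y => Sum.inr y ∈ supp K')
  have hO : ∀ x, x ∈ O ↔ x ∉ S ∧ Sum.inl x ∈ supp K' := by simp [O]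
  have hA : ∀ y, y ∈ A ↔ Sum.inr y ∈ supp K' := by simp [A]
  have hsuppf : ∀ z ∈ supp K', ∃ x, f x = z := by
    intro z hz
    obtain ⟨z', hz'⟩ := mem_supp.1 hz
    obtain ⟨a, b, h1, h2, h3⟩ := hle hz'
    exact ⟨a, h2⟩
  have hinl : ∀ x, Sum.inl x ∈ supp K' → x ∈ O := by
    intro x hx
    rw [hO]
    refine ⟨?_, hx⟩
    obtain ⟨y, hy⟩ := hsuppf _ hx
    intro hxS
    by_cases hyS : y ∈ S
    · rw [fS y hyS] at hy; cases hy
    · rw [fO y hyS] at hy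
      rw [Sum.inl.inj hy] at hyS
      exact hyS hxS
  have hcard : (supp K').card = O.card + A.card := by
    have : supp K' = O.image Sum.inl ∪ A.image Sum.inr := by
      ext z
      rcases z with x | y
      · simp only [Finset.mem_union, Finset.mem_image, reduceCtorEq, and_false, exists_false,
          or_false, Sum.inl.injEq, exists_eq_right]
        exact ⟨hinl x, fun h => ((hO x).1 h).2⟩
      · simp only [Finset.mem_union, Finset.mem_image, reduceCtorEq, and_false, exists_false,
          false_or, Sum.inr.injEq, exists_eq_right]
        exact (hA y).symm
    rw [this, Finset.card_union_of_disjoint, Finset.card_image_of_injective _ Sum.inl_injective,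
      Finset.card_image_of_injective _ Sum.inr_injective]
    rw [Finset.disjoint_left]
    intro z h1 h2
    obtain ⟨x, -, rfl⟩ := Finset.mem_image.1 h1
    obtain ⟨y, -, h3⟩ := Finset.mem_image.1 h2
    cases h3
  have hlt : (supp K').card < Fintype.card V := by
    have h1 : supp K' ⊆ (Finset.univ.erase a0).image f := by
      intro z hz
      obtain ⟨x, hx⟩ := hsuppf z hz
      rw [Finset.mem_image]
      by_cases hxa : x = a0
      · refine ⟨b0, by simp [hab0.symm], ?_⟩
        rw [← hx, hxa, fS a0 ha0, fS b0 hb0, hφ0]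
      · exact ⟨x, by simp [hxa], hx⟩
    have h2 := Finset.card_le_card h1
    have h3 : ((Finset.univ.erase a0).image f).card ≤ _ := Finset.card_image_le
    rw [Finset.card_erase_of_mem (Finset.mem_univ _), Finset.card_univ] at h3
    have : 0 < Fintype.card V := Fintype.card_pos
    omega
  have hAne : A.Nonempty := by
    by_contra hemp
    rw [Finset.not_nonempty_iff_eq_empty] at hemp
    obtain ⟨c, hc⟩ := crit_colOn h.1 {x | x ∉ S} (by
      intro h1
      obtain ⟨x, hx⟩ := hS
      have : x ∈ {x | x ∉ S} := by rw [h1]; trivial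
      exact this hx)
    apply hmin.1
    refine ⟨fun z => Sum.elim c (fun _ => 0) z, ?_⟩
    have hz : ∀ z ∈ supp K', ∃ x, z = Sum.inl x ∧ x ∉ S := by
      intro z hz
      rcases z with x | y
      · exact ⟨x, rfl, ((hO x).1 (hinl x hz)).1⟩
      · have := (hA y).2 hz
        rw [hemp] at this
        simp at this
    intro z z' hzz
    obtain ⟨x, rfl, hx⟩ := hz z (mem_supp.2 ⟨_, hzz⟩)
    obtain ⟨x', rfl, hx'⟩ := hz z' (mem_supp.2 ⟨_, hzz.symm⟩)
    obtain ⟨a, b, h1, h2, h3⟩ := hle hzz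
    have key : ∀ a x, f a = Sum.inl x → a = x := by
      intro a x h2
      by_cases ha : a ∈ S
      · rw [fS a ha] at h2; cases h2
      · rw [fO a ha] at h2; exact Sum.inl.inj h2
    rw [key a x h2, key b x' h3] at h1
    exact hc x hx x' hx' h1
  let B0 := (A ×ˢ A).filter (fun q => adj6 q.1 q.2)
  let B : Finset ((V ⊕ Fin 6) × (V ⊕ Fin 6)) := B0.image (fun q => (Sum.inr q.1, Sum.inr q.2))
  have hB : B.card ≤ B0.card := Finset.card_image_le
  have hmemS' : ∀ a, f a ∈ supp K' → a ∈ S ∪ O := by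
    intro a ha
    by_cases haS : a ∈ S
    · exact Finset.mem_union_left _ haS
    · rw [fO a haS] at ha
      exact Finset.mem_union_right _ (hinl a ha)
  have hlift : ∀ z z', K'.Adj z z' → (z, z') ∉ B → ∃ a b, G.Adj a b ∧ f a = z ∧ f b = z' ∧
      a ∈ S ∪ O ∧ b ∈ S ∪ O ∧ ¬ (a ∈ S ∧ b ∈ S) := by
    intro z z' hzz hnB
    obtain ⟨a, b, h1, h2, h3⟩ := hle hzz
    refine ⟨a, b, h1, h2, h3, hmemS' a ?_, hmemS' b ?_, ?_⟩
    · rw [h2]; exact mem_supp.2 ⟨_, hzz⟩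
    · rw [h3]; exact mem_supp.2 ⟨_, hzz.symm⟩
    · rintro ⟨haS, hbS⟩
      apply hnB
      rw [fS a haS] at h2
      rw [fS b hbS] at h3
      rw [Finset.mem_image]
      refine ⟨(φ a, φ b), ?_, by rw [h2, h3]⟩
      rw [Finset.mem_filter, Finset.mem_product, hA, hA, h2, h3]
      exact ⟨⟨mem_supp.2 ⟨_, hzz⟩, mem_supp.2 ⟨_, hzz.symm⟩⟩, hφ a haS b hbS h1⟩
  have hdisj : Disjoint S O := by
    rw [Finset.disjoint_left]
    intro x hx hxO
    exact ((hO x).1 hxO).1 hx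
  have hmain : ∀ T : Finset (V × V), (∀ q ∈ T, q ∈ prs G (S ∪ O) ∧ ¬ (q.1 ∈ S ∧ q.2 ∈ S) ∧
      ¬ K'.Adj (f q.1) (f q.2)) → PP G (S ∪ O) + 2 * (T.card : ℤ) ≤
        PP G S + (5 * ((supp K').card : ℤ) - 2 * ((prs K' Finset.univ).card : ℤ)) - pY A := by
    intro T hT
    have h1 := count_lift f K' S (S ∪ O) B Finset.subset_union_left hlift T hT
    have h2 : pY A = 5 * (A.card : ℤ) - 2 * (B0.card : ℤ) := by
      unfold pY
      congr!
    rw [h2, hcard]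
    simp only [PP, Finset.card_union_of_disjoint hdisj]
    push_cast
    omega
  refine ⟨O, A, 5 * ((supp K').card : ℤ) - 2 * ((prs K' Finset.univ).card : ℤ), hdisj, hAne, ?_,
    ?_, ?_⟩
  · rcases apply_min h hmin hlt with h1 | h1 | h1
    · left; exact h1
    · right; left
      rw [← hcard]
      refine ⟨?_, h1.1⟩
      rw [h1.1, h1.2.1]; norm_num
    · right; right
      rw [← hcard]
      refine ⟨?_, h1.1⟩
      rw [h1.1, h1.2.1]; norm_num
  · have := hmain ∅ (by simp)
    simpa using this
  · intro y hy o ho hyo hyA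
    have hno : o ∉ S := ((hO o).1 ho).1
    have hn : f y ∉ supp K' := by rw [fS y hy, ← hA]; exact hyA
    have hyo' : (y, o) ≠ (o, y) := by
      intro h
      exact hno ((Prod.mk.inj h).1 ▸ hy)
    have := hmain {(y, o), (o, y)} (by
      intro q hq
      simp only [Finset.mem_insert, Finset.mem_singleton] at hq
      rcases hq with rfl | rfl
      · refine ⟨mem_prs.2 ⟨⟨Finset.mem_union_left _ hy, Finset.mem_union_right _ ho⟩, hyo⟩,
          fun h => hno h.2, fun h => hn (mem_supp.2 ⟨_, h⟩)⟩
      · refine ⟨mem_prs.2 ⟨⟨Finset.mem_union_right _ ho, Finset.mem_union_left _ hy⟩, hyo.symm⟩,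
          fun h => hno h.1, fun h => hn (mem_supp.2 ⟨_, h.symm⟩)⟩)
    rw [Finset.card_pair hyo'] at this
    push_cast at this
    omega

end folding
section basics

open scoped Classical

variable {V : Type} [Fintype V] {G : SimpleGraph V}

lemma PP_univ (h : SmallestCex G) : 2 ≤ PP G Finset.univ := by
  rw [← pot_eq]; exact h.2.2.2.2.1

lemma PP_inj (S : Finset V) (hS : S.Nonempty) (φ : V → Fin 6)
    (hφ : ∀ a ∈ S, ∀ b ∈ S, G.Adj a b → adj6 (φ a) (φ b))
    (hni : ¬ ∃ a ∈ S, ∃ b ∈ S, a ≠ b ∧ φ a = φ b) : 5 ≤ PP G S := by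
  have hinj : ∀ a ∈ S, ∀ b ∈ S, φ a = φ b → a = b := by
    intro a ha b hb hab
    by_contra hne
    exact hni ⟨a, ha, b, hb, hne, hab⟩
  have h1 := pY_nonempty (S.image φ) (hS.image φ)
  have h2 : (S.image φ).card = S.card := Finset.card_image_of_injOn hinj
  have h3 : (prs G S).card ≤
      (((S.image φ) ×ˢ (S.image φ)).filter (fun q => adj6 q.1 q.2)).card := by
    apply Finset.card_le_card_of_injOn (fun q => (φ q.1, φ q.2))
    · intro q hq
      have hq := mem_prs.1 hq
      simp only [Finset.coe_filter, Finset.mem_product, Finset.mem_image, Set.mem_setOf_eq]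
      exact ⟨⟨⟨_, hq.1.1, rfl⟩, ⟨_, hq.1.2, rfl⟩⟩, hφ _ hq.1.1 _ hq.1.2 hq.2⟩
    · intro q hq q' hq' hqq
      have hq := mem_prs.1 hq
      have hq' := mem_prs.1 hq'
      simp only [Prod.mk.injEq] at hqq
      exact Prod.ext (hinj _ hq.1.1 _ hq'.1.1 hqq.1) (hinj _ hq.1.2 _ hq'.1.2 hqq.2)
  have h4 : pY (S.image φ) = 5 * ((S.image φ).card : ℤ) - 2 *
      ((((S.image φ) ×ˢ (S.image φ)).filter (fun q => adj6 q.1 q.2)).card : ℤ) := by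
    unfold pY
    congr!
  rw [h4, h2] at h1
  unfold PP
  omega

lemma base (h : SmallestCex G) (S : Finset V) (hS : S.Nonempty) (hu : S ≠ Finset.univ) :
    4 ≤ PP G S := by
  by_contra hlt
  have hmax : ∀ n : ℕ, ∀ S : Finset V, Fintype.card V - S.card = n → S.Nonempty →
      S ≠ Finset.univ → 4 ≤ PP G S := by
    intro n
    induction n using Nat.strong_induction_on with
    | _ n ih =>
    intro S hn hS hu
    by_contra hlt
    obtain ⟨c, hc⟩ := crit_colOn h.1 (S : Set V) (by simpa using hu)
    have hφ : ∀ a ∈ S, ∀ b ∈ S, G.Adj a b → adj6 (c a).castSucc (c b).castSucc :=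
      fun a ha b hb hab => adj6_castSucc (hc a ha b hb hab)
    by_cases hni : ∃ a ∈ S, ∃ b ∈ S, a ≠ b ∧ (c a).castSucc = (c b).castSucc
    · obtain ⟨O, A, p, hd, hA, hp, h1, -⟩ := fold h S hS (fun x => (c x).castSucc) hφ hni
      have h2 := pY_nonempty A hA
      have h3 : PP G (S ∪ O) ≤ 1 := by omega
      by_cases h4 : S ∪ O = Finset.univ
      · rw [h4] at h3
        have := PP_univ h
        omega
      · by_cases h5 : O = ∅
        · subst h5
          rw [Finset.union_empty] at h1
          omega
        · have h6 : 0 < O.card := Finset.card_pos.2 (Finset.nonempty_iff_ne_empty.2 h5)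
          have h7 := Finset.card_union_of_disjoint hd
          have h8 : (S ∪ O).card < Fintype.card V := by
            rw [← Finset.card_univ]
            exact Finset.card_lt_card (Finset.ssubset_univ_iff.2 h4)
          have := ih (Fintype.card V - (S ∪ O).card) (by omega) (S ∪ O) rfl
            (hS.mono Finset.subset_union_left) h4
          omega
    · have := PP_inj (G := G) S hS (fun x => (c x).castSucc) hφ hni
      omega
  exact hlt (hmax _ S rfl hS hu)

lemma base_univ (h : SmallestCex G) (S : Finset V) (hS : S.Nonempty) (hp : PP G S ≤ 3) :
    S = Finset.univ := by
  by_contra hu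
  have := base h S hS hu
  omega

lemma base_two (h : SmallestCex G) (S : Finset V) (hS : S.Nonempty) : 2 ≤ PP G S := by
  by_cases hu : S = Finset.univ
  · rw [hu]; exact PP_univ h
  · have := base h S hS hu
    omega

lemma base_four (h : SmallestCex G) (S : Finset V) (hS : S.Nonempty) (hu : S ≠ Finset.univ)
    (hp : PP G S ≤ 4) : Fintype.card V ≤ S.card + 2 := by
  obtain ⟨c, hc⟩ := crit_colOn h.1 (S : Set V) (by simpa using hu)
  have hφ : ∀ a ∈ S, ∀ b ∈ S, G.Adj a b → adj6 (c a).castSucc (c b).castSucc :=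
    fun a ha b hb hab => adj6_castSucc (hc a ha b hb hab)
  by_cases hni : ∃ a ∈ S, ∃ b ∈ S, a ≠ b ∧ (c a).castSucc = (c b).castSucc
  · obtain ⟨O, A, p, hd, hA, hpp, h1, -⟩ := fold h S hS (fun x => (c x).castSucc) hφ hni
    have h2 := pY_nonempty A hA
    have h3 := base_two h (S ∪ O) (hS.mono Finset.subset_union_left)
    have h4 := base_univ h (S ∪ O) (hS.mono Finset.subset_union_left) (by omega)
    have h5 := Finset.card_union_of_disjoint hd
    rw [h4, Finset.card_univ] at h5
    have h6 : 0 < A.card := Finset.card_pos.2 hA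
    omega
  · have := PP_inj (G := G) S hS (fun x => (c x).castSucc) hφ hni
    omega

lemma cut (h : SmallestCex G) (S : Finset V) (v : V) (hv : v ∈ S) (hS : ∃ y ∈ S, y ≠ v)
    (hu : S ≠ Finset.univ) : ∃ y ∈ S, y ≠ v ∧ ∃ o, o ∉ S ∧ G.Adj y o := by
  by_contra hcon
  push Not at hcon
  obtain ⟨c, hc⟩ := crit_colOn h.1 (S : Set V) (by simpa using hu)
  obtain ⟨d, hd⟩ := crit_colOn h.1 {x | x ∉ S ∨ x = v} (by
    intro h1
    obtain ⟨y, hy, hyv⟩ := hS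
    have : y ∈ {x | x ∉ S ∨ x = v} := by rw [h1]; trivial
    rcases this with h2 | h2
    · exact h2 hy
    · exact hyv h2)
  obtain ⟨l, hl, hl2⟩ := rot_col (d v) (c v)
  apply crit_not_colb h.1
  refine ⟨fun x => if x ∈ S then c x else d x + l, ?_⟩
  have key : ∀ a b, a ∈ S → b ∉ S → G.Adj a b → adj5 (c a) (d b + l) := by
    intro a b ha hb hab
    by_cases hav : a = v
    · subst hav
      rw [← hl2]
      exact hl _ _ (hd a (Or.inr rfl) b (Or.inl hb) hab)
    · exact absurd hab (hcon a ha hav b hb)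
  intro a b hab
  by_cases ha : a ∈ S <;> by_cases hb : b ∈ S <;> simp only [ha, hb, if_true, if_false]
  · exact hc a ha b hb hab
  · exact key a b ha hb hab
  · exact adj5_symm (key b a hb ha hab.symm)
  · exact hl _ _ (hd a (Or.inl ha) b (Or.inl hb) hab)


lemma ext1 {S : Set V} {c : V → Fin 5} (hc : ColOn G S c) (x : V) (k : Fin 5) (hx : x ∉ S)
    (hk : ∀ b ∈ S, G.Adj x b → adj5 k (c b)) :
    ColOn G (insert x S) (Function.update c x k) := by
  have hne : ∀ b ∈ S, b ≠ x := fun b hb h => hx (h ▸ hb)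
  intro a ha b hb hab
  rcases ha with rfl | ha <;> rcases hb with rfl | hb
  · exact absurd hab (G.irrefl)
  · rw [Function.update_self, Function.update_of_ne (hne b hb)]
    exact hk b hb hab
  · rw [Function.update_self, Function.update_of_ne (hne a ha)]
    exact adj5_symm (hk a ha hab.symm)
  · rw [Function.update_of_ne (hne a ha), Function.update_of_ne (hne b hb)]
    exact hc a ha b hb hab

/-- A string of length two. -/
structure Short (G : SimpleGraph V) (v m u : V) : Prop where
  a1 : G.Adj v m
  a2 : G.Adj m u
  n : ∀ x, G.Adj m x → x = v ∨ x = u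
  vu : v ≠ u

/-- A string of length three. -/
structure Long (G : SimpleGraph V) (v s t u : V) : Prop where
  a1 : G.Adj v s
  a2 : G.Adj s t
  a3 : G.Adj t u
  ns : ∀ x, G.Adj s x → x = v ∨ x = t
  nt : ∀ x, G.Adj t x → x = s ∨ x = u
  vt : v ≠ t
  su : s ≠ u
  vu : v ≠ u


lemma ext_short {S : Set V} {c : V → Fin 5} (hc : ColOn G S c) {v m u : V} (hs : Short G v m u)
    (hm : m ∉ S) (hcc : ¬ adj5 (c v) (c u)) :
    ∃ c', ColOn G (insert m S) c' ∧ ∀ x ∈ S, c' x = c x := by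
  obtain ⟨k, hk1, hk2⟩ := mid2 _ _ hcc
  refine ⟨_, ext1 hc m k hm ?_, fun x hx => Function.update_of_ne (ne_of_mem_of_not_mem hx hm) _ _⟩
  intro b hb hmb
  rcases hs.n b hmb with rfl | rfl
  · exact adj5_symm hk1
  · exact hk2


lemma ext_long {S : Set V} {c : V → Fin 5} (hc : ColOn G S c) {v s t u : V} (hl : Long G v s t u)
    (hs : s ∉ S) (ht : t ∉ S) (hcc : c v ≠ c u) :
    ∃ c', ColOn G (insert s (insert t S)) c' ∧ ∀ x ∈ S, c' x = c x := by
  obtain ⟨k, l, hk1, hk2, hk3⟩ := mid3 _ _ hcc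
  have hst : s ≠ t := hl.a2.ne
  have h1 := ext1 hc t l ht (by
    intro b hb hmb
    rcases hl.nt b hmb with rfl | rfl
    · exact absurd hb hs
    · exact hk3)
  have h2 := ext1 h1 s k (by
    rintro (h | h)
    · exact hst h
    · exact hs h) (by
    intro b hb hmb
    rcases hl.ns b hmb with rfl | rfl
    · rw [Function.update_of_ne hl.vt]
      exact adj5_symm hk1
    · rw [Function.update_self]
      exact hk2)
  refine ⟨_, h2, fun x hx => ?_⟩
  rw [Function.update_of_ne (ne_of_mem_of_not_mem hx hs), Function.update_of_ne (ne_of_mem_of_not_mem hx ht)]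


lemma long_P {S : Finset V} {v s t u : V} (hl : Long G v s t u) (hv : v ∈ S) (hu : u ∈ S)
    (hs : s ∉ S) (ht : t ∉ S) : PP G (insert s (insert t S)) ≤ PP G S - 2 := by
  have h1 := PP_insert1 (G := G) ht hu hl.a3
  have h2 := PP_insert2 (G := G) (x := s) (S := insert t S) (a := v) (b := t)
    (by simp [hl.a2.ne, hs]) (by simp [hv]) (by simp) hl.vt hl.a1.symm hl.a2
  omega

/-- Two strings of length three at `v`. -/
structure Tails (G : SimpleGraph V) (v s3 t3 u3 s4 t4 u4 : V) : Prop where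
  l3 : Long G v s3 t3 u3
  l4 : Long G v s4 t4 u4
  s3s4 : s3 ≠ s4
  s3t4 : s3 ≠ t4
  t3s4 : t3 ≠ s4
  t3t4 : t3 ≠ t4
  u3s4 : u3 ≠ s4
  u3t4 : u3 ≠ t4
  u4s3 : u4 ≠ s3
  u4t3 : u4 ≠ t3


lemma Tails.symm {v s3 t3 u3 s4 t4 u4 : V} (h : Tails G v s3 t3 u3 s4 t4 u4) :
    Tails G v s4 t4 u4 s3 t3 u3 :=
  ⟨h.l4, h.l3, h.s3s4.symm, h.t3s4.symm, h.s3t4.symm, h.t3t4.symm, h.u4s3, h.u4t3, h.u3s4, h.u3t4⟩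

lemma five_out {v s3 t3 u3 s4 t4 u4 : V} (ht : Tails G v s3 t3 u3 s4 t4 u4) (S : Finset V)
    (h1 : s3 ∉ S) (h2 : t3 ∉ S) (h3 : s4 ∉ S) (h4 : t4 ∉ S) (h5 : u3 ∉ S) :
    S.card + 5 ≤ Fintype.card V := by
  have e1 : (insert u3 (insert s3 (insert t3 (insert s4 (insert t4 S))))).card = S.card + 5 := by
    rw [Finset.card_insert_of_notMem, Finset.card_insert_of_notMem, Finset.card_insert_of_notMem,
      Finset.card_insert_of_notMem, Finset.card_insert_of_notMem]
    · exact h4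
    · simp [h3, ht.l4.a2.ne]
    · simp [h2, ht.t3s4, ht.t3t4]
    · simp [h1, ht.l3.a2.ne, ht.s3s4, ht.s3t4]
    · simp [h5, ht.l3.su.symm, ht.l3.a3.ne', ht.u3s4, ht.u3t4]
  rw [← e1]
  exact Finset.card_le_univ _

lemma tail (h : SmallestCex G) {v s3 t3 u3 s4 t4 u4 : V} (ht : Tails G v s3 t3 u3 s4 t4 u4)
    (S : Finset V) (hv : v ∈ S) (h1 : s3 ∉ S) (h2 : t3 ∉ S) (h3 : s4 ∉ S) (h4 : t4 ∉ S)
    (hP : PP G S ≤ 5) (φ : V → Fin 6) (hφ : ∀ a ∈ S, ∀ b ∈ S, G.Adj a b → adj6 (φ a) (φ b))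
    (hni : ∃ a ∈ S, ∃ b ∈ S, a ≠ b ∧ φ a = φ b) (hφv : φ v = 5)
    (hφn : ∀ x ∈ S, x ≠ v → φ x ≠ 5) : False := by
  have hne : S.Nonempty := ⟨v, hv⟩
  have one : ∀ s3 t3 u3 s4 t4 u4 : V, Tails G v s3 t3 u3 s4 t4 u4 → s3 ∉ S → t3 ∉ S → s4 ∉ S →
      t4 ∉ S → u3 ∈ S → False := by
    intro s3 t3 u3 s4 t4 u4 ht h1 h2 h3 h4 h5
    have e1 := long_P ht.l3 hv h5 h1 h2
    have e2 := base_univ h _ (by simp) (e1.trans (by omega : _ ≤ (3 : ℤ)))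
    have : s4 ∈ insert s3 (insert t3 S) := by rw [e2]; simp
    simp [ht.s3s4.symm, ht.t3s4.symm, h3] at this
  by_cases h5 : u3 ∈ S
  · exact one _ _ _ _ _ _ ht h1 h2 h3 h4 h5
  by_cases h6 : u4 ∈ S
  · exact one _ _ _ _ _ _ ht.symm h3 h4 h1 h2 h6
  have h7 := five_out ht S h1 h2 h3 h4 h5
  have hu : S ≠ Finset.univ := by rintro rfl; simp at h1
  obtain ⟨O, A, p, hd, hA, hpp, hle, hT⟩ := fold h S hne φ hφ hni
  obtain ⟨y, hy, hyv, o, ho, hyo⟩ := cut h S v hv (by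
    obtain ⟨a, ha, b, hb, hab, -⟩ := hni
    by_cases hav : a = v
    · exact ⟨b, hb, fun h => hab (hav.trans h.symm)⟩
    · exact ⟨a, ha, hav⟩) hu
  have g1 := pY_nonempty A hA
  have g2 := base_two h (S ∪ O) (hne.mono Finset.subset_union_left)
  have g3 := base_univ h (S ∪ O) (hne.mono Finset.subset_union_left) (by omega)
  have hmem : ∀ x, x ∉ S → x ∈ O := by
    intro x hx
    have : x ∈ S ∪ O := by rw [g3]; simp
    exact (Finset.mem_union.1 this).resolve_left hx
  have g4 : 5 ∈ A := by
    by_contra hA5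
    have := hT v hv s3 (hmem _ h1) ht.l3.a1 (by rwa [hφv])
    omega
  have g5 : φ y ∈ A := by
    by_contra hA5
    have := hT y hy o (hmem _ ho) hyo hA5
    omega
  have g6 := pY_two A g4 _ g5 (hφn y hy hyv)
  have g7 := Finset.card_union_of_disjoint hd
  rw [g3, Finset.card_univ] at g7
  have g8 : 0 < A.card := Finset.card_pos.2 hA
  omega

end basics
section elemma

open scoped Classical

variable {V : Type} [Fintype V] {G : SimpleGraph V}

lemma ladj_symm (l : List (ℕ × ℕ)) (x y : ℕ) : ladj l x y = ladj l y x := by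
  unfold ladj
  congr 1
  funext e
  rw [Bool.or_comm]

lemma elem (h : SmallestCex G) {v s3 t3 u3 s4 t4 u4 : V} (ht : Tails G v s3 t3 u3 s4 t4 u4)
    (i : Bool) (a w : Fin 10) (haw : (EE i).Adj a w) (e : Fin 14 → V) (he : Function.Injective e)
    (hadj : ∀ x y : Fin 14, ladj (qlist i a.val w.val) x.val y.val = true → G.Adj (e x) (e y))
    (hv : e 12 = v) (hN11 : ∀ x, G.Adj (e 11) x → ∃ j, e j = x)
    (hN13 : ∀ x, G.Adj (e 13) x → ∃ j, e j = x)
    (h1 : ∀ j, e j ≠ s3) (h2 : ∀ j, e j ≠ t3) (h3 : ∀ j, e j ≠ s4) (h4 : ∀ j, e j ≠ t4)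
    (hu3 : u3 ≠ e 11 ∧ u3 ≠ e 13) (hu4 : u4 ≠ e 11 ∧ u4 ≠ e 13) : False := by
  obtain ⟨S, hmemS, hScard⟩ : ∃ S : Finset V, (∀ x, x ∈ S ↔ ∃ j, e j = x) ∧ S.card = 14 := by
    refine ⟨Finset.univ.image e, by simp, ?_⟩
    rw [Finset.card_image_of_injective _ he, Finset.card_univ, Fintype.card_fin]
  have heS : ∀ j, e j ∈ S := fun j => (hmemS _).2 ⟨j, rfl⟩
  have hout : ∀ x, (∀ j, e j ≠ x) → x ∉ S := by
    intro x hx hxS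
    obtain ⟨j, hj⟩ := (hmemS x).1 hxS
    exact hx j hj
  have k1 := hout _ h1
  have k2 := hout _ h2
  have k3 := hout _ h3
  have k4 := hout _ h4
  have hne : S.Nonempty := ⟨_, heS 0⟩
  have hu : S ≠ Finset.univ := by
    intro hh
    rw [hh] at k1
    simp at k1
  obtain ⟨Q, hQ, hq⟩ : ∃ Q : Finset (Fin 14 × Fin 14),
      (∀ q, q ∈ Q ↔ ladj (qlist i a.val w.val) q.1.val q.2.val = true) ∧ Q.card = 32 :=
    ⟨_, fun q => by rw [Finset.mem_filter]; simp only [Finset.mem_univ, true_and],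
      qcount i a w ((EE_adj i a w).1 haw)⟩
  have hPi : Function.Injective (fun q : Fin 14 × Fin 14 => (e q.1, e q.2)) := by
    intro q q' hqq
    simp only [Prod.mk.injEq] at hqq
    exact Prod.ext (he hqq.1) (he hqq.2)
  have hcnt : ∀ Q' : Finset (Fin 14 × Fin 14), (∀ q ∈ Q', G.Adj (e q.1) (e q.2)) →
      PP G S ≤ 70 - 2 * (Q'.card : ℤ) := by
    intro Q' hQ'
    have : Q'.image (fun q => (e q.1, e q.2)) ⊆ prs G S := by
      intro r hr
      obtain ⟨q, hq, hqr⟩ := Finset.mem_image.1 hr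
      rw [← hqr]
      exact mem_prs.2 ⟨⟨heS _, heS _⟩, hQ' q hq⟩
    have := Finset.card_le_card this
    rw [Finset.card_image_of_injective _ hPi] at this
    unfold PP
    rw [hScard]
    push_cast
    omega
  have hQadj : ∀ q ∈ Q, G.Adj (e q.1) (e q.2) := by
    intro q hq
    exact hadj _ _ ((hQ q).1 hq)
  have hP := hcnt Q hQadj
  rw [hq] at hP
  norm_num at hP
  have hind : ∀ x y, G.Adj (e x) (e y) → ladj (qlist i a.val w.val) x.val y.val = true := by
    intro x y hxy
    by_contra hno
    have hxy' : x ≠ y := by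
      rintro rfl
      exact G.irrefl hxy
    have n1 : (y, x) ∉ Q := by
      rw [hQ, ladj_symm]
      exact hno
    have n2 : (x, y) ∉ insert (y, x) Q := by
      rw [Finset.mem_insert, hQ]
      rintro (h | h)
      · exact hxy' (Prod.mk.inj h).1
      · exact hno h
    have := hcnt (insert (x, y) (insert (y, x) Q)) (by
      intro q hq
      rcases Finset.mem_insert.1 hq with rfl | hq
      · exact hxy
      · rcases Finset.mem_insert.1 hq with rfl | hq
        · exact hxy.symm
        · exact hQadj q hq)
    rw [Finset.card_insert_of_notMem n2, Finset.card_insert_of_notMem n1, hq] at this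
    norm_num at this
    exact hu (base_univ h S hne (by omega))
  have hvS : v ∈ S := hv ▸ heS 12
  -- indices of old vertices
  have hidx : ∀ j : Fin 14, j ≠ 11 → j ≠ 12 → j ≠ 13 → j.val < 11 := by decide
  by_cases h5 : u3 ∈ S <;> by_cases h6 : u4 ∈ S
  · -- both ends inside
    obtain ⟨j3, hj3⟩ := (hmemS _).1 h5
    obtain ⟨j4, hj4⟩ := (hmemS _).1 h6
    have b3 : j3.val < 11 := by
      apply hidx
      · rintro rfl; exact hu3.1 hj3.symm
      · rintro rfl; exact ht.l3.vu (hv.symm.trans hj3)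
      · rintro rfl; exact hu3.2 hj3.symm
    have b4 : j4.val < 11 := by
      apply hidx
      · rintro rfl; exact hu4.1 hj4.symm
      · rintro rfl; exact ht.l4.vu (hv.symm.trans hj4)
      · rintro rfl; exact hu4.2 hj4.symm
    obtain ⟨χ, hχ, c3, c4⟩ := col_full i a w haw j3 j4 b3 b4
    have hce : ∀ j, Function.extend e χ (fun _ => 0) (e j) = χ j := fun j => he.extend_apply _ _ _
    have hcol : ColOn G (S : Set V) (Function.extend e χ (fun _ => 0)) := by
      intro x hx y hy hxy
      obtain ⟨jx, rfl⟩ := (hmemS _).1 hx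
      obtain ⟨jy, rfl⟩ := (hmemS _).1 hy
      rw [hce, hce]
      exact hχ _ _ (hind _ _ hxy)
    obtain ⟨c', hc', hcc⟩ := ext_long hcol ht.l3 k1 k2 (by
      rw [← hv, ← hj3, hce, hce]; exact c3)
    have o4 : s4 ∉ insert s3 (insert t3 S) := by
      simp [ht.s3s4.symm, ht.t3s4.symm, k3]
    have o5 : t4 ∉ insert s3 (insert t3 S) := by
      simp [ht.s3t4.symm, ht.t3t4.symm, k4]
    obtain ⟨c'', hc'', -⟩ := ext_long hc' ht.l4 (by simpa using o4) (by simpa using o5) (by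
      rw [hcc _ hvS, hcc _ h6, ← hv, ← hj4, hce, hce]; exact c4)
    have e1 := long_P ht.l3 hvS h5 k1 k2
    have e2 := long_P ht.l4 (S := insert s3 (insert t3 S)) (by simp [hvS]) (by simp [h6]) o4 o5
    have e3 := base_univ h _ (by simp) (e2.trans (by omega : _ ≤ (3 : ℤ)))
    apply crit_not_colb h.1
    refine ⟨c'', fun x y hxy => ?_⟩
    have hall : ∀ x, x ∈ insert s4 (insert t4 (insert s3 (insert t3 (S : Set V)))) := by
      intro x
      have : x ∈ insert s4 (insert t4 (insert s3 (insert t3 S))) := by rw [e3]; simp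
      simpa using this
    exact hc'' x (hall x) y (hall y) hxy
  · have e1 := long_P ht.l3 hvS h5 k1 k2
    have e2 : insert s3 (insert t3 S) ≠ Finset.univ := by
      intro hh
      have : s4 ∈ insert s3 (insert t3 S) := by rw [hh]; simp
      simp [ht.s3s4.symm, ht.t3s4.symm, k3] at this
    have e3 := base_four h _ (by simp) e2 (e1.trans (by omega : _ ≤ (4 : ℤ)))
    have e4 := five_out ht.symm S k3 k4 k1 k2 h6
    have e5 := Finset.card_insert_le s3 (insert t3 S)
    have e6 := Finset.card_insert_le t3 S
    omega
  · have e1 := long_P ht.l4 hvS h6 k3 k4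
    have e2 : insert s4 (insert t4 S) ≠ Finset.univ := by
      intro hh
      have : s3 ∈ insert s4 (insert t4 S) := by rw [hh]; simp
      simp [ht.s3s4, ht.s3t4, k1] at this
    have e3 := base_four h _ (by simp) e2 (e1.trans (by omega : _ ≤ (4 : ℤ)))
    have e4 := five_out ht S k1 k2 k3 k4 h5
    have e5 := Finset.card_insert_le s4 (insert t4 S)
    have e6 := Finset.card_insert_le t4 S
    omega
  · have h7 := five_out ht S k1 k2 k3 k4 h5
    have hne1112 : e 11 ≠ v := by
      rw [← hv]
      exact fun h => absurd (he h) (by decide)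
    obtain ⟨y, hy, hyv, o, ho, hyo⟩ := cut h S v hvS ⟨e 11, heS _, hne1112⟩ hu
    obtain ⟨j, rfl⟩ := (hmemS _).1 hy
    have bj : j.val < 11 := by
      apply hidx
      · rintro rfl; exact ho ((hmemS _).2 (hN11 o hyo))
      · rintro rfl; exact hyv hv
      · rintro rfl; exact ho ((hmemS _).2 (hN13 o hyo))
    obtain ⟨χ, hχ, c12, c11, c13, cn5, cy⟩ := col_pendant i a w haw j bj
    have hce : ∀ j, Function.extend e χ (fun _ => 0) (e j) = χ j := fun j => he.extend_apply _ _ _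
    obtain ⟨O, A, p, hd, hA, hpp, hle, hT⟩ := fold h S hne (Function.extend e χ (fun _ => 0)) (by
      intro x hx y hy hxy
      obtain ⟨jx, rfl⟩ := (hmemS _).1 hx
      obtain ⟨jy, rfl⟩ := (hmemS _).1 hy
      rw [hce, hce]
      exact hχ _ _ (hind _ _ hxy)) ⟨e 11, heS _, e 13, heS _, fun h => absurd (he h) (by decide), by
        rw [hce, hce, c11, c13]⟩
    have g1 := pY_nonempty A hA
    have g2 := base_two h (S ∪ O) (hne.mono Finset.subset_union_left)
    have g7 := Finset.card_union_of_disjoint hd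
    have g8 : 0 < A.card := Finset.card_pos.2 hA
    by_cases g3 : S ∪ O = Finset.univ
    · have hmem : ∀ x, x ∉ S → x ∈ O := by
        intro x hx
        have : x ∈ S ∪ O := by rw [g3]; simp
        exact (Finset.mem_union.1 this).resolve_left hx
      rw [g3, Finset.card_univ] at g7
      have g4 : 5 ∈ A := by
        by_contra hA5
        have := hT v hvS s3 (hmem _ k1) ht.l3.a1 (by rwa [← hv, hce, c12])
        omega
      have g5 : χ j ∈ A := by
        by_contra hA5
        have := hT _ hy o (hmem _ ho) hyo (by rwa [hce])
        omega
      have g6 := pY_three A g4 _ g5 (cn5 j (by rintro rfl; exact hyv hv)) cy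
      omega
    · have g9 := base h (S ∪ O) (hne.mono Finset.subset_union_left) g3
      have g10 := base_four h (S ∪ O) (hne.mono Finset.subset_union_left) g3
      omega

end elemma
section prep

open scoped Classical

variable {V : Type} [Fintype V] {G : SimpleGraph V}

lemma norm30 (x y : Fin 5) (hxy : x ≠ y) (hn : ¬ adj5 x y) :
    ∃ g : Fin 5 → Fin 5, (∀ p q, adj5 p q → adj5 (g p) (g q)) ∧ g x = 3 ∧ g y = 0 := by
  obtain ⟨k, l, h1, h2, h3⟩ := norm_col x y hxy hn
  have hrot : ∀ a b : Fin 5, adj5 a b → adj5 (a + 3) (b + 3) := by decide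
  refine ⟨fun p => k * p + l + 3, ?_, ?_, ?_⟩
  · intro p q hpq
    exact hrot _ _ (h1 p q hpq)
  · simp only [h2]; decide
  · simp only [h3]; decide

lemma norm02 (x y : Fin 5) (hxy : x ≠ y) (hn : ¬ adj5 x y) :
    ∃ g : Fin 5 → Fin 5, (∀ p q, adj5 p q → adj5 (g p) (g q)) ∧ g x = 0 ∧ g y = 2 := by
  obtain ⟨k, l, h1, h2, h3⟩ := norm_col x y hxy hn
  exact ⟨fun p => k * p + l, h1, h2, h3⟩

/-- Extension property of a string with interior `I` between `v` and `u`. -/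
def ExtP {V : Type} (G : SimpleGraph V) (v u : V) (I : Set V) (R : Fin 5 → Fin 5 → Prop) : Prop :=
  ∀ (S : Set V) (c : V → Fin 5), ColOn G S c → v ∈ S → u ∈ S → (∀ x ∈ I, x ∉ S) →
    R (c v) (c u) → ∃ c', ColOn G (I ∪ S) c' ∧ ∀ x ∈ S, c' x = c x

lemma Short.ext {v m u : V} (hs : Short G v m u) : ExtP G v u {m} (fun x y => ¬ adj5 x y) := by
  intro S c hc hv hu hI hR
  obtain ⟨c', h1, h2⟩ := ext_short hc hs (hI m rfl) hR
  exact ⟨c', h1, h2⟩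

lemma Long.ext {v s t u : V} (hs : Long G v s t u) : ExtP G v u {s, t} (fun x y => x ≠ y) := by
  intro S c hc hv hu hI hR
  obtain ⟨c', h1, h2⟩ := ext_long hc hs (hI s (Or.inl rfl)) (hI t (Or.inr rfl)) hR
  refine ⟨c', ?_, h2⟩
  rwa [Set.insert_union, Set.singleton_union]

lemma ext_all (h : SmallestCex G) {v u1 u2 u3 u4 : V} {I1 I2 I3 I4 : Set V}
    {R1 R2 R3 R4 : Fin 5 → Fin 5 → Prop} (x1 : ExtP G v u1 I1 R1) (x2 : ExtP G v u2 I2 R2)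
    (x3 : ExtP G v u3 I3 R3) (x4 : ExtP G v u4 I4 R4)
    (d12 : ∀ x ∈ I2, x ∉ I1) (d13 : ∀ x ∈ I3, x ∉ I1) (d14 : ∀ x ∈ I4, x ∉ I1)
    (d23 : ∀ x ∈ I3, x ∉ I2) (d24 : ∀ x ∈ I4, x ∉ I2) (d34 : ∀ x ∈ I4, x ∉ I3)
    (hv : v ∉ I1 ∧ v ∉ I2 ∧ v ∉ I3 ∧ v ∉ I4)
    (S0 : Set V) (hS0 : ∀ x, x ∈ S0 ↔ x ≠ v ∧ x ∉ I1 ∧ x ∉ I2 ∧ x ∉ I3 ∧ x ∉ I4)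
    (hu1 : u1 ∈ S0) (hu2 : u2 ∈ S0) (hu3 : u3 ∈ S0) (hu4 : u4 ∈ S0)
    (hN : ∀ x, G.Adj v x → x ∉ S0) (c : V → Fin 5) (hc : ColOn G S0 c) (k : Fin 5)
    (r1 : R1 k (c u1)) (r2 : R2 k (c u2)) (r3 : R3 k (c u3)) (r4 : R4 k (c u4)) : False := by
  have hvS : v ∉ S0 := fun h => ((hS0 v).1 h).1 rfl
  have q0 := ext1 hc v k hvS (fun b hb hvb => absurd hb (hN b hvb))
  have z : ∀ u ∈ S0, Function.update c v k u = c u := fun u hu =>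
    Function.update_of_ne (ne_of_mem_of_not_mem hu hvS) _ _
  have zv : Function.update c v k v = k := Function.update_self _ _ _
  have nv : ∀ I : Set V, v ∉ I → ∀ x ∈ I, x ≠ v := fun I hI x hx h => hI (h ▸ hx)
  have mv : v ∈ insert v S0 := Set.mem_insert _ _
  have mu : ∀ u ∈ S0, u ∈ insert v S0 := fun u hu => Set.mem_insert_of_mem _ hu
  obtain ⟨c1, q1, e1⟩ := x1 _ _ q0 mv (mu _ hu1) (by
    rintro x hx (rfl | h)
    · exact hv.1 hx
    · exact ((hS0 x).1 h).2.1 hx) (by rw [zv, z _ hu1]; exact r1)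
  have f1 : ∀ u ∈ S0, c1 u = c u := fun u hu => (e1 u (mu _ hu)).trans (z u hu)
  have g1 : c1 v = k := (e1 v mv).trans zv
  have i1 : ∀ u ∈ insert v S0, u ∈ I1 ∪ insert v S0 := fun u hu => Or.inr hu
  obtain ⟨c2, q2, e2⟩ := x2 _ _ q1 (i1 _ mv) (i1 _ (mu _ hu2)) (by
    rintro x hx (h | rfl | h)
    · exact d12 x hx h
    · exact hv.2.1 hx
    · exact ((hS0 x).1 h).2.2.1 hx) (by rw [g1, f1 _ hu2]; exact r2)
  have f2 : ∀ u ∈ S0, c2 u = c u := fun u hu => (e2 u (i1 _ (mu _ hu))).trans (f1 u hu)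
  have g2 : c2 v = k := (e2 v (i1 _ mv)).trans g1
  have i2 : ∀ u ∈ insert v S0, u ∈ I2 ∪ (I1 ∪ insert v S0) := fun u hu => Or.inr (i1 u hu)
  obtain ⟨c3, q3, e3⟩ := x3 _ _ q2 (i2 _ mv) (i2 _ (mu _ hu3)) (by
    rintro x hx (h | h | rfl | h)
    · exact d23 x hx h
    · exact d13 x hx h
    · exact hv.2.2.1 hx
    · exact ((hS0 x).1 h).2.2.2.1 hx) (by rw [g2, f2 _ hu3]; exact r3)
  have f3 : ∀ u ∈ S0, c3 u = c u := fun u hu => (e3 u (i2 _ (mu _ hu))).trans (f2 u hu)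
  have g3 : c3 v = k := (e3 v (i2 _ mv)).trans g2
  have i3 : ∀ u ∈ insert v S0, u ∈ I3 ∪ (I2 ∪ (I1 ∪ insert v S0)) := fun u hu => Or.inr (i2 u hu)
  obtain ⟨c4, q4, e4⟩ := x4 _ _ q3 (i3 _ mv) (i3 _ (mu _ hu4)) (by
    rintro x hx (h | h | h | rfl | h)
    · exact d34 x hx h
    · exact d24 x hx h
    · exact d14 x hx h
    · exact hv.2.2.2 hx
    · exact ((hS0 x).1 h).2.2.2.2 hx) (by rw [g3, f3 _ hu4]; exact r4)
  have hall : ∀ x, x ∈ I4 ∪ (I3 ∪ (I2 ∪ (I1 ∪ insert v S0))) := by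
    intro x
    have := hS0 x
    simp only [Set.mem_union, Set.mem_insert_iff]
    tauto
  exact crit_not_colb h.1 ⟨c4, fun a b hab => q4 a (hall a) b (hall b) hab⟩

lemma elist_lt : ∀ (i : Bool), ∀ ed ∈ elist i, ed.1 < 10 ∧ ed.2 < 10 := by decide

lemma elem' (h : SmallestCex G) {v s3 t3 u3 s4 t4 u4 : V} (ht : Tails G v s3 t3 u3 s4 t4 u4)
    (i : Bool) (a w : Fin 10) (haw : (EE i).Adj a w) (e : Fin 10 → V) (he : Function.Injective e)
    (hadj : ∀ x y, (EE i).Adj x y → ¬ (x = a ∧ y = w) → ¬ (x = w ∧ y = a) → G.Adj (e x) (e y))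
    (q r q' : V) (b1 : G.Adj (e a) q) (b2 : G.Adj q r) (b3 : G.Adj r v) (b4 : G.Adj v q')
    (b5 : G.Adj q' (e w)) (hnd : [q, r, v, q'].Nodup) (hne : ∀ x, e x ∉ [q, r, v, q'])
    (nr : ∀ x, G.Adj r x → x = q ∨ x = v) (nq' : ∀ x, G.Adj q' x → x = v ∨ x = e w)
    (h3 : ∀ x ∈ [s3, t3, s4, t4], (∀ j, e j ≠ x) ∧ x ∉ [q, r, v, q'])
    (hu3 : u3 ≠ r ∧ u3 ≠ q') (hu4 : u4 ≠ r ∧ u4 ≠ q') : False := by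
  let E : ℕ → V := fun n => if hn : n < 10 then e ⟨n, hn⟩ else if n = 10 then q
    else if n = 11 then r else if n = 12 then v else q'
  have Elt : ∀ n (hn : n < 10), E n = e ⟨n, hn⟩ := fun n hn => by simp [E, hn]
  have Ef : ∀ x : Fin 10, E x.val = e x := fun x => Elt _ x.2
  have E10 : E 10 = q := by simp [E]
  have E11 : E 11 = r := by simp [E]
  have E12 : E 12 = v := by simp [E]
  have E13 : E 13 = q' := by simp [E]
  have hcase : ∀ n, n < 14 → (∃ x : Fin 10, x.val = n) ∨ n = 10 ∨ n = 11 ∨ n = 12 ∨ n = 13 := by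
    intro n hn
    by_cases h : n < 10
    · exact Or.inl ⟨⟨n, h⟩, rfl⟩
    · omega
  have Eed : ∀ ed ∈ qlist i a.val w.val, G.Adj (E ed.1) (E ed.2) := by
    intro ed hed
    rw [qlist, List.mem_append] at hed
    rcases hed with hed | hed
    · rw [List.mem_filter] at hed
      obtain ⟨l1, l2⟩ := elist_lt i ed hed.1
      rw [Elt _ l1, Elt _ l2]
      apply hadj
      · rw [EE_adj, ladj, List.any_eq_true]
        exact ⟨ed, hed.1, by simp⟩
      · rintro ⟨g1, g2⟩
        have g1 := congrArg Fin.val g1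
        have g2 := congrArg Fin.val g2
        simp only at g1 g2
        simp [g1, g2] at hed
      · rintro ⟨g1, g2⟩
        have g1 := congrArg Fin.val g1
        have g2 := congrArg Fin.val g2
        simp only at g1 g2
        simp [g1, g2] at hed
    · simp only [List.mem_cons, List.not_mem_nil, or_false] at hed
      rcases hed with rfl | rfl | rfl | rfl | rfl
      · simpa only [Ef, E10] using b1
      · simpa only [E11, E10] using b2
      · simpa only [E11, E12] using b3
      · simpa only [E13, E12] using b4
      · simpa only [Ef, E13] using b5
  have hinj : ∀ m n, m < 14 → n < 14 → E m = E n → m = n := by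
    simp only [List.nodup_cons, List.mem_cons, List.not_mem_nil, or_false, not_or,
      not_false_eq_true, List.nodup_nil, and_true] at hnd hne
    obtain ⟨⟨n1, n2, n3⟩, ⟨n4, n5⟩, n6⟩ := hnd
    intro m n hm hn
    rcases hcase m hm with ⟨x, rfl⟩ | rfl | rfl | rfl | rfl <;>
    rcases hcase n hn with ⟨y, rfl⟩ | rfl | rfl | rfl | rfl <;>
    intro heq <;> first | rfl | simp only [Ef, E10, E11, E12, E13] at heq
    · exact congrArg Fin.val (he heq)
    all_goals first
      | exact absurd heq (hne _).1
      | exact absurd heq (hne _).2.1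
      | exact absurd heq (hne _).2.2.1
      | exact absurd heq (hne _).2.2.2
      | exact absurd heq.symm (hne _).1
      | exact absurd heq.symm (hne _).2.1
      | exact absurd heq.symm (hne _).2.2.1
      | exact absurd heq.symm (hne _).2.2.2
      | exact absurd heq (by assumption)
      | exact absurd heq.symm (by assumption)
  have hav : ∀ x ∈ [s3, t3, s4, t4], ∀ j : Fin 14, E j.val ≠ x := by
    intro x hx j
    obtain ⟨g1, g2⟩ := h3 x hx
    simp only [List.mem_cons, List.not_mem_nil, or_false, not_or] at g2
    rcases hcase j.val j.2 with ⟨y, hy⟩ | hy | hy | hy | hy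
    · rw [← hy, Ef]; exact g1 y
    · rw [hy, E10]; exact Ne.symm g2.1
    · rw [hy, E11]; exact Ne.symm g2.2.1
    · rw [hy, E12]; exact Ne.symm g2.2.2.1
    · rw [hy, E13]; exact Ne.symm g2.2.2.2
  refine elem h ht i a w haw (fun j => E j.val) ?_ ?_ E12 ?_ ?_ (hav s3 (by simp))
    (hav t3 (by simp)) (hav s4 (by simp)) (hav t4 (by simp)) ?_ ?_
  · intro x y hxy
    exact Fin.ext (hinj _ _ x.2 y.2 hxy)
  · intro x y hxy
    rw [ladj, List.any_eq_true] at hxy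
    obtain ⟨ed, hed, h2⟩ := hxy
    have h4 := Eed ed hed
    simp only [Bool.or_eq_true, Bool.and_eq_true, beq_iff_eq] at h2
    rcases h2 with ⟨g1, g2⟩ | ⟨g1, g2⟩
    · rw [g1, g2] at h4; exact h4
    · rw [g1, g2] at h4; exact h4.symm
  · intro x hx
    rcases nr x (by have hx' : G.Adj (E 11) x := hx; rwa [E11] at hx') with rfl | rfl
    · exact ⟨10, E10⟩
    · exact ⟨12, E12⟩
  · intro x hx
    rcases nq' x (by have hx' : G.Adj (E 13) x := hx; rwa [E13] at hx') with rfl | rfl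
    · exact ⟨12, E12⟩
    · exact ⟨⟨w.val, by omega⟩, Ef w⟩
  · exact ⟨by rw [show E (11 : Fin 14).val = r from E11]; exact hu3.1,
      by rw [show E (13 : Fin 14).val = q' from E13]; exact hu3.2⟩
  · exact ⟨by rw [show E (11 : Fin 14).val = r from E11]; exact hu4.1,
      by rw [show E (13 : Fin 14).val = q' from E13]; exact hu4.2⟩

end prep
section caseA

open scoped Classical

variable {V : Type} [Fintype V] {G : SimpleGraph V}

lemma add_count {V : Type} [Fintype V] {G K : SimpleGraph V} (S : Finset V) (X : Finset (V × V))
    (hX : ∀ a b, K.Adj a b → (a ∈ S ∧ b ∈ S ∧ G.Adj a b) ∨ (a, b) ∈ X) :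
    PP G S ≤ 5 * (S.card : ℤ) - 2 * ((prs K Finset.univ).card : ℤ) + 2 * (X.card : ℤ) := by
  have : prs K Finset.univ ⊆ prs G S ∪ X := by
    intro q hq
    rw [Finset.mem_union, mem_prs]
    rcases hX _ _ (mem_prs.1 hq).2 with h1 | h1
    · exact Or.inl ⟨⟨h1.1, h1.2.1⟩, h1.2.2⟩
    · exact Or.inr h1
  have h1 := Finset.card_le_card this
  have h2 := Finset.card_union_le (prs G S) X
  unfold PP
  omega

lemma colb_of_le (h : SmallestCex G) {K : SimpleGraph V} (S0 : Finset V) (v : V) (hv : v ∉ S0)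
    (hK : ∀ a b, K.Adj a b → a ∈ S0 ∧ b ∈ S0 ∧ G.Adj a b) : Colb K := by
  obtain ⟨c, hc⟩ := crit_colOn h.1 (S0 : Set V) (by
    intro hh
    have : v ∈ (S0 : Set V) := by rw [hh]; trivial
    exact hv this)
  exact ⟨c, fun a b hab => hc a (hK a b hab).1 b (hK a b hab).2.1 (hK a b hab).2.2⟩

lemma pick3 : ∀ x y z : Fin 5, ∃ k : Fin 5, ¬ adj5 k x ∧ k ≠ y ∧ k ≠ z := by decide +kernel

/-- The configuration with two strings of length two and two of length three. -/
structure CfgA (G : SimpleGraph V) (v m1 u1 m2 u2 s3 t3 u3 s4 t4 u4 : V) (S0 : Finset V) :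
    Prop where
  s1 : Short G v m1 u1
  s2 : Short G v m2 u2
  ht : Tails G v s3 t3 u3 s4 t4 u4
  hnd : [v, m1, m2, s3, t3, s4, t4].Nodup
  hS0 : ∀ x, x ∈ S0 ↔ x ∉ [v, m1, m2, s3, t3, s4, t4]
  hu1 : u1 ∈ S0
  hu2 : u2 ∈ S0
  hu3 : u3 ∈ S0
  hu4 : u4 ∈ S0
  hN : ∀ x, G.Adj v x → x ∈ [m1, m2, s3, s4]

variable {v m1 u1 m2 u2 s3 t3 u3 s4 t4 u4 : V} {S0 : Finset V}

lemma CfgA.col (h : SmallestCex G) (C : CfgA G v m1 u1 m2 u2 s3 t3 u3 s4 t4 u4 S0)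
    (c : V → Fin 5) (hc : ColOn G (S0 : Set V) c) : c u1 ≠ c u2 := by
  intro heq
  obtain ⟨k, k1, k2, k3⟩ := pick3 (c u1) (c u3) (c u4)
  have hnd := C.hnd
  simp only [List.nodup_cons, List.mem_cons, List.not_mem_nil, or_false, not_or,
      not_false_eq_true, List.nodup_nil, and_true] at hnd
  refine ext_all h C.s1.ext C.s2.ext C.ht.l3.ext C.ht.l4.ext ?_ ?_ ?_ ?_ ?_ ?_ ?_ (S0 : Set V) ?_
    C.hu1 C.hu2 C.hu3 C.hu4 ?_ c hc k k1 (heq ▸ k1) k2 k3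
  · rintro x rfl h
    exact hnd.2.1.1 h.symm
  · rintro x (rfl | rfl) h
    · exact hnd.2.1.2.1 h.symm
    · exact hnd.2.1.2.2.1 h.symm
  · rintro x (rfl | rfl) h
    · exact hnd.2.1.2.2.2.1 h.symm
    · exact hnd.2.1.2.2.2.2 h.symm
  · rintro x (rfl | rfl) h
    · exact hnd.2.2.1.1 h.symm
    · exact hnd.2.2.1.2.1 h.symm
  · rintro x (rfl | rfl) h
    · exact hnd.2.2.1.2.2.1 h.symm
    · exact hnd.2.2.1.2.2.2 h.symm
  · rintro x (rfl | rfl) (h | h)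
    · exact hnd.2.2.2.1.2.1 h.symm
    · exact hnd.2.2.2.2.1.1 h.symm
    · exact hnd.2.2.2.1.2.2 h.symm
    · exact hnd.2.2.2.2.1.2 h.symm
  · simp only [Set.mem_singleton_iff, Set.mem_insert_iff]
    tauto
  · intro x
    rw [Finset.mem_coe, C.hS0]
    simp only [Set.mem_singleton_iff, Set.mem_insert_iff, List.mem_cons, List.not_mem_nil, or_false]
    tauto
  · intro x hx hxS
    have h1 := C.hN x hx
    rw [Finset.mem_coe, C.hS0] at hxS
    simp only [List.mem_cons, List.not_mem_nil, or_false] at h1 hxS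
    tauto

lemma card_out4 {a b c d : V} (S : Finset V) (hnd : [a, b, c, d].Nodup) (ha : a ∉ S) (hb : b ∉ S)
    (hc : c ∉ S) (hd : d ∉ S) : S.card + 4 ≤ Fintype.card V := by
  simp only [List.nodup_cons, List.mem_cons, List.not_mem_nil, or_false, not_or,
      not_false_eq_true, List.nodup_nil, and_true] at hnd
  have e1 : (insert a (insert b (insert c (insert d S)))).card = S.card + 4 := by
    rw [Finset.card_insert_of_notMem, Finset.card_insert_of_notMem, Finset.card_insert_of_notMem,
      Finset.card_insert_of_notMem]
    · exact hd
    · simp [hnd, hc]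
    · simp [hnd, hb]
    · simp [hnd, ha]
  rw [← e1]
  exact Finset.card_le_univ _

/-- A proper set of small potential cannot miss four vertices. -/
lemma miss4 (h : SmallestCex G) {a b c d : V} (S : Finset V) (hne : S.Nonempty)
    (hnd : [a, b, c, d].Nodup) (ha : a ∉ S) (hb : b ∉ S)
    (hc : c ∉ S) (hd : d ∉ S) : 5 ≤ PP G S := by
  have h1 := card_out4 S hnd ha hb hc hd
  have hu : S ≠ Finset.univ := by
    intro hh
    rw [hh] at ha
    simp at ha
  by_contra hlt
  have := base_four h S hne hu (by omega)
  omega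

lemma CfgA.out (C : CfgA G v m1 u1 m2 u2 s3 t3 u3 s4 t4 u4 S0) :
    [s3, t3, s4, t4].Nodup ∧ ∀ x ∈ [s3, t3, s4, t4], x ∉ S0 ∧ x ≠ v ∧ x ≠ m1 ∧ x ≠ m2 := by
  have hnd := C.hnd
  have hS0 := C.hS0
  clear C
  constructor
  · exact hnd.of_cons.of_cons.of_cons
  · intro x hx
    rw [hS0]
    simp only [List.nodup_cons, List.mem_cons, List.not_mem_nil, or_false, not_or,
      not_false_eq_true, List.nodup_nil, and_true] at hnd hx ⊢
    clear hS0
    grind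

lemma CfgA.path2 (h : SmallestCex G) (C : CfgA G v m1 u1 m2 u2 s3 t3 u3 s4 t4 u4 S0)
    (hadj : ¬ G.Adj u1 u2) :
    ∃ c : V → Fin 5, ColOn G (S0 : Set V) c ∧ ¬ adj5 (c u1) (c u2) := by
  have hnd := C.hnd
  simp only [List.nodup_cons, List.mem_cons, List.not_mem_nil, or_false, not_or,
      not_false_eq_true, List.nodup_nil, and_true] at hnd
  have hS0 := C.hS0
  simp only [List.mem_cons, List.not_mem_nil, or_false, not_or] at hS0
  have hvS : v ∉ S0 := fun hh => ((hS0 v).1 hh).1 rfl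
  have hv1 : v ≠ u1 := C.s1.vu
  have hv2 : v ≠ u2 := C.s2.vu
  let K : SimpleGraph V :=
    { Adj := fun a b => (a ∈ S0 ∧ b ∈ S0 ∧ G.Adj a b) ∨ (a = v ∧ (b = u1 ∨ b = u2)) ∨
        (b = v ∧ (a = u1 ∨ a = u2))
      symm := ⟨fun a b hab => by
        rcases hab with ⟨h1, h2, h3⟩ | h1 | h1
        · exact Or.inl ⟨h2, h1, h3.symm⟩
        · exact Or.inr (Or.inr h1)
        · exact Or.inr (Or.inl h1)⟩
      loopless := ⟨fun a hab => by
        rcases hab with ⟨h1, h2, h3⟩ | ⟨h1, h2⟩ | ⟨h1, h2⟩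
        · exact G.irrefl h3
        · rcases h2 with h2 | h2
          · exact hv1 (h1.symm.trans h2)
          · exact hv2 (h1.symm.trans h2)
        · rcases h2 with h2 | h2
          · exact hv1 (h1.symm.trans h2)
          · exact hv2 (h1.symm.trans h2)⟩ }
  have hKadj : ∀ a b, K.Adj a b ↔ (a ∈ S0 ∧ b ∈ S0 ∧ G.Adj a b) ∨ (a = v ∧ (b = u1 ∨ b = u2)) ∨
        (b = v ∧ (a = u1 ∨ a = u2)) := fun a b => Iff.rfl
  by_cases hK : Colb K
  · obtain ⟨c, hc⟩ := hK
    refine ⟨c, fun a ha b hb hab => hc a b (Or.inl ⟨ha, hb, hab⟩), ?_⟩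
    intro h1
    exact no_tri (c u1) (c v) (c u2) (adj5_symm (hc v u1 (Or.inr (Or.inl ⟨rfl, Or.inl rfl⟩))))
      (hc v u2 (Or.inr (Or.inl ⟨rfl, Or.inr rfl⟩))) h1
  exfalso
  obtain ⟨K', hle, hmin⟩ := exists_minU K hK
  have hK' : ∀ a b, K'.Adj a b → (a ∈ S0 ∧ b ∈ S0 ∧ G.Adj a b) ∨ (a = v ∧ (b = u1 ∨ b = u2)) ∨
        (b = v ∧ (a = u1 ∨ a = u2)) := fun a b hab => (hKadj a b).1 (hle hab)
  have hsub : ∀ a ∈ supp K', a ∈ S0 ∨ a = v := by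
    intro a ha
    obtain ⟨b, hb⟩ := mem_supp.1 ha
    rcases hK' a b hb with h1 | h1 | h1
    · exact Or.inl h1.1
    · exact Or.inr h1.1
    · rcases h1.2 with rfl | rfl
      · exact Or.inl C.hu1
      · exact Or.inl C.hu2
  have hvs : v ∈ supp K' := by
    by_contra hvs
    apply hmin.1
    apply colb_of_le h S0 v hvS
    intro a b hab
    rcases hK' a b hab with h1 | h1 | h1
    · exact h1
    · exact absurd (h1.1 ▸ mem_supp.2 ⟨b, hab⟩) hvs
    · exact absurd (h1.1 ▸ mem_supp.2 ⟨a, hab.symm⟩) hvs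
  have hvn : ∀ b, K'.Adj v b → b = u1 ∨ b = u2 := by
    intro b hb
    rcases hK' v b hb with h1 | h1 | h1
    · exact absurd h1.1 hvS
    · exact h1.2
    · rcases h1.2 with h2 | h2
      · exact absurd h2 hv1
      · exact absurd h2 hv2
  have hboth : K'.Adj v u1 ∧ K'.Adj v u2 ∧ u1 ≠ u2 := by
    obtain ⟨b, hb⟩ := mem_supp.1 hvs
    obtain ⟨z, hz, hvz⟩ := minU_deg hmin hb
    rcases hvn b hb with rfl | rfl <;> rcases hvn z hvz with rfl | rfl
    · exact absurd rfl hz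
    · exact ⟨hb, hvz, hz.symm⟩
    · exact ⟨hvz, hb, hz⟩
    · exact absurd rfl hz
  obtain ⟨hb1, hb2, hu12⟩ := hboth
  have hu1s : u1 ∈ supp K' := mem_supp.2 ⟨_, hb1.symm⟩
  have hu2s : u2 ∈ supp K' := mem_supp.2 ⟨_, hb2.symm⟩
  have hns : ∀ x, x ≠ v → x ∉ S0 → x ∉ supp K' := by
    intro x h1 h2 h3
    rcases hsub x h3 with h4 | h4
    · exact h2 h4
    · exact h1 h4
  have hm1S : m1 ∉ S0 := fun hh => ((hS0 _).1 hh).2.1 rfl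
  have hm2S : m2 ∉ S0 := fun hh => ((hS0 _).1 hh).2.2.1 rfl
  have hlt : (supp K').card < Fintype.card V := by
    rw [← Finset.card_univ]
    apply Finset.card_lt_card
    rw [Finset.ssubset_univ_iff]
    intro hh
    exact hns m1 (Ne.symm hnd.1.1) hm1S (by rw [hh]; simp)
  set S := (supp K').erase v with hSdef
  have hSS0 : ∀ x ∈ S, x ∈ S0 := by
    intro x hx
    rw [hSdef, Finset.mem_erase] at hx
    exact (hsub x hx.2).resolve_right hx.1
  have hu1S : u1 ∈ S := Finset.mem_erase.2 ⟨hv1.symm, hu1s⟩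
  have hu2S : u2 ∈ S := Finset.mem_erase.2 ⟨hv2.symm, hu2s⟩
  have hcS : S.card + 1 = (supp K').card := Finset.card_erase_add_one hvs
  have hcount := add_count (G := G) (K := K') S {(v, u1), (v, u2), (u1, v), (u2, v)} (by
    intro a b hab
    rcases hK' a b hab with h1 | h1 | h1
    · left
      refine ⟨?_, ?_, h1.2.2⟩
      · exact Finset.mem_erase.2 ⟨fun hh => hvS (hh ▸ h1.1), mem_supp.2 ⟨_, hab⟩⟩
      · exact Finset.mem_erase.2 ⟨fun hh => hvS (hh ▸ h1.2.1), mem_supp.2 ⟨_, hab.symm⟩⟩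
    · right
      rcases h1 with ⟨rfl, rfl | rfl⟩ <;> simp
    · right
      rcases h1 with ⟨rfl, rfl | rfl⟩ <;> simp)
  have hX4 : ({(v, u1), (v, u2), (u1, v), (u2, v)} : Finset (V × V)).card ≤ 4 :=
    Finset.card_le_four
  have nS : ∀ x, x ∉ S0 → x ∉ S := fun x hx hxS => hx (hSS0 x hxS)
  have p1 := PP_insert1 (G := G) (nS m1 hm1S) hu1S C.s1.a2
  have p2 := PP_insert1 (G := G) (S := insert m1 S) (x := m2) (a := u2)
    (by simp [Ne.symm hnd.2.1.1, nS m2 hm2S]) (by simp [hu2S]) C.s2.a2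
  have p3 := PP_insert2 (G := G) (S := insert m2 (insert m1 S)) (x := v) (a := m1) (b := m2)
    (by simp [hnd.1, nS v hvS]) (by simp) (by simp) hnd.2.1.1 C.s1.a1 C.s2.a1
  have hout : ∀ x, x ∉ S0 → x ≠ v → x ≠ m1 → x ≠ m2 →
      x ∉ insert v (insert m2 (insert m1 S)) := by
    intro x h1 h2 h3 h4
    simp [h2, h3, h4, nS x h1]
  have hout' : ∀ x ∈ [s3, t3, s4, t4], x ∉ insert v (insert m2 (insert m1 S)) := fun x hx =>
    hout x (C.out.2 x hx).1 (C.out.2 x hx).2.1 (C.out.2 x hx).2.2.1 (C.out.2 x hx).2.2.2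
  have m := miss4 (a := s3) (b := t3) (c := s4) (d := t4) h _ (by simp) C.out.1
    (hout' s3 (by simp)) (hout' t3 (by simp)) (hout' s4 (by simp)) (hout' t4 (by simp))
  rcases apply_min h hmin hlt with h1 | h1 | h1
  · omega
  · obtain ⟨-, -, e, -, e2, e3⟩ := h1
    obtain ⟨i1, hi1⟩ := (e2 _).1 hu1s
    obtain ⟨i2, hi2⟩ := (e2 _).1 hu2s
    have h4 := e3 i1 i2 (by rintro rfl; exact hu12 (hi1.symm.trans hi2))
    rw [hi1, hi2] at h4
    rcases hK' _ _ h4 with h5 | h5 | h5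
    · exact hadj h5.2.2
    · exact hv1 h5.1.symm
    · exact hv2 h5.1.symm
  · omega

end caseA
section caseA2

open scoped Classical

variable {V : Type} [Fintype V] {G : SimpleGraph V}
variable {v m1 u1 m2 u2 s3 t3 u3 s4 t4 u4 : V} {S0 : Finset V}

/-- Replacing an edge of an exceptional graph by two strings through `v`. -/
lemma CfgA.ecase (h : SmallestCex G) (C : CfgA G v m1 u1 m2 u2 s3 t3 u3 s4 t4 u4 S0)
    (hu12 : u1 ≠ u2) (i : Bool) (e : Fin 10 → V) (he : Function.Injective e) (a w : Fin 10)
    (haw : (EE i).Adj a w) (heS : ∀ x, x ≠ w → e x ∈ S0 ∧ e x ≠ u1 ∧ e x ≠ u2)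
    (hL : ∀ x y, (EE i).Adj x y → x ≠ w → y ≠ w → G.Adj (e x) (e y))
    (hW : ∀ y, (EE i).Adj w y → y ≠ a → G.Adj u2 (e y)) (ha : G.Adj u1 (e a)) : False := by
  have hnd := C.hnd
  simp only [List.nodup_cons, List.mem_cons, List.not_mem_nil, or_false, not_or,
      not_false_eq_true, List.nodup_nil, and_true] at hnd
  have hS0 := C.hS0
  simp only [List.mem_cons, List.not_mem_nil, or_false, not_or] at hS0
  have hvS : v ∉ S0 := fun hh => ((hS0 v).1 hh).1 rfl
  have hm1S : m1 ∉ S0 := fun hh => ((hS0 _).1 hh).2.1 rfl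
  have hm2S : m2 ∉ S0 := fun hh => ((hS0 _).1 hh).2.2.1 rfl
  let e' := Function.update e w u2
  have ew : e' w = u2 := Function.update_self _ _ _
  have en : ∀ x, x ≠ w → e' x = e x := fun x hx => Function.update_of_ne hx _ _
  have eS : ∀ x, e' x ∈ S0 ∧ e' x ≠ u1 := by
    intro x
    by_cases hx : x = w
    · rw [hx, ew]; exact ⟨C.hu2, hu12.symm⟩
    · rw [en x hx]; exact ⟨(heS x hx).1, (heS x hx).2.1⟩
  have einj : Function.Injective e' := by
    intro x y hxy
    by_cases hx : x = w <;> by_cases hy : y = w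
    · rw [hx, hy]
    · rw [hx, ew, en y hy] at hxy
      exact absurd hxy.symm (heS y hy).2.2
    · rw [hy, ew, en x hx] at hxy
      exact absurd hxy (heS x hx).2.2
    · rw [en x hx, en y hy] at hxy
      exact he hxy
  have awn : a ≠ w := haw.ne
  have nem : ∀ {x y : V}, x ∈ S0 → y ∉ S0 → x ≠ y := fun hx hy => ne_of_mem_of_not_mem hx hy
  refine elem' h C.ht i a w haw e' einj ?_ u1 m1 m2 ?_ C.s1.a2.symm C.s1.a1.symm C.s2.a1 ?_ ?_ ?_
    ?_ ?_ ?_ ⟨nem C.hu3 hm1S, nem C.hu3 hm2S⟩ ⟨nem C.hu4 hm1S, nem C.hu4 hm2S⟩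
  · intro x y hxy h1 h2
    by_cases hx : x = w
    · subst hx
      have hy : y ≠ x := hxy.ne'
      rw [ew, en y hy]
      exact hW y hxy (fun hh => h2 ⟨rfl, hh⟩)
    · by_cases hy : y = w
      · subst hy
        rw [ew, en x hx]
        exact (hW x hxy.symm (fun hh => h1 ⟨hh, rfl⟩)).symm
      · rw [en x hx, en y hy]
        exact hL x y hxy hx hy
  · rw [en a awn]; exact ha.symm
  · rw [ew]; exact C.s2.a2
  · simp only [List.nodup_cons, List.mem_cons, List.not_mem_nil, or_false, not_or,
      not_false_eq_true, List.nodup_nil, and_true]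
    exact ⟨⟨nem C.hu1 hm1S, nem C.hu1 hvS, nem C.hu1 hm2S⟩, ⟨Ne.symm hnd.1.1, hnd.2.1.1⟩, hnd.1.2.1⟩
  · intro x
    simp only [List.mem_cons, List.not_mem_nil, or_false, not_or]
    exact ⟨(eS x).2, nem (eS x).1 hm1S, nem (eS x).1 hvS, nem (eS x).1 hm2S⟩
  · intro x hx
    exact (C.s1.n x hx).symm
  · intro x hx
    rw [ew]
    exact C.s2.n x hx
  · intro x hx
    obtain ⟨o1, o2, o3, o4⟩ := C.out.2 x hx
    refine ⟨fun j => nem (eS j).1 o1, ?_⟩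
    simp only [List.mem_cons, List.not_mem_nil, or_false, not_or]
    exact ⟨(nem C.hu1 o1).symm, o3, o2, o4⟩

lemma CfgA.symm (C : CfgA G v m1 u1 m2 u2 s3 t3 u3 s4 t4 u4 S0) :
    CfgA G v m2 u2 m1 u1 s3 t3 u3 s4 t4 u4 S0 := by
  obtain ⟨s1, s2, ht, hnd, hS0, hu1, hu2, hu3, hu4, hN⟩ := C
  refine ⟨s2, s1, ht, ?_, ?_, hu2, hu1, hu3, hu4, ?_⟩
  · simp only [List.nodup_cons, List.mem_cons, List.not_mem_nil, or_false, not_or,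
      not_false_eq_true, List.nodup_nil, and_true] at hnd ⊢
    clear hN hS0
    grind
  · intro x
    rw [hS0]
    simp only [List.mem_cons, List.not_mem_nil, or_false]
    tauto
  · intro x hx
    have := hN x hx
    simp only [List.mem_cons, List.not_mem_nil, or_false] at this ⊢
    tauto

lemma CfgA.main (h : SmallestCex G) (C : CfgA G v m1 u1 m2 u2 s3 t3 u3 s4 t4 u4 S0)
    (hadj : ¬ G.Adj u1 u2) : u1 ≠ u2 ∧ ∃ b c, b ∈ S0 ∧ c ∈ S0 ∧ b ≠ u1 ∧ b ≠ u2 ∧ c ≠ u1 ∧ c ≠ u2 ∧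
      G.Adj u1 b ∧ G.Adj b c ∧ G.Adj c u2 := by
  have hnd := C.hnd
  simp only [List.nodup_cons, List.mem_cons, List.not_mem_nil, or_false, not_or,
      not_false_eq_true, List.nodup_nil, and_true] at hnd
  have hS0 := C.hS0
  simp only [List.mem_cons, List.not_mem_nil, or_false, not_or] at hS0
  have hvS : v ∉ S0 := fun hh => ((hS0 v).1 hh).1 rfl
  have hm1S : m1 ∉ S0 := fun hh => ((hS0 _).1 hh).2.1 rfl
  have hm2S : m2 ∉ S0 := fun hh => ((hS0 _).1 hh).2.2.1 rfl
  have nem : ∀ {x y : V}, x ∈ S0 → y ∉ S0 → x ≠ y := fun hx hy => ne_of_mem_of_not_mem hx hy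
  obtain ⟨ψ, hψ, hψn⟩ := C.path2 h hadj
  have hψu : ψ u1 ≠ ψ u2 := C.col h ψ hψ
  have hu12 : u1 ≠ u2 := fun hh => hψu (by rw [hh])
  refine ⟨hu12, ?_⟩
  let f : V → V := fun x => if x = u1 then u2 else x
  have f1 : f u1 = u2 := by simp [f]
  have fn : ∀ x, x ≠ u1 → f x = x := fun x hx => by simp [f, hx]
  have finv : ∀ x z, f x = z → (x = u1 ∧ z = u2) ∨ (x = z ∧ x ≠ u1) := by
    intro x z hz
    by_cases hx : x = u1
    · left; rw [hx, f1] at hz; exact ⟨hx, hz.symm⟩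
    · right; rw [fn x hx] at hz; exact ⟨hz, hx⟩
  let K := imgG (fun a b => a ∈ S0 ∧ b ∈ S0 ∧ G.Adj a b) (fun a b hh => ⟨hh.2.1, hh.1, hh.2.2.symm⟩)
    f (by
      rintro a b ⟨ha, hb, hab⟩ heq
      rcases finv a _ heq with ⟨h1, h2⟩ | ⟨h1, h2⟩ <;> rcases finv b _ rfl with ⟨h3, h4⟩ | ⟨h3, h4⟩
      · exact hab.ne (h1.trans h3.symm)
      · rw [h2] at h3
        rw [h1, h3] at hab
        exact hadj hab
      · rw [h4] at h1
        rw [h1, h3] at hab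
        exact hadj hab.symm
      · exact hab.ne (h1.trans h3.symm))
  have hK : ¬ Colb K := by
    rintro ⟨c, hc⟩
    refine C.col h (fun x => c (f x)) (fun a ha b hb hab => hc _ _ ⟨a, b, ⟨ha, hb, hab⟩, rfl, rfl⟩) ?_
    simp only [f1, fn u2 hu12.symm]
  obtain ⟨K', hle, hmin⟩ := exists_minU K hK
  have hlift : ∀ z z', K'.Adj z z' → ∃ a b, (a ∈ S0 ∧ b ∈ S0 ∧ G.Adj a b) ∧ f a = z ∧ f b = z' :=
    fun z z' hzz => hle hzz
  have hsub : ∀ z ∈ supp K', z ∈ S0 ∧ z ≠ u1 := by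
    intro z hz
    obtain ⟨z', hz'⟩ := mem_supp.1 hz
    obtain ⟨a, b, ⟨h1, -, -⟩, h2, -⟩ := hlift z z' hz'
    rcases finv a z h2 with ⟨h3, rfl⟩ | ⟨rfl, h4⟩
    · exact ⟨C.hu2, hu12.symm⟩
    · exact ⟨h1, h4⟩
  have hLift2 : ∀ z z', K'.Adj z z' → z ≠ u2 → z' ≠ u2 → G.Adj z z' := by
    intro z z' hzz h1 h2
    obtain ⟨a, b, ⟨-, -, h3⟩, h4, h5⟩ := hlift z z' hzz
    rcases finv a z h4 with ⟨-, h6⟩ | ⟨rfl, -⟩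
    · exact absurd h6 h1
    · rcases finv b z' h5 with ⟨-, h6⟩ | ⟨rfl, -⟩
      · exact absurd h6 h2
      · exact h3
  have hLift1 : ∀ z', K'.Adj u2 z' → G.Adj u2 z' ∨ G.Adj u1 z' := by
    intro z' hzz
    have h2 : z' ≠ u2 := hzz.ne'
    obtain ⟨a, b, ⟨-, -, h3⟩, h4, h5⟩ := hlift u2 z' hzz
    rcases finv b z' h5 with ⟨-, h6⟩ | ⟨rfl, -⟩
    · exact absurd h6 h2
    · rcases finv a _ h4 with ⟨rfl, -⟩ | ⟨rfl, -⟩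
      · exact Or.inr h3
      · exact Or.inl h3
  -- not all neighbours of the identified vertex come from one side
  have hside2 : ∃ z, K'.Adj u2 z ∧ ¬ G.Adj u2 z := by
    by_contra hcon
    push Not at hcon
    apply hmin.1
    apply colb_of_le h S0 v hvS
    intro a b hab
    refine ⟨(hsub a (mem_supp.2 ⟨_, hab⟩)).1, (hsub b (mem_supp.2 ⟨_, hab.symm⟩)).1, ?_⟩
    by_cases ha : a = u2
    · subst ha; exact hcon b hab
    · by_cases hb : b = u2
      · subst hb; exact (hcon a hab.symm).symm
      · exact hLift2 a b hab ha hb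
  have hside1 : ∃ z, K'.Adj u2 z ∧ ¬ G.Adj u1 z := by
    by_contra hcon
    push Not at hcon
    apply hmin.1
    refine ⟨fun z => if z = u2 then ψ u1 else ψ z, ?_⟩
    intro a b hab
    have haS := (hsub a (mem_supp.2 ⟨_, hab⟩)).1
    have hbS := (hsub b (mem_supp.2 ⟨_, hab.symm⟩)).1
    by_cases ha : a = u2
    · subst ha
      have hb : b ≠ a := hab.ne'
      simp only [if_true, hb, if_false]
      exact hψ u1 C.hu1 b hbS (hcon b hab)
    · by_cases hb : b = u2
      · subst hb
        simp only [if_true, ha, if_false]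
        exact hψ a haS u1 C.hu1 (hcon a hab.symm).symm
      · simp only [ha, hb, if_false]
        exact hψ a haS b hbS (hLift2 a b hab ha hb)
  have hu2s : u2 ∈ supp K' := by
    obtain ⟨z, hz, -⟩ := hside2
    exact mem_supp.2 ⟨_, hz⟩
  have hu1s : u1 ∉ supp K' := fun hh => (hsub u1 hh).2 rfl
  have hlt : (supp K').card < Fintype.card V := by
    rw [← Finset.card_univ]
    apply Finset.card_lt_card
    rw [Finset.ssubset_univ_iff]
    intro hh
    exact hu1s (by rw [hh]; simp)
  rcases apply_min h hmin hlt with h1 | h1 | h1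
  · exfalso
    set S := insert u1 (supp K') with hSdef
    have hSS0 : ∀ x ∈ S, x ∈ S0 := by
      intro x hx
      rcases Finset.mem_insert.1 hx with rfl | hx
      · exact C.hu1
      · exact (hsub x hx).1
    haveI : Nonempty V := ⟨v⟩
    have hcnt := count_lift (G := G) f K' ∅ S ∅ (by simp) (by
      intro z z' hzz _
      obtain ⟨a, b, ⟨-, -, h3⟩, h4, h5⟩ := hlift z z' hzz
      refine ⟨a, b, h3, h4, h5, ?_, ?_, by simp⟩
      · rcases finv a z h4 with ⟨rfl, -⟩ | ⟨rfl, -⟩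
        · simp [hSdef]
        · exact Finset.mem_insert_of_mem (mem_supp.2 ⟨_, hzz⟩)
      · rcases finv b z' h5 with ⟨rfl, -⟩ | ⟨rfl, -⟩
        · simp [hSdef]
        · exact Finset.mem_insert_of_mem (mem_supp.2 ⟨_, hzz.symm⟩)) ∅ (by simp)
    have hSc : S.card = (supp K').card + 1 := Finset.card_insert_of_notMem hu1s
    have hPS : PP G S ≤ 6 := by
      unfold PP
      simp only [Finset.card_empty] at hcnt
      omega
    have nS : ∀ x, x ∉ S0 → x ∉ S := fun x hx hxS => hx (hSS0 x hxS)
    have hu1S : u1 ∈ S := Finset.mem_insert_self _ _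
    have hu2S : u2 ∈ S := Finset.mem_insert_of_mem hu2s
    have p1 := PP_insert1 (G := G) (nS m1 hm1S) hu1S C.s1.a2
    have p2 := PP_insert1 (G := G) (S := insert m1 S) (x := m2) (a := u2)
      (by simp [Ne.symm hnd.2.1.1, nS m2 hm2S]) (by simp [hu2S]) C.s2.a2
    have p3 := PP_insert2 (G := G) (S := insert m2 (insert m1 S)) (x := v) (a := m1) (b := m2)
      (by simp [hnd.1, nS v hvS]) (by simp) (by simp) hnd.2.1.1 C.s1.a1 C.s2.a1
    have hout' : ∀ x ∈ [s3, t3, s4, t4], x ∉ insert v (insert m2 (insert m1 S)) := by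
      intro x hx
      obtain ⟨o1, o2, o3, o4⟩ := C.out.2 x hx
      simp [o2, o3, o4, nS x o1]
    obtain ⟨g, hg, g1, g2⟩ := norm30 _ _ hψu hψn
    let φ : V → Fin 6 := fun x => if x = v then 5 else if x = m1 ∨ x = m2 then 4 else
      (g (ψ x)).castSucc
    have φv : φ v = 5 := by simp [φ]
    have φm1 : φ m1 = 4 := by simp [φ, Ne.symm hnd.1.1]
    have φm2 : φ m2 = 4 := by simp [φ, Ne.symm hnd.1.2.1]
    have φS : ∀ x ∈ S, φ x = (g (ψ x)).castSucc := by
      intro x hx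
      have hx := hSS0 x hx
      simp [φ, nem hx hvS, nem hx hm1S, nem hx hm2S]
    have hmem : ∀ x ∈ insert v (insert m2 (insert m1 S)), x = v ∨ x = m2 ∨ x = m1 ∨ x ∈ S := by
      intro x hx
      simpa using hx
    have hns : ∀ x ∈ S, ¬ G.Adj v x := by
      intro x hx hvx
      have h3 := C.hN x hvx
      have h4 := (hS0 x).1 (hSS0 x hx)
      simp only [List.mem_cons, List.not_mem_nil, or_false] at h3
      rcases h3 with h3 | h3 | h3 | h3
      · exact h4.2.1 h3
      · exact h4.2.2.1 h3
      · exact h4.2.2.2.1 h3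
      · exact h4.2.2.2.2.2.1 h3
    have hm1n : ∀ x ∈ S, G.Adj m1 x → adj6 4 (φ x) := by
      intro x hx hmx
      rcases C.s1.n x hmx with h3 | h3
      · exact absurd h3 (nem (hSS0 x hx) hvS)
      · rw [φS x hx, h3, g1]; decide
    have hm2n : ∀ x ∈ S, G.Adj m2 x → adj6 4 (φ x) := by
      intro x hx hmx
      rcases C.s2.n x hmx with h3 | h3
      · exact absurd h3 (nem (hSS0 x hx) hvS)
      · rw [φS x hx, h3, g2]; decide
    have hm12 : ¬ G.Adj m1 m2 := by
      intro hmm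
      rcases C.s1.n _ hmm with h3 | h3
      · exact hnd.1.2.1 h3.symm
      · exact nem C.hu1 hm2S h3.symm
    have d54 : adj6 5 4 := by decide
    refine tail h C.ht _ (by simp) (hout' s3 (by simp)) (hout' t3 (by simp)) (hout' s4 (by simp))
      (hout' t4 (by simp)) (by omega) φ ?_ ⟨m1, by simp, m2, by simp, hnd.2.1.1, by
        rw [φm1, φm2]⟩ φv ?_
    · intro a ha b hb hab
      rcases hmem a ha with rfl | rfl | rfl | ha' <;> rcases hmem b hb with rfl | rfl | rfl | hb'
      · exact absurd hab G.irrefl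
      · rw [φv, φm2]; exact d54
      · rw [φv, φm1]; exact d54
      · exact absurd hab (hns b hb')
      · rw [φv, φm2]; exact adj6_symm d54
      · exact absurd hab G.irrefl
      · exact absurd hab.symm hm12
      · rw [φm2]; exact hm2n b hb' hab
      · rw [φv, φm1]; exact adj6_symm d54
      · exact absurd hab hm12
      · exact absurd hab G.irrefl
      · rw [φm1]; exact hm1n b hb' hab
      · exact absurd hab.symm (hns a ha')
      · rw [φm2]; exact adj6_symm (hm2n a ha' hab.symm)
      · rw [φm1]; exact adj6_symm (hm1n a ha' hab.symm)
      · rw [φS a ha', φS b hb']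
        exact adj6_castSucc (hg _ _ (hψ a (hSS0 a ha') b (hSS0 b hb') hab))
    · intro x hx hxv
      rcases hmem x hx with rfl | rfl | rfl | hx
      · exact absurd rfl hxv
      · rw [φm2]; decide
      · rw [φm1]; decide
      · rw [φS x hx]
        generalize g (ψ x) = y
        revert y
        decide
  · obtain ⟨-, -, e, e1, e2, e3⟩ := h1
    obtain ⟨i0, hi0⟩ := (e2 _).1 hu2s
    obtain ⟨i1, i2, hi1, hi2, hi12⟩ : ∃ i1 i2 : Fin 3, i1 ≠ i0 ∧ i2 ≠ i0 ∧ i1 ≠ i2 :=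
      (by decide : ∀ i0 : Fin 3, ∃ i1 i2 : Fin 3, i1 ≠ i0 ∧ i2 ≠ i0 ∧ i1 ≠ i2) i0
    have key : ∀ i1 i2 : Fin 3, i1 ≠ i0 → i2 ≠ i0 → i1 ≠ i2 → G.Adj u1 (e i1) → G.Adj u2 (e i2) →
        ∃ b c, b ∈ S0 ∧ c ∈ S0 ∧ b ≠ u1 ∧ b ≠ u2 ∧ c ≠ u1 ∧ c ≠ u2 ∧
      G.Adj u1 b ∧ G.Adj b c ∧ G.Adj c u2 := by
      intro i1 i2 hi1 hi2 hi12 a1 a2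
      have q1 := hsub (e i1) ((e2 _).2 ⟨_, rfl⟩)
      have q2 := hsub (e i2) ((e2 _).2 ⟨_, rfl⟩)
      have r1 : e i1 ≠ u2 := fun hh => hi1 (e1 (hh.trans hi0.symm))
      have r2 : e i2 ≠ u2 := fun hh => hi2 (e1 (hh.trans hi0.symm))
      exact ⟨e i1, e i2, q1.1, q2.1, q1.2, r1, q2.2, r2, a1, hLift2 _ _ (e3 _ _ hi12) r1 r2, a2.symm⟩
    have q1 := hsub (e i1) ((e2 _).2 ⟨_, rfl⟩)
    have q2 := hsub (e i2) ((e2 _).2 ⟨_, rfl⟩)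
    have r1 : e i1 ≠ u2 := fun hh => hi1 (e1 (hh.trans hi0.symm))
    have r2 : e i2 ≠ u2 := fun hh => hi2 (e1 (hh.trans hi0.symm))
    have r12 := hLift2 _ _ (e3 _ _ hi12) r1 r2
    have t1 := hLift1 (e i1) (hi0 ▸ e3 i0 i1 hi1.symm)
    have t2 := hLift1 (e i2) (hi0 ▸ e3 i0 i2 hi2.symm)
    have tri : ∀ u ∈ S0, G.Adj u (e i1) → G.Adj u (e i2) → False := by
      intro u hu a1 a2
      exact no_tri (ψ u) (ψ (e i1)) (ψ (e i2)) (hψ u hu _ q1.1 a1) (hψ _ q1.1 _ q2.1 r12)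
        (hψ u hu _ q2.1 a2)
    rcases t1 with t1 | t1 <;> rcases t2 with t2 | t2
    · exact (tri u2 C.hu2 t1 t2).elim
    · exact key i2 i1 hi2 hi1 hi12.symm t2 t1
    · exact key i1 i2 hi1 hi2 hi12 t1 t2
    · exact (tri u1 C.hu1 t1 t2).elim
  · exfalso
    obtain ⟨-, -, i, e, e1, e2, e3⟩ := h1
    obtain ⟨w, hw⟩ := (e2 _).1 hu2s
    have heS : ∀ x, x ≠ w → e x ∈ S0 ∧ e x ≠ u1 ∧ e x ≠ u2 := by
      intro x hx
      have q1 := hsub (e x) ((e2 _).2 ⟨_, rfl⟩)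
      exact ⟨q1.1, q1.2, fun hh => hx (e1 (hh.trans hw.symm))⟩
    have hL : ∀ x y, (EE i).Adj x y → x ≠ w → y ≠ w → G.Adj (e x) (e y) := fun x y hxy hx hy =>
      hLift2 _ _ ((e3 x y).2 hxy) (heS x hx).2.2 (heS y hy).2.2
    have hW : ∀ y, (EE i).Adj w y → G.Adj u2 (e y) ∨ G.Adj u1 (e y) := fun y hy =>
      hLift1 _ (hw ▸ (e3 w y).2 hy)
    obtain ⟨za, ha1, ha2⟩ := hside2
    obtain ⟨zb, hb1, hb2⟩ := hside1
    obtain ⟨a, rfl⟩ := (e2 za).1 (mem_supp.2 ⟨_, ha1.symm⟩)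
    obtain ⟨b, rfl⟩ := (e2 zb).1 (mem_supp.2 ⟨_, hb1.symm⟩)
    rw [← hw, e3] at ha1 hb1
    have ha3 := (hW a ha1).resolve_left ha2
    have hb3 := (hW b hb1).resolve_right hb2
    by_cases hj : ∃ j, (EE i).Adj w j ∧ j ≠ a ∧ ¬ G.Adj u2 (e j)
    · obtain ⟨j, hj1, hj2, hj3⟩ := hj
      have hj4 := (hW j hj1).resolve_left hj3
      have hab : a ≠ b := by rintro rfl; exact ha2 hb3
      have hjb : j ≠ b := by rintro rfl; exact hj3 hb3
      refine C.symm.ecase h hu12.symm i e e1 b w hb1.symm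
        (fun x hx => ⟨(heS x hx).1, (heS x hx).2.2, (heS x hx).2.1⟩) hL ?_ hb3
      intro y hy hyb
      by_contra hno
      have hya : y ≠ a := by rintro rfl; exact hno ha3
      have hyj : y ≠ j := by rintro rfl; exact hno hj4
      have hd := edeg i w
      have hsub : ({a, b, j, y} : Finset (Fin 10)) ⊆ (Finset.univ : Finset (Fin 10)).filter
          (fun q => ladj (elist i) w.val q.val = true) := by
        intro x hx
        simp only [Finset.mem_insert, Finset.mem_singleton] at hx
        rw [Finset.mem_filter]
        refine ⟨Finset.mem_univ _, (EE_adj i w x).1 ?_⟩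
        rcases hx with rfl | rfl | rfl | rfl <;> assumption
      have h4 : ({a, b, j, y} : Finset (Fin 10)).card = 4 := by
        rw [Finset.card_insert_of_notMem, Finset.card_insert_of_notMem,
          Finset.card_insert_of_notMem, Finset.card_singleton]
        · simpa using hyj.symm
        · simp [hjb.symm, Ne.symm hyb]
        · simp [hab, hj2.symm, hya.symm]
      have h5 := Finset.card_le_card hsub
      rw [h4] at h5
      have h6 := h5.trans hd
      omega
    · push Not at hj
      exact C.ecase h hu12 i e e1 a w ha1.symm heS hL hj ha3

end caseA2
section caseB

open scoped Classical

variable {V : Type} [Fintype V] {G : SimpleGraph V}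

lemma pick4 : ∀ x x' y z : Fin 5, adj5 x x' → ∃ k : Fin 5, ¬ adj5 k x ∧ k ≠ x' ∧ k ≠ y ∧ k ≠ z := by
  decide +kernel

lemma pick5 : ∀ x y z t : Fin 5, ∃ k : Fin 5, k ≠ x ∧ k ≠ y ∧ k ≠ z ∧ k ≠ t := by
  decide +kernel

lemma no_three : ∀ x y z t : Fin 5, adj5 x y → adj5 y z → adj5 z t → x ≠ t := by decide +kernel

/-- The configuration with one string of length two and three of length three. -/
structure CfgB (G : SimpleGraph V) (v m1 u1 n n' u2 s3 t3 u3 s4 t4 u4 : V) (S0 : Finset V) :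
    Prop where
  s1 : Short G v m1 u1
  l2 : Long G v n n' u2
  ht : Tails G v s3 t3 u3 s4 t4 u4
  hnd : [v, m1, n, n', s3, t3, s4, t4].Nodup
  hS0 : ∀ x, x ∈ S0 ↔ x ∉ [v, m1, n, n', s3, t3, s4, t4]
  hu1 : u1 ∈ S0
  hu2 : u2 ∈ S0
  hu3 : u3 ∈ S0
  hu4 : u4 ∈ S0
  hN : ∀ x, G.Adj v x → x ∈ [m1, n, s3, s4]

variable {v m1 u1 n n' u2 s3 t3 u3 s4 t4 u4 : V} {S0 : Finset V}

lemma CfgB.col (h : SmallestCex G) (C : CfgB G v m1 u1 n n' u2 s3 t3 u3 s4 t4 u4 S0)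
    (c : V → Fin 5) (hc : ColOn G (S0 : Set V) c) : ¬ adj5 (c u1) (c u2) := by
  intro heq
  obtain ⟨k, k1, k2, k3, k4⟩ := pick4 (c u1) (c u2) (c u3) (c u4) heq
  have hnd := C.hnd
  simp only [List.nodup_cons, List.mem_cons, List.not_mem_nil, or_false, not_or,
      not_false_eq_true, List.nodup_nil, and_true] at hnd
  obtain ⟨a0, a1, a2, a3, a4, a5, a6⟩ := hnd
  refine ext_all h C.s1.ext C.l2.ext C.ht.l3.ext C.ht.l4.ext ?_ ?_ ?_ ?_ ?_ ?_ ?_ (S0 : Set V) ?_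
    C.hu1 C.hu2 C.hu3 C.hu4 ?_ c hc k k1 k2 k3 k4
  · rintro x (rfl | rfl) h
    · exact a1.1 h.symm
    · exact a1.2.1 h.symm
  · rintro x (rfl | rfl) h
    · exact a1.2.2.1 h.symm
    · exact a1.2.2.2.1 h.symm
  · rintro x (rfl | rfl) h
    · exact a1.2.2.2.2.1 h.symm
    · exact a1.2.2.2.2.2 h.symm
  · rintro x (rfl | rfl) (h | h)
    · exact a2.2.1 h.symm
    · exact a3.1 h.symm
    · exact a2.2.2.1 h.symm
    · exact a3.2.1 h.symm
  · rintro x (rfl | rfl) (h | h)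
    · exact a2.2.2.2.1 h.symm
    · exact a3.2.2.1 h.symm
    · exact a2.2.2.2.2 h.symm
    · exact a3.2.2.2 h.symm
  · rintro x (rfl | rfl) (h | h)
    · exact a4.2.1 h.symm
    · exact a5.1 h.symm
    · exact a4.2.2 h.symm
    · exact a5.2 h.symm
  · simp only [Set.mem_singleton_iff, Set.mem_insert_iff]
    tauto
  · intro x
    rw [Finset.mem_coe, C.hS0]
    simp only [Set.mem_singleton_iff, Set.mem_insert_iff, List.mem_cons, List.not_mem_nil, or_false]
    tauto
  · intro x hx hxS
    have h1 := C.hN x hx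
    rw [Finset.mem_coe, C.hS0] at hxS
    simp only [List.mem_cons, List.not_mem_nil, or_false] at h1 hxS
    tauto

lemma CfgB.out (C : CfgB G v m1 u1 n n' u2 s3 t3 u3 s4 t4 u4 S0) :
    [s3, t3, s4, t4].Nodup ∧
      ∀ x ∈ [s3, t3, s4, t4], x ∉ S0 ∧ x ≠ v ∧ x ≠ m1 ∧ x ≠ n ∧ x ≠ n' := by
  have hnd := C.hnd
  have hS0 := C.hS0
  clear C
  constructor
  · exact hnd.of_cons.of_cons.of_cons.of_cons
  · intro x hx
    rw [hS0]
    simp only [List.nodup_cons, List.mem_cons, List.not_mem_nil, or_false, not_or,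
      not_false_eq_true, List.nodup_nil, and_true] at hnd hx ⊢
    clear hS0
    grind

lemma CfgB.path3 (h : SmallestCex G) (C : CfgB G v m1 u1 n n' u2 s3 t3 u3 s4 t4 u4 S0)
    (hu12 : u1 ≠ u2) :
    ∃ c : V → Fin 5, ColOn G (S0 : Set V) c ∧ c u1 ≠ c u2 := by
  have hS0 := C.hS0
  simp only [List.mem_cons, List.not_mem_nil, or_false, not_or] at hS0
  have hvS : v ∉ S0 := fun hh => ((hS0 v).1 hh).1 rfl
  have hm1S : m1 ∉ S0 := fun hh => ((hS0 _).1 hh).2.1 rfl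
  have nem : ∀ {x y : V}, x ∈ S0 → y ∉ S0 → x ≠ y := fun hx hy => ne_of_mem_of_not_mem hx hy
  have hv1 : u1 ≠ v := nem C.hu1 hvS
  have hv2 : u2 ≠ v := nem C.hu2 hvS
  have hw1 : u1 ≠ m1 := nem C.hu1 hm1S
  have hw2 : u2 ≠ m1 := nem C.hu2 hm1S
  have hvm : v ≠ m1 := C.s1.a1.ne
  let R : V → V → Prop := fun a b => (a = u1 ∧ b = v) ∨ (a = v ∧ b = m1) ∨ (a = m1 ∧ b = u2)
  let K : SimpleGraph V :=
    { Adj := fun a b => (a ∈ S0 ∧ b ∈ S0 ∧ G.Adj a b) ∨ R a b ∨ R b a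
      symm := ⟨fun a b hab => by
        rcases hab with ⟨h1, h2, h3⟩ | h1 | h1
        · exact Or.inl ⟨h2, h1, h3.symm⟩
        · exact Or.inr (Or.inr h1)
        · exact Or.inr (Or.inl h1)⟩
      loopless := ⟨fun a hab => by
        have key : ¬ R a a := by
          rintro (⟨h1, h2⟩ | ⟨h1, h2⟩ | ⟨h1, h2⟩)
          · exact hv1 (h1.symm.trans h2)
          · exact hvm (h1.symm.trans h2)
          · exact hw2 (h2.symm.trans h1)
        rcases hab with ⟨h1, h2, h3⟩ | h1 | h1
        · exact G.irrefl h3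
        · exact key h1
        · exact key h1⟩ }
  have hKadj : ∀ a b, K.Adj a b ↔ (a ∈ S0 ∧ b ∈ S0 ∧ G.Adj a b) ∨ R a b ∨ R b a :=
    fun a b => Iff.rfl
  have R1 : R u1 v := Or.inl ⟨rfl, rfl⟩
  have R2 : R v m1 := Or.inr (Or.inl ⟨rfl, rfl⟩)
  have R3 : R m1 u2 := Or.inr (Or.inr ⟨rfl, rfl⟩)
  by_cases hK : Colb K
  · obtain ⟨c, hc⟩ := hK
    exact ⟨c, fun a ha b hb hab => hc a b (Or.inl ⟨ha, hb, hab⟩),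
      no_three _ _ _ _ (hc u1 v (Or.inr (Or.inl R1))) (hc v m1 (Or.inr (Or.inl R2)))
        (hc m1 u2 (Or.inr (Or.inl R3)))⟩
  exfalso
  obtain ⟨K', hle, hmin⟩ := exists_minU K hK
  have hK' : ∀ a b, K'.Adj a b → (a ∈ S0 ∧ b ∈ S0 ∧ G.Adj a b) ∨ R a b ∨ R b a :=
    fun a b hab => (hKadj a b).1 (hle hab)
  have hvn : ∀ b, K'.Adj v b → b = u1 ∨ b = m1 := by
    intro b hb
    rcases hK' v b hb with h1 | (h1 | h1 | h1) | (h1 | h1 | h1)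
    · exact absurd h1.1 hvS
    · exact absurd h1.1.symm hv1
    · exact Or.inr h1.2
    · exact absurd h1.1 hvm
    · exact Or.inl h1.1
    · exact absurd h1.2 hvm
    · exact absurd h1.2.symm hv2
  have hmn : ∀ b, K'.Adj m1 b → b = v ∨ b = u2 := by
    intro b hb
    rcases hK' m1 b hb with h1 | (h1 | h1 | h1) | (h1 | h1 | h1)
    · exact absurd h1.1 hm1S
    · exact absurd h1.1.symm hw1
    · exact absurd h1.1.symm hvm
    · exact Or.inr h1.2
    · exact absurd h1.2.symm hvm
    · exact Or.inl h1.1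
    · exact absurd h1.2.symm hw2
  have hv' : v ∈ supp K' → K'.Adj v u1 ∧ K'.Adj v m1 := by
    intro hvs
    obtain ⟨b, hb⟩ := mem_supp.1 hvs
    obtain ⟨z, hz, hvz⟩ := minU_deg hmin hb
    rcases hvn b hb with rfl | rfl <;> rcases hvn z hvz with rfl | rfl
    · exact absurd rfl hz
    · exact ⟨hb, hvz⟩
    · exact ⟨hvz, hb⟩
    · exact absurd rfl hz
  have hm' : m1 ∈ supp K' → K'.Adj m1 v ∧ K'.Adj m1 u2 := by
    intro hvs
    obtain ⟨b, hb⟩ := mem_supp.1 hvs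
    obtain ⟨z, hz, hvz⟩ := minU_deg hmin hb
    rcases hmn b hb with rfl | rfl <;> rcases hmn z hvz with rfl | rfl
    · exact absurd rfl hz
    · exact ⟨hb, hvz⟩
    · exact ⟨hvz, hb⟩
    · exact absurd rfl hz
  have hvs : v ∈ supp K' := by
    by_contra hvs
    have hms : m1 ∉ supp K' := fun hh => hvs (mem_supp.2 ⟨_, (hm' hh).1.symm⟩)
    apply hmin.1
    apply colb_of_le h S0 v hvS
    intro a b hab
    have sa : a ∈ supp K' := mem_supp.2 ⟨b, hab⟩
    have sb : b ∈ supp K' := mem_supp.2 ⟨a, hab.symm⟩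
    rcases hK' a b hab with h1 | (h1 | h1 | h1) | (h1 | h1 | h1)
    · exact h1
    · exact absurd (h1.2 ▸ sb) hvs
    · exact absurd (h1.1 ▸ sa) hvs
    · exact absurd (h1.1 ▸ sa) hms
    · exact absurd (h1.2 ▸ sa) hvs
    · exact absurd (h1.1 ▸ sb) hvs
    · exact absurd (h1.1 ▸ sb) hms
  obtain ⟨w1, w2⟩ := hv' hvs
  have hms : m1 ∈ supp K' := mem_supp.2 ⟨_, w2.symm⟩
  obtain ⟨-, w3⟩ := hm' hms
  have hu1s : u1 ∈ supp K' := mem_supp.2 ⟨_, w1.symm⟩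
  have hsub : ∀ a ∈ supp K', a ∈ S0 ∨ a = v ∨ a = m1 := by
    intro a ha
    obtain ⟨b, hb⟩ := mem_supp.1 ha
    rcases hK' a b hb with h1 | (h1 | h1 | h1) | (h1 | h1 | h1)
    · exact Or.inl h1.1
    · rw [h1.1]; exact Or.inl C.hu1
    · exact Or.inr (Or.inl h1.1)
    · exact Or.inr (Or.inr h1.1)
    · exact Or.inr (Or.inl h1.2)
    · exact Or.inr (Or.inr h1.2)
    · rw [h1.2]; exact Or.inl C.hu2
  set S := ((supp K').erase v).erase m1 with hSdef
  have hSS0 : ∀ x ∈ S, x ∈ S0 := by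
    intro x hx
    rw [hSdef, Finset.mem_erase, Finset.mem_erase] at hx
    exact ((hsub x hx.2.2).resolve_right (fun hh => hh.elim hx.2.1 hx.1))
  have mS : ∀ x ∈ supp K', x ∈ S0 → x ∈ S := fun x hx hx0 =>
    Finset.mem_erase.2 ⟨nem hx0 hm1S, Finset.mem_erase.2 ⟨nem hx0 hvS, hx⟩⟩
  have hcS : S.card + 1 + 1 = (supp K').card := by
    rw [hSdef, Finset.card_erase_add_one (Finset.mem_erase.2 ⟨hvm.symm, hms⟩),
      Finset.card_erase_add_one hvs]
  have hcount := add_count (G := G) (K := K') S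
    {(u1, v), (v, m1), (m1, u2), (v, u1), (m1, v), (u2, m1)} (by
    intro a b hab
    rcases hK' a b hab with h1 | (h1 | h1 | h1) | (h1 | h1 | h1)
    · left
      exact ⟨mS _ (mem_supp.2 ⟨_, hab⟩) h1.1, mS _ (mem_supp.2 ⟨_, hab.symm⟩) h1.2.1, h1.2.2⟩
    all_goals
      right
      rw [h1.1, h1.2]
      simp)
  have hX6 : ({(u1, v), (v, m1), (m1, u2), (v, u1), (m1, v), (u2, m1)} : Finset (V × V)).card ≤ 6 :=
    Finset.card_le_six
  have hout' : ∀ x ∈ [s3, t3, s4, t4], x ∉ S := fun x hx hxS => (C.out.2 x hx).1 (hSS0 x hxS)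
  have m := miss4 (a := s3) (b := t3) (c := s4) (d := t4) h S ⟨u1, mS _ hu1s C.hu1⟩ C.out.1
    (hout' s3 (by simp)) (hout' t3 (by simp)) (hout' s4 (by simp)) (hout' t4 (by simp))
  have hlt : (supp K').card < Fintype.card V := by
    rw [← Finset.card_univ]
    apply Finset.card_lt_card
    rw [Finset.ssubset_univ_iff]
    intro hh
    have o := C.out.2 s3 (by simp)
    rcases hsub s3 (by rw [hh]; simp) with h1 | h1 | h1
    · exact o.1 h1
    · exact o.2.1 h1
    · exact o.2.2.1 h1
  rcases apply_min h hmin hlt with h1 | h1 | h1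
  · omega
  · obtain ⟨-, -, e, -, e2, e3⟩ := h1
    obtain ⟨i1, hi1⟩ := (e2 _).1 hu1s
    obtain ⟨i2, hi2⟩ := (e2 _).1 hms
    have h4 := e3 i2 i1 (by rintro rfl; exact hw1 (hi1.symm.trans hi2))
    rw [hi1, hi2] at h4
    rcases hmn _ h4 with h5 | h5
    · exact hv1 h5
    · exact hu12 h5
  · omega

lemma CfgB.main (h : SmallestCex G) (C : CfgB G v m1 u1 n n' u2 s3 t3 u3 s4 t4 u4 S0)
    (hu12 : u1 ≠ u2) : ∃ b, b ∈ S0 ∧ b ≠ u1 ∧ b ≠ u2 ∧ G.Adj u1 b ∧ G.Adj b u2 := by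
  have hnd := C.hnd
  simp only [List.nodup_cons, List.mem_cons, List.not_mem_nil, or_false, not_or,
      not_false_eq_true, List.nodup_nil, and_true] at hnd
  obtain ⟨⟨vm, vn, vn', -⟩, ⟨mn, mn', -⟩, ⟨nn', -⟩, -⟩ := hnd
  have hS0 := C.hS0
  simp only [List.mem_cons, List.not_mem_nil, or_false, not_or] at hS0
  have hvS : v ∉ S0 := fun hh => ((hS0 v).1 hh).1 rfl
  have hm1S : m1 ∉ S0 := fun hh => ((hS0 _).1 hh).2.1 rfl
  have hnS : n ∉ S0 := fun hh => ((hS0 _).1 hh).2.2.1 rfl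
  have hn'S : n' ∉ S0 := fun hh => ((hS0 _).1 hh).2.2.2.1 rfl
  have nem : ∀ {x y : V}, x ∈ S0 → y ∉ S0 → x ≠ y := fun hx hy => ne_of_mem_of_not_mem hx hy
  obtain ⟨ψ, hψ, hψu⟩ := C.path3 h hu12
  have hψn : ¬ adj5 (ψ u1) (ψ u2) := C.col h ψ hψ
  let K : SimpleGraph V :=
    { Adj := fun a b => (a ∈ S0 ∧ b ∈ S0 ∧ G.Adj a b) ∨ (a = u1 ∧ b = u2) ∨ (a = u2 ∧ b = u1)
      symm := ⟨fun a b hab => by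
        rcases hab with ⟨h1, h2, h3⟩ | h1 | h1
        · exact Or.inl ⟨h2, h1, h3.symm⟩
        · exact Or.inr (Or.inr h1.symm)
        · exact Or.inr (Or.inl h1.symm)⟩
      loopless := ⟨fun a hab => by
        rcases hab with ⟨h1, h2, h3⟩ | h1 | h1
        · exact G.irrefl h3
        · exact hu12 (h1.1.symm.trans h1.2)
        · exact hu12 (h1.2.symm.trans h1.1)⟩ }
  have hK : ¬ Colb K := by
    rintro ⟨c, hc⟩
    exact C.col h c (fun a ha b hb hab => hc a b (Or.inl ⟨ha, hb, hab⟩))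
      (hc u1 u2 (Or.inr (Or.inl ⟨rfl, rfl⟩)))
  obtain ⟨K', hle, hmin⟩ := exists_minU K hK
  have hK' : ∀ a b, K'.Adj a b → (a ∈ S0 ∧ b ∈ S0 ∧ G.Adj a b) ∨ (a = u1 ∧ b = u2) ∨
      (a = u2 ∧ b = u1) := fun a b hab => hle hab
  have he : K'.Adj u1 u2 := by
    by_contra hno
    apply hmin.1
    apply colb_of_le h S0 v hvS
    intro a b hab
    rcases hK' a b hab with h1 | ⟨rfl, rfl⟩ | ⟨rfl, rfl⟩
    · exact h1
    · exact absurd hab hno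
    · exact absurd hab.symm hno
  have hu1s : u1 ∈ supp K' := mem_supp.2 ⟨_, he⟩
  have hu2s : u2 ∈ supp K' := mem_supp.2 ⟨_, he.symm⟩
  have hsub : ∀ a ∈ supp K', a ∈ S0 := by
    intro a ha
    obtain ⟨b, hb⟩ := mem_supp.1 ha
    rcases hK' a b hb with h1 | ⟨rfl, rfl⟩ | ⟨rfl, rfl⟩
    · exact h1.1
    · exact C.hu1
    · exact C.hu2
  have hlt : (supp K').card < Fintype.card V := by
    rw [← Finset.card_univ]
    apply Finset.card_lt_card
    rw [Finset.ssubset_univ_iff]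
    intro hh
    exact hvS (hsub v (by rw [hh]; simp))
  rcases apply_min h hmin hlt with h1 | h1 | h1
  · exfalso
    obtain ⟨S, hSeq⟩ : ∃ S, S = supp K' := ⟨_, rfl⟩
    have hcount := add_count (G := G) (K := K') S {(u1, u2), (u2, u1)} (by
      intro a b hab
      rcases hK' a b hab with h1 | h1 | h1
      · left
        rw [hSeq]
        exact ⟨mem_supp.2 ⟨_, hab⟩, mem_supp.2 ⟨_, hab.symm⟩, h1.2.2⟩
      all_goals
        right
        rw [h1.1, h1.2]
        simp)
    have hX2 : ({(u1, u2), (u2, u1)} : Finset (V × V)).card ≤ 2 := Finset.card_le_two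
    rw [← hSeq] at hsub hu1s hu2s h1
    have nS : ∀ x, x ∉ S0 → x ∉ S := fun x hx hxS => hx (hsub x hxS)
    have p1 := PP_insert1 (G := G) (nS m1 hm1S) hu1s C.s1.a2
    have p2 := PP_insert1 (G := G) (S := insert m1 S) (x := n') (a := u2)
      (by simp [Ne.symm mn', nS n' hn'S]) (by simp [hu2s]) C.l2.a3
    have p3 := PP_insert1 (G := G) (S := insert n' (insert m1 S)) (x := n) (a := n')
      (by simp [nn', Ne.symm mn, nS n hnS]) (by simp) C.l2.a2
    have p4 := PP_insert2 (G := G) (S := insert n (insert n' (insert m1 S))) (x := v) (a := m1)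
      (b := n) (by simp [vm, vn, vn', nS v hvS]) (by simp) (by simp) mn C.s1.a1 C.l2.a1
    have hout' : ∀ x ∈ [s3, t3, s4, t4], x ∉ insert v (insert n (insert n' (insert m1 S))) := by
      intro x hx
      obtain ⟨o1, o2, o3, o4, o5⟩ := C.out.2 x hx
      simp [o2, o3, o4, o5, nS x o1]
    obtain ⟨g, hg, g1, g2⟩ := norm02 _ _ hψu hψn
    let φ : V → Fin 6 := fun x => if x = v then 5 else if x = m1 ∨ x = n then 4 else
      if x = n' then 3 else (g (ψ x)).castSucc
    have φv : φ v = 5 := by simp [φ]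
    have φm : φ m1 = 4 := by simp [φ, Ne.symm vm]
    have φn : φ n = 4 := by simp [φ, Ne.symm vn]
    have φn' : φ n' = 3 := by simp [φ, Ne.symm vn', Ne.symm nn', Ne.symm mn']
    have φS : ∀ x ∈ S, φ x = (g (ψ x)).castSucc := by
      intro x hx
      have hx := hsub x hx
      simp [φ, nem hx hvS, nem hx hm1S, nem hx hnS, nem hx hn'S]
    have hmem : ∀ x ∈ insert v (insert n (insert n' (insert m1 S))),
        x = v ∨ x = n ∨ x = n' ∨ x = m1 ∨ x ∈ S := by
      intro x hx
      simpa using hx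
    -- only neighbours inside the set matter
    have hvadj : ∀ x ∈ insert v (insert n (insert n' (insert m1 S))), G.Adj v x →
        adj6 (φ v) (φ x) := by
      intro x hx hvx
      have h3 := C.hN x hvx
      have h4 : ∀ y ∈ [s3, t3, s4, t4], x ≠ y := fun y hy hxy => hout' y hy (hxy ▸ hx)
      have q3 := h4 s3 (by simp)
      have q4 := h4 s4 (by simp)
      simp only [List.mem_cons, List.not_mem_nil, or_false] at h3
      rcases h3 with h3 | h3 | h3 | h3
      · rw [φv, h3, φm]; decide
      · rw [φv, h3, φn]; decide
      · exact absurd h3 q3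
      · exact absurd h3 q4
    have hmadj : ∀ x, G.Adj m1 x → adj6 (φ m1) (φ x) := by
      intro x hx
      rcases C.s1.n x hx with h3 | h3
      · rw [h3, φv, φm]; decide
      · rw [h3, φm, φS u1 hu1s, g1]; decide
    have hnadj : ∀ x, G.Adj n x → adj6 (φ n) (φ x) := by
      intro x hx
      rcases C.l2.ns x hx with h3 | h3
      · rw [h3, φv, φn]; decide
      · rw [h3, φn, φn']; decide
    have hn'adj : ∀ x, G.Adj n' x → adj6 (φ n') (φ x) := by
      intro x hx
      rcases C.l2.nt x hx with h3 | h3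
      · rw [h3, φn, φn']; decide
      · rw [h3, φn', φS u2 hu2s, g2]; decide
    refine tail h C.ht _ (by simp) (hout' s3 (by simp)) (hout' t3 (by simp)) (hout' s4 (by simp))
      (hout' t4 (by simp)) (by omega) φ ?_ ⟨m1, by simp, n, by simp, mn, by
        rw [φm, φn]⟩ φv ?_
    · intro a ha b hb hab
      rcases hmem a ha with h3 | h3 | h3 | h3 | h3
      · rw [h3] at hab ⊢; exact hvadj b hb hab
      · rw [h3] at hab ⊢; exact hnadj b hab
      · rw [h3] at hab ⊢; exact hn'adj b hab
      · rw [h3] at hab ⊢; exact hmadj b hab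
      rcases hmem b hb with h4 | h4 | h4 | h4 | h4
      · rw [h4] at hab ⊢; exact adj6_symm (hvadj a ha hab.symm)
      · rw [h4] at hab ⊢; exact adj6_symm (hnadj a hab.symm)
      · rw [h4] at hab ⊢; exact adj6_symm (hn'adj a hab.symm)
      · rw [h4] at hab ⊢; exact adj6_symm (hmadj a hab.symm)
      · rw [φS a h3, φS b h4]
        exact adj6_castSucc (hg _ _ (hψ a (hsub a h3) b (hsub b h4) hab))
    · intro x hx hxv
      rcases hmem x hx with h3 | h3 | h3 | h3 | h3
      · exact absurd h3 hxv
      · rw [h3, φn]; decide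
      · rw [h3, φn']; decide
      · rw [h3, φm]; decide
      · rw [φS x h3]
        generalize g (ψ x) = y
        revert y
        decide
  · obtain ⟨-, -, e, e1, e2, e3⟩ := h1
    obtain ⟨i1, hi1⟩ := (e2 _).1 hu1s
    obtain ⟨i2, hi2⟩ := (e2 _).1 hu2s
    obtain ⟨i0, h01, h02⟩ : ∃ i0 : Fin 3, i0 ≠ i1 ∧ i0 ≠ i2 :=
      (by decide : ∀ i1 i2 : Fin 3, ∃ i0 : Fin 3, i0 ≠ i1 ∧ i0 ≠ i2) i1 i2
    have a1 := e3 i1 i0 h01.symm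
    have a2 := e3 i0 i2 h02
    have b1 : e i0 ≠ u1 := fun hh => h01 (e1 (hh.trans hi1.symm))
    have b2 : e i0 ≠ u2 := fun hh => h02 (e1 (hh.trans hi2.symm))
    rw [hi1] at a1
    rw [hi2] at a2
    refine ⟨e i0, hsub _ ((e2 _).2 ⟨_, rfl⟩), b1, b2, ?_, ?_⟩
    · rcases hK' _ _ a1 with h5 | h5 | h5
      · exact h5.2.2
      · exact absurd h5.2 b2
      · exact absurd h5.1 hu12
    · rcases hK' _ _ a2 with h5 | h5 | h5
      · exact h5.2.2
      · exact absurd h5.1 b1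
      · exact absurd h5.1 b2
  · exfalso
    obtain ⟨-, -, i, e, e1, e2, e3⟩ := h1
    obtain ⟨w, hw⟩ := (e2 _).1 hu1s
    obtain ⟨a, ha⟩ := (e2 _).1 hu2s
    have eS : ∀ x, e x ∈ S0 := fun x => hsub _ ((e2 _).2 ⟨_, rfl⟩)
    refine elem' h C.ht i a w ((e3 a w).1 (by rw [ha, hw]; exact he.symm)) e e1 ?_ n' n m1 ?_
      C.l2.a2.symm C.l2.a1.symm C.s1.a1 ?_ ?_ ?_ ?_ ?_ ?_ ⟨nem C.hu3 hnS, nem C.hu3 hm1S⟩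
      ⟨nem C.hu4 hnS, nem C.hu4 hm1S⟩
    · intro x y hxy g1 g2
      rcases hK' _ _ ((e3 x y).2 hxy) with h5 | h5 | h5
      · exact h5.2.2
      · exact absurd ⟨e1 (h5.1.trans hw.symm), e1 (h5.2.trans ha.symm)⟩ g2
      · exact absurd ⟨e1 (h5.1.trans ha.symm), e1 (h5.2.trans hw.symm)⟩ g1
    · rw [ha]; exact C.l2.a3.symm
    · rw [hw]; exact C.s1.a2
    · simp only [List.nodup_cons, List.mem_cons, List.not_mem_nil, or_false, not_or,
        not_false_eq_true, List.nodup_nil, and_true]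
      exact ⟨⟨Ne.symm nn', Ne.symm vn', Ne.symm mn'⟩, ⟨Ne.symm vn, Ne.symm mn⟩, vm⟩
    · intro x
      simp only [List.mem_cons, List.not_mem_nil, or_false, not_or]
      exact ⟨nem (eS x) hn'S, nem (eS x) hnS, nem (eS x) hvS, nem (eS x) hm1S⟩
    · intro x hx
      exact (C.l2.ns x hx).symm
    · intro x hx
      rw [hw]
      exact C.s1.n x hx
    · intro x hx
      obtain ⟨o1, o2, o3, o4, o5⟩ := C.out.2 x hx
      refine ⟨fun j => nem (eS j) o1, ?_⟩
      simp only [List.mem_cons, List.not_mem_nil, or_false, not_or]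
      exact ⟨o5, o4, o2, o3⟩

/-- Four long strings at a vertex are impossible. -/
lemma caseC (h : SmallestCex G) {s1 t1 u1 s2 t2 u2 s3 t3 u3 s4 t4 u4 : V} (l1 : Long G v s1 t1 u1)
    (l2 : Long G v s2 t2 u2) (l3 : Long G v s3 t3 u3) (l4 : Long G v s4 t4 u4)
    (hnd : [v, s1, t1, s2, t2, s3, t3, s4, t4].Nodup) (S0 : Finset V)
    (hS0 : ∀ x, x ∈ S0 ↔ x ∉ [v, s1, t1, s2, t2, s3, t3, s4, t4]) (hu1 : u1 ∈ S0) (hu2 : u2 ∈ S0)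
    (hu3 : u3 ∈ S0) (hu4 : u4 ∈ S0) (hN : ∀ x, G.Adj v x → x ∈ [s1, s2, s3, s4]) : False := by
  have hvS : v ∉ S0 := by rw [hS0]; simp
  obtain ⟨c, hc⟩ := crit_colOn h.1 (S0 : Set V) (by
    intro hh
    have : v ∈ (S0 : Set V) := by rw [hh]; trivial
    exact hvS this)
  obtain ⟨k, k1, k2, k3, k4⟩ := pick5 (c u1) (c u2) (c u3) (c u4)
  simp only [List.nodup_cons, List.mem_cons, List.not_mem_nil, or_false, not_or,
      not_false_eq_true, List.nodup_nil, and_true] at hnd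
  obtain ⟨a0, a1, b1, a2, b2, a3, b3, a4⟩ := hnd
  refine ext_all h l1.ext l2.ext l3.ext l4.ext ?_ ?_ ?_ ?_ ?_ ?_ ?_ (S0 : Set V) ?_
    hu1 hu2 hu3 hu4 ?_ c hc k k1 k2 k3 k4
  · rintro x (rfl | rfl) (h | h)
    · exact a1.2.1 h.symm
    · exact b1.1 h.symm
    · exact a1.2.2.1 h.symm
    · exact b1.2.1 h.symm
  · rintro x (rfl | rfl) (h | h)
    · exact a1.2.2.2.1 h.symm
    · exact b1.2.2.1 h.symm
    · exact a1.2.2.2.2.1 h.symm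
    · exact b1.2.2.2.1 h.symm
  · rintro x (rfl | rfl) (h | h)
    · exact a1.2.2.2.2.2.1 h.symm
    · exact b1.2.2.2.2.1 h.symm
    · exact a1.2.2.2.2.2.2 h.symm
    · exact b1.2.2.2.2.2 h.symm
  · rintro x (rfl | rfl) (h | h)
    · exact a2.2.1 h.symm
    · exact b2.1 h.symm
    · exact a2.2.2.1 h.symm
    · exact b2.2.1 h.symm
  · rintro x (rfl | rfl) (h | h)
    · exact a2.2.2.2.1 h.symm
    · exact b2.2.2.1 h.symm
    · exact a2.2.2.2.2 h.symm
    · exact b2.2.2.2 h.symm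
  · rintro x (rfl | rfl) (h | h)
    · exact a3.2.1 h.symm
    · exact b3.1 h.symm
    · exact a3.2.2 h.symm
    · exact b3.2 h.symm
  · simp only [Set.mem_singleton_iff, Set.mem_insert_iff]
    tauto
  · intro x
    rw [Finset.mem_coe, hS0]
    simp only [Set.mem_singleton_iff, Set.mem_insert_iff, List.mem_cons, List.not_mem_nil, or_false]
    tauto
  · intro x hx hxS
    have h1 := hN x hx
    rw [Finset.mem_coe, hS0] at hxS
    simp only [List.mem_cons, List.not_mem_nil, or_false] at h1 hxS
    tauto

end caseB
section strings

open scoped Classical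

variable {V : Type} [Fintype V] {G : SimpleGraph V}

lemma nbr2 {m a b : V} (hd : deg G m = 2) (ha : G.Adj m a) (hb : G.Adj m b) (hab : a ≠ b) (x : V)
    (hx : G.Adj m x) : x = a ∨ x = b := by
  have hsub : ({a, b} : Set V) ⊆ G.neighborSet m := by
    rintro y (rfl | rfl)
    · exact ha
    · exact hb
  have := Set.eq_of_subset_of_ncard_le hsub (by
    rw [Set.ncard_pair hab]; exact hd.le) (Set.toFinite _)
  have hx' : x ∈ G.neighborSet m := hx
  rw [← this] at hx'
  exact hx'

lemma nbr4 {m a b c d : V} (hd : deg G m = 4) (ha : G.Adj m a) (hb : G.Adj m b) (hc : G.Adj m c)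
    (hd' : G.Adj m d) (h12 : a ≠ b) (h13 : a ≠ c) (h14 : a ≠ d) (h23 : b ≠ c) (h24 : b ≠ d)
    (h34 : c ≠ d) (x : V) (hx : G.Adj m x) : x ∈ [a, b, c, d] := by
  have hsub : (({a, b, c, d} : Finset V) : Set V) ⊆ G.neighborSet m := by
    intro y hy
    simp only [Finset.coe_insert, Finset.coe_singleton, Set.mem_insert_iff,
      Set.mem_singleton_iff] at hy
    rcases hy with rfl | rfl | rfl | rfl <;> assumption
  have h4 : ({a, b, c, d} : Finset V).card = 4 := by
    rw [Finset.card_insert_of_notMem, Finset.card_insert_of_notMem,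
          Finset.card_insert_of_notMem, Finset.card_singleton]
    · simpa using h34
    · simp [h23, h24]
    · simp [h12, h13, h14]
  have := Set.eq_of_subset_of_ncard_le hsub (by
    rw [Set.ncard_coe_finset, h4]; exact hd.le) (Set.toFinite _)
  have hx' : x ∈ G.neighborSet m := hx
  rw [← this] at hx'
  simpa using hx'

/-- A string of length two with degrees. -/
structure SStr (G : SimpleGraph V) (v m u : V) : Prop where
  sh : Short G v m u
  dm : deg G m = 2
  du : 3 ≤ deg G u

/-- A string of length three with degrees. -/
structure LStr (G : SimpleGraph V) (v s t u : V) : Prop where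
  lo : Long G v s t u
  ds : deg G s = 2
  dt : deg G t = 2
  du : 3 ≤ deg G u

lemma str2 {v u : V} (p : G.Walk v u) (hs : IsString G p) (hl : p.length = 2) :
    ∃ m, SStr G v m u ∧ p.getVert 1 = m ∧ p.edges = [s(v, m), s(m, u)] := by
  obtain ⟨hp, -, -, du, hinner⟩ := hs
  cases p with
  | nil => simp at hl
  | @cons _ m _ h1 q =>
    cases q with
    | nil => simp at hl
    | @cons _ w _ h2 r =>
      cases r with
      | nil =>
        simp only [Walk.cons_isPath_iff, Walk.support_cons, Walk.support_nil, List.mem_cons,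
          List.not_mem_nil, or_false, not_or] at hp hinner
        have dm := hinner m (Or.inr (Or.inl rfl)) h1.ne' h2.ne
        exact ⟨m, ⟨⟨h1, h2, nbr2 dm h1.symm h2 hp.2.2, hp.2.2⟩, dm, du⟩, by simp, by simp⟩
      | cons h3 r => simp at hl

lemma str3 {v u : V} (p : G.Walk v u) (hs : IsString G p) (hl : p.length = 3) :
    ∃ s t, LStr G v s t u ∧ p.getVert 1 = s ∧ p.edges = [s(v, s), s(s, t), s(t, u)] := by
  obtain ⟨hp, -, -, du, hinner⟩ := hs
  cases p with
  | nil => simp at hl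
  | @cons _ s _ h1 q =>
    cases q with
    | nil => simp at hl
    | @cons _ t _ h2 r =>
      cases r with
      | nil => simp at hl
      | @cons _ w _ h3 r =>
        cases r with
        | nil =>
          simp only [Walk.cons_isPath_iff, Walk.support_cons, Walk.support_nil, List.mem_cons,
            List.not_mem_nil, or_false, not_or] at hp hinner
          obtain ⟨⟨hp1, hp2⟩, hp3⟩ := hp
          have ds := hinner s (Or.inr (Or.inl rfl)) h1.ne' hp2.2
          have dt := hinner t (Or.inr (Or.inr (Or.inl rfl))) (Ne.symm hp3.2.1) h3.ne
          exact ⟨s, t, ⟨⟨h1, h2, h3, nbr2 ds h1.symm h2 hp3.2.1, nbr2 dt h2.symm h3 hp2.2,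
            hp3.2.1, hp2.2, hp3.2.2⟩, ds, dt, du⟩, by simp, by simp⟩
        | cons h4 r => simp at hl

lemma str_le (h : SmallestCex G) {v u : V} (p : G.Walk v u) (hs : IsString G p) :
    p.length ≤ 3 := by
  by_contra hlt
  obtain ⟨hp, -, -, du, hinner⟩ := hs
  cases p with
  | nil => simp at hlt
  | @cons _ a _ h1 q =>
  cases q with
  | nil => simp at hlt
  | @cons _ b _ h2 q =>
  cases q with
  | nil => simp at hlt
  | @cons _ c _ h3 q =>
  cases q with
  | nil => simp at hlt
  | @cons _ d _ h4 q =>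
  simp only [Walk.cons_isPath_iff, Walk.support_cons, List.mem_cons, not_or] at hp hinner
  obtain ⟨⟨⟨⟨hq, c1⟩, b1, b2⟩, a1, a2, a3⟩, v1, v2, v3, v4⟩ := hp
  have hu := q.end_mem_support
  have hd := q.start_mem_support
  have n1 : ∀ x, x ∉ q.support → x ≠ u := fun x hx hh => hx (hh ▸ hu)
  have n2 : ∀ x, x ∉ q.support → x ≠ d := fun x hx hh => hx (hh ▸ hd)
  have da := hinner a (Or.inr (Or.inl rfl)) (Ne.symm v1) (n1 a a3)
  have db := hinner b (Or.inr (Or.inr (Or.inl rfl))) (Ne.symm v2) (n1 b b2)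
  have dc := hinner c (Or.inr (Or.inr (Or.inr (Or.inl rfl)))) (Ne.symm v3) (n1 c c1)
  have na := nbr2 da h1.symm h2 v2
  have nb := nbr2 db h2.symm h3 a2
  have nc := nbr2 dc h3.symm h4 (n2 b b2)
  obtain ⟨κ, hκ⟩ := crit_colOn h.1 {x | x ≠ a ∧ x ≠ b ∧ x ≠ c} (by
    intro hh
    have : a ∈ {x | x ≠ a ∧ x ≠ b ∧ x ≠ c} := by rw [hh]; trivial
    exact this.1 rfl)
  obtain ⟨x, y, z, k1, k2, k3, k4⟩ := mid4 (κ v) (κ d)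
  have q1 := ext1 hκ c z (fun hh => hh.2.2 rfl) (by
    intro w hw hcw
    rcases nc w hcw with rfl | rfl
    · exact absurd rfl hw.2.1
    · exact k4)
  have q2 := ext1 q1 b y (by
    rintro (hh | hh)
    · exact b1 hh
    · exact hh.2.1 rfl) (by
    intro w hw hcw
    rcases nb w hcw with rfl | rfl
    · rcases hw with hh | hh
      · exact absurd hh a2
      · exact absurd rfl hh.1
    · rw [Function.update_self]; exact k3)
  have q3 := ext1 q2 a x (by
    rintro (hh | hh | hh)
    · exact a1 hh
    · exact a2 hh
    · exact hh.1 rfl) (by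
    intro w hw hcw
    rcases na w hcw with rfl | rfl
    · rw [Function.update_of_ne v2, Function.update_of_ne v3]; exact adj5_symm k1
    · rw [Function.update_self]; exact k2)
  refine crit_not_colb h.1 ⟨_, fun e f hef => q3 e ?_ f ?_ hef⟩
  all_goals
    simp only [Set.mem_insert_iff, Set.mem_setOf_eq]
    tauto

lemma cyc5 {a b c d e : V} (h1 : G.Adj a b) (h2 : G.Adj b c) (h3 : G.Adj c d) (h4 : G.Adj d e)
    (h5 : G.Adj e a) (hnd : [a, b, c, d, e].Nodup) :
    ∃ w : G.Walk a a, w.IsCycle ∧ w.length = 5 ∧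
      w.edges = [s(a, b), s(b, c), s(c, d), s(d, e), s(e, a)] := by
  simp only [List.nodup_cons, List.mem_cons, List.not_mem_nil, or_false, not_or,
      not_false_eq_true, List.nodup_nil, and_true] at hnd
  refine ⟨.cons h1 (.cons h2 (.cons h3 (.cons h4 (.cons h5 .nil)))), ?_, rfl, rfl⟩
  rw [Walk.cons_isCycle_iff]
  simp only [Walk.cons_isPath_iff, Walk.support_cons, Walk.support_nil, List.mem_cons,
    List.not_mem_nil, or_false, not_or, Walk.edges_cons, Walk.edges_nil, Sym2.eq_iff]
  grind [Walk.IsPath.nil]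

lemma cyc7 {a b c d e f g : V} (h1 : G.Adj a b) (h2 : G.Adj b c) (h3 : G.Adj c d) (h4 : G.Adj d e)
    (h5 : G.Adj e f) (h6 : G.Adj f g) (h7 : G.Adj g a) (hnd : [a, b, c, d, e, f, g].Nodup) :
    ∃ w : G.Walk a a, w.IsCycle ∧ w.length = 7 ∧
      w.edges = [s(a, b), s(b, c), s(c, d), s(d, e), s(e, f), s(f, g), s(g, a)] := by
  simp only [List.nodup_cons, List.mem_cons, List.not_mem_nil, or_false, not_or,
      not_false_eq_true, List.nodup_nil, and_true] at hnd
  refine ⟨.cons h1 (.cons h2 (.cons h3 (.cons h4 (.cons h5 (.cons h6 (.cons h7 .nil)))))), ?_,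
    rfl, rfl⟩
  rw [Walk.cons_isCycle_iff]
  simp only [Walk.cons_isPath_iff, Walk.support_cons, Walk.support_nil, List.mem_cons,
    List.not_mem_nil, or_false, not_or, Walk.edges_cons, Walk.edges_nil, Sym2.eq_iff]
  grind [Walk.IsPath.nil]

lemma deg_ne {x y : V} (hx : deg G x = 2) (hy : 3 ≤ deg G y) : y ≠ x := by
  rintro rfl; omega

lemma LStr.t_ne {v s t u x : V} (l : LStr G v s t u) (hx : G.Adj v x) : t ≠ x := by
  rintro rfl
  rcases l.lo.nt v hx.symm with h | h
  · exact l.lo.a1.ne h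
  · exact l.lo.vu h

lemma LStr.tt {v s t u s' t' u' : V} (l : LStr G v s t u) (l' : LStr G v s' t' u') (hs : s ≠ s') :
    t ≠ t' := by
  rintro rfl
  rcases l.lo.nt s' l'.lo.a2.symm with h | h
  · exact hs h.symm
  · exact deg_ne l'.ds l.du h.symm

lemma LStr.tails {v s t u s' t' u' : V} (l : LStr G v s t u) (l' : LStr G v s' t' u')
    (hs : s ≠ s') : Tails G v s t u s' t' u' :=
  ⟨l.lo, l'.lo, hs, (l'.t_ne l.lo.a1).symm, l.t_ne l'.lo.a1, l.tt l' hs, deg_ne l'.ds l.du,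
    deg_ne l'.dt l.du, deg_ne l.ds l'.du, deg_ne l.dt l'.du⟩

variable {v : V}

lemma finA (h : SmallestCex G) (hdeg : deg G v = 4) {m1 u1 m2 u2 s3 t3 u3 s4 t4 u4 : V}
    (p1 : SStr G v m1 u1) (p2 : SStr G v m2 u2) (p3 : LStr G v s3 t3 u3) (p4 : LStr G v s4 t4 u4)
    (h12 : m1 ≠ m2) (h13 : m1 ≠ s3) (h14 : m1 ≠ s4) (h23 : m2 ≠ s3) (h24 : m2 ≠ s4)
    (h34 : s3 ≠ s4) :
    ∃ c : G.Walk v v, c.IsCycle ∧ (c.length = 5 ∨ c.length = 7) ∧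
      s(v, m1) ∈ c.edges ∧ s(m1, u1) ∈ c.edges ∧ s(v, m2) ∈ c.edges ∧ s(m2, u2) ∈ c.edges := by
  have C : CfgA G v m1 u1 m2 u2 s3 t3 u3 s4 t4 u4
      (Finset.univ.filter (fun x => x ∉ [v, m1, m2, s3, t3, s4, t4])) := by
    have hm : ∀ u, 3 ≤ deg G u → u ≠ v →
        u ∈ Finset.univ.filter (fun x => x ∉ [v, m1, m2, s3, t3, s4, t4]) := by
      intro u hu huv
      rw [Finset.mem_filter]
      simp only [List.mem_cons, List.not_mem_nil, or_false, not_or]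
      exact ⟨Finset.mem_univ _, huv, deg_ne p1.dm hu, deg_ne p2.dm hu, deg_ne p3.ds hu,
        deg_ne p3.dt hu, deg_ne p4.ds hu, deg_ne p4.dt hu⟩
    refine ⟨p1.sh, p2.sh, p3.tails p4 h34, ?_, by simp, hm _ p1.du p1.sh.vu.symm,
      hm _ p2.du p2.sh.vu.symm, hm _ p3.du p3.lo.vu.symm, hm _ p4.du p4.lo.vu.symm,
      nbr4 hdeg p1.sh.a1 p2.sh.a1 p3.lo.a1 p4.lo.a1 h12 h13 h14 h23 h24 h34⟩
    simp only [List.nodup_cons, List.mem_cons, List.not_mem_nil, or_false, not_or,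
      not_false_eq_true, List.nodup_nil, and_true]
    exact ⟨⟨p1.sh.a1.ne, p2.sh.a1.ne, p3.lo.a1.ne, p3.lo.vt, p4.lo.a1.ne, p4.lo.vt⟩,
      ⟨h12, h13, (p3.t_ne p1.sh.a1).symm, h14, (p4.t_ne p1.sh.a1).symm⟩,
      ⟨h23, (p3.t_ne p2.sh.a1).symm, h24, (p4.t_ne p2.sh.a1).symm⟩,
      ⟨p3.lo.a2.ne, h34, (p4.t_ne p3.lo.a1).symm⟩, ⟨p3.t_ne p4.lo.a1, p3.tt p4 h34⟩, p4.lo.a2.ne⟩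
  have w1 := deg_ne p1.dm p1.du
  have w2 := deg_ne p2.dm p1.du
  have w3 := deg_ne p1.dm p2.du
  have w4 := deg_ne p2.dm p2.du
  by_cases hadj : G.Adj u1 u2
  · obtain ⟨c, c1, c2, c3⟩ := cyc5 p1.sh.a1 p1.sh.a2 hadj p2.sh.a2.symm p2.sh.a1.symm (by
      simp only [List.nodup_cons, List.mem_cons, List.not_mem_nil, or_false, not_or,
        not_false_eq_true, List.nodup_nil, and_true]
      exact ⟨⟨p1.sh.a1.ne, p1.sh.vu, p2.sh.vu, p2.sh.a1.ne⟩, ⟨w1.symm, w3.symm, h12⟩,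
        ⟨hadj.ne, w2⟩, w4⟩)
    refine ⟨c, c1, Or.inl c2, ?_⟩
    rw [c3]
    simp [Sym2.eq_swap]
  · obtain ⟨hu12, b, c, hb, hc, b1, b2, b3, b4, a1, a2, a3⟩ := C.main h hadj
    rw [C.hS0] at hb hc
    simp only [List.mem_cons, List.not_mem_nil, or_false, not_or] at hb hc
    obtain ⟨e1, e2, e3, -⟩ := hb
    obtain ⟨f1, f2, f3, -⟩ := hc
    obtain ⟨c, c1, c2, c3⟩ := cyc7 p1.sh.a1 p1.sh.a2 a1 a2 a3 p2.sh.a2.symm p2.sh.a1.symm (by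
      simp only [List.nodup_cons, List.mem_cons, List.not_mem_nil, or_false, not_or,
        not_false_eq_true, List.nodup_nil, and_true]
      exact ⟨⟨p1.sh.a1.ne, p1.sh.vu, Ne.symm e1, Ne.symm f1, p2.sh.vu, p2.sh.a1.ne⟩,
        ⟨w1.symm, Ne.symm e2, Ne.symm f2, w3.symm, h12⟩,
        ⟨b1.symm, b3.symm, hu12, w2⟩, ⟨a2.ne, b2, e3⟩, ⟨b4, f3⟩, w4⟩)
    refine ⟨c, c1, Or.inr c2, ?_⟩
    rw [c3]
    simp [Sym2.eq_swap]

lemma finB (h : SmallestCex G) (hdeg : deg G v = 4) {m1 u1 n n' u2 s3 t3 u3 s4 t4 u4 : V}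
    (p1 : SStr G v m1 u1) (p2 : LStr G v n n' u2) (p3 : LStr G v s3 t3 u3)
    (p4 : LStr G v s4 t4 u4)
    (h12 : m1 ≠ n) (h13 : m1 ≠ s3) (h14 : m1 ≠ s4) (h23 : n ≠ s3) (h24 : n ≠ s4)
    (h34 : s3 ≠ s4) :
    ∃ c : G.Walk v v, c.IsCycle ∧ (c.length = 5 ∨ c.length = 7) ∧
      s(v, m1) ∈ c.edges ∧ s(m1, u1) ∈ c.edges ∧ s(v, n) ∈ c.edges ∧ s(n, n') ∈ c.edges ∧
      s(n', u2) ∈ c.edges := by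
  have C : CfgB G v m1 u1 n n' u2 s3 t3 u3 s4 t4 u4
      (Finset.univ.filter (fun x => x ∉ [v, m1, n, n', s3, t3, s4, t4])) := by
    have hm : ∀ u, 3 ≤ deg G u → u ≠ v →
        u ∈ Finset.univ.filter (fun x => x ∉ [v, m1, n, n', s3, t3, s4, t4]) := by
      intro u hu huv
      rw [Finset.mem_filter]
      simp only [List.mem_cons, List.not_mem_nil, or_false, not_or]
      exact ⟨Finset.mem_univ _, huv, deg_ne p1.dm hu, deg_ne p2.ds hu, deg_ne p2.dt hu,
        deg_ne p3.ds hu, deg_ne p3.dt hu, deg_ne p4.ds hu, deg_ne p4.dt hu⟩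
    refine ⟨p1.sh, p2.lo, p3.tails p4 h34, ?_, by simp, hm _ p1.du p1.sh.vu.symm,
      hm _ p2.du p2.lo.vu.symm, hm _ p3.du p3.lo.vu.symm, hm _ p4.du p4.lo.vu.symm,
      nbr4 hdeg p1.sh.a1 p2.lo.a1 p3.lo.a1 p4.lo.a1 h12 h13 h14 h23 h24 h34⟩
    simp only [List.nodup_cons, List.mem_cons, List.not_mem_nil, or_false, not_or,
      not_false_eq_true, List.nodup_nil, and_true]
    exact ⟨⟨p1.sh.a1.ne, p2.lo.a1.ne, p2.lo.vt, p3.lo.a1.ne, p3.lo.vt, p4.lo.a1.ne, p4.lo.vt⟩,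
      ⟨h12, (p2.t_ne p1.sh.a1).symm, h13, (p3.t_ne p1.sh.a1).symm, h14, (p4.t_ne p1.sh.a1).symm⟩,
      ⟨p2.lo.a2.ne, h23, (p3.t_ne p2.lo.a1).symm, h24, (p4.t_ne p2.lo.a1).symm⟩,
      ⟨p2.t_ne p3.lo.a1, p2.tt p3 h23, p2.t_ne p4.lo.a1, p2.tt p4 h24⟩,
      ⟨p3.lo.a2.ne, h34, (p4.t_ne p3.lo.a1).symm⟩, ⟨p3.t_ne p4.lo.a1, p3.tt p4 h34⟩, p4.lo.a2.ne⟩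
  have w1 := deg_ne p1.dm p1.du
  have w2 := deg_ne p2.ds p1.du
  have w2' := deg_ne p2.dt p1.du
  have w3 := deg_ne p1.dm p2.du
  have w4 := deg_ne p2.ds p2.du
  have w4' := deg_ne p2.dt p2.du
  have w5 : m1 ≠ n' := (p2.t_ne p1.sh.a1).symm
  by_cases hu12 : u1 = u2
  · have a3 := p2.lo.a3.symm
    rw [← hu12] at a3
    obtain ⟨c, c1, c2, c3⟩ := cyc5 p1.sh.a1 p1.sh.a2 a3 p2.lo.a2.symm p2.lo.a1.symm (by
      simp only [List.nodup_cons, List.mem_cons, List.not_mem_nil, or_false, not_or,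
        not_false_eq_true, List.nodup_nil, and_true]
      exact ⟨⟨p1.sh.a1.ne, p1.sh.vu, p2.lo.vt, p2.lo.a1.ne⟩, ⟨w1.symm, w5, h12⟩,
        ⟨w2', w2⟩, p2.lo.a2.ne'⟩)
    refine ⟨c, c1, Or.inl c2, ?_⟩
    rw [c3, ← hu12]
    simp [Sym2.eq_swap]
  · obtain ⟨b, hb, b1, b2, a1, a2⟩ := C.main h hu12
    rw [C.hS0] at hb
    simp only [List.mem_cons, List.not_mem_nil, or_false, not_or] at hb
    obtain ⟨e1, e2, e3, e4, -⟩ := hb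
    obtain ⟨c, c1, c2, c3⟩ := cyc7 p1.sh.a1 p1.sh.a2 a1 a2 p2.lo.a3.symm p2.lo.a2.symm
      p2.lo.a1.symm (by
      simp only [List.nodup_cons, List.mem_cons, List.not_mem_nil, or_false, not_or,
        not_false_eq_true, List.nodup_nil, and_true]
      exact ⟨⟨p1.sh.a1.ne, p1.sh.vu, Ne.symm e1, p2.lo.vu, p2.lo.vt, p2.lo.a1.ne⟩,
        ⟨w1.symm, Ne.symm e2, w3.symm, w5, h12⟩,
        ⟨b1.symm, hu12, w2', w2⟩, ⟨b2, e4, e3⟩, ⟨w4', w4⟩, p2.lo.a2.ne'⟩)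
    refine ⟨c, c1, Or.inr c2, ?_⟩
    rw [c3]
    simp [Sym2.eq_swap]

lemma finC (h : SmallestCex G) (hdeg : deg G v = 4) {s1 t1 u1 s2 t2 u2 s3 t3 u3 s4 t4 u4 : V}
    (p1 : LStr G v s1 t1 u1) (p2 : LStr G v s2 t2 u2) (p3 : LStr G v s3 t3 u3)
    (p4 : LStr G v s4 t4 u4)
    (h12 : s1 ≠ s2) (h13 : s1 ≠ s3) (h14 : s1 ≠ s4) (h23 : s2 ≠ s3) (h24 : s2 ≠ s4)
    (h34 : s3 ≠ s4) : False := by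
  have hm : ∀ u, 3 ≤ deg G u → u ≠ v →
      u ∈ Finset.univ.filter (fun x => x ∉ [v, s1, t1, s2, t2, s3, t3, s4, t4]) := by
    intro u hu huv
    rw [Finset.mem_filter]
    simp only [List.mem_cons, List.not_mem_nil, or_false, not_or]
    exact ⟨Finset.mem_univ _, huv, deg_ne p1.ds hu, deg_ne p1.dt hu, deg_ne p2.ds hu,
      deg_ne p2.dt hu, deg_ne p3.ds hu, deg_ne p3.dt hu, deg_ne p4.ds hu, deg_ne p4.dt hu⟩
  refine caseC h p1.lo p2.lo p3.lo p4.lo ?_ _ (by simp) (hm _ p1.du p1.lo.vu.symm)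
    (hm _ p2.du p2.lo.vu.symm) (hm _ p3.du p3.lo.vu.symm) (hm _ p4.du p4.lo.vu.symm)
    (nbr4 hdeg p1.lo.a1 p2.lo.a1 p3.lo.a1 p4.lo.a1 h12 h13 h14 h23 h24 h34)
  simp only [List.nodup_cons, List.mem_cons, List.not_mem_nil, or_false, not_or,
      not_false_eq_true, List.nodup_nil, and_true]
  exact ⟨⟨p1.lo.a1.ne, p1.lo.vt, p2.lo.a1.ne, p2.lo.vt, p3.lo.a1.ne, p3.lo.vt, p4.lo.a1.ne,
      p4.lo.vt⟩,
    ⟨p1.lo.a2.ne, h12, (p2.t_ne p1.lo.a1).symm, h13, (p3.t_ne p1.lo.a1).symm, h14,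
      (p4.t_ne p1.lo.a1).symm⟩,
    ⟨p1.t_ne p2.lo.a1, p1.tt p2 h12, p1.t_ne p3.lo.a1, p1.tt p3 h13, p1.t_ne p4.lo.a1,
      p1.tt p4 h14⟩,
    ⟨p2.lo.a2.ne, h23, (p3.t_ne p2.lo.a1).symm, h24, (p4.t_ne p2.lo.a1).symm⟩,
    ⟨p2.t_ne p3.lo.a1, p2.tt p3 h23, p2.t_ne p4.lo.a1, p2.tt p4 h24⟩,
    ⟨p3.lo.a2.ne, h34, (p4.t_ne p3.lo.a1).symm⟩, ⟨p3.t_ne p4.lo.a1, p3.tt p4 h34⟩, p4.lo.a2.ne⟩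

end strings

/-- Let `v` be a vertex of degree four of a smallest counterexample,
and let `P1, P2, P3, P4` be the four strings having `v` as an end. If `P1` and `P2` have
length at least two and `P3` and `P4` have length at least three, then the path
`P1 ∪ P2` is contained in a 5-cycle or in a 7-cycle. -/
theorem smallestCex_opposite_seven_cycle {V : Type} [Fintype V] (G : SimpleGraph V)
    (h : SmallestCex G) (v : V) (hdeg : deg G v = 4)
    (u1 u2 u3 u4 : V) (p1 : G.Walk v u1) (p2 : G.Walk v u2)
    (p3 : G.Walk v u3) (p4 : G.Walk v u4)
    (hs1 : IsString G p1) (hs2 : IsString G p2) (hs3 : IsString G p3) (hs4 : IsString G p4)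
    (h12 : p1.getVert 1 ≠ p2.getVert 1) (h13 : p1.getVert 1 ≠ p3.getVert 1)
    (h14 : p1.getVert 1 ≠ p4.getVert 1) (h23 : p2.getVert 1 ≠ p3.getVert 1)
    (h24 : p2.getVert 1 ≠ p4.getVert 1) (h34 : p3.getVert 1 ≠ p4.getVert 1)
    (hl1 : 2 ≤ p1.length) (hl2 : 2 ≤ p2.length)
    (hl3 : 3 ≤ p3.length) (hl4 : 3 ≤ p4.length) :
    ∃ (w : V) (c : G.Walk w w), c.IsCycle ∧ (c.length = 5 ∨ c.length = 7) ∧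
      (∀ e ∈ p1.edges, e ∈ c.edges) ∧ (∀ e ∈ p2.edges, e ∈ c.edges) := by

  have b1 := str_le h p1 hs1
  have b2 := str_le h p2 hs2
  have b3 := str_le h p3 hs3
  have b4 := str_le h p4 hs4
  obtain ⟨s3, t3, q3, f3, -⟩ := str3 p3 hs3 (by omega)
  obtain ⟨s4, t4, q4, f4, -⟩ := str3 p4 hs4 (by omega)
  rw [f3] at h13 h23 h34
  rw [f4] at h14 h24 h34
  rcases (by omega : p1.length = 2 ∨ p1.length = 3) with k1 | k1 <;>
    rcases (by omega : p2.length = 2 ∨ p2.length = 3) with k2 | k2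
  · obtain ⟨m1, q1, f1, g1⟩ := str2 p1 hs1 k1
    obtain ⟨m2, q2, f2, g2⟩ := str2 p2 hs2 k2
    rw [f1] at h12 h13 h14
    rw [f2] at h12 h23 h24
    obtain ⟨c, c1, c2, c3, c4, c5, c6⟩ := finA h hdeg q1 q2 q3 q4 h12 h13 h14 h23 h24 h34
    refine ⟨v, c, c1, c2, ?_, ?_⟩
    · rw [g1]; simp [c3, c4]
    · rw [g2]; simp [c5, c6]
  · obtain ⟨m1, q1, f1, g1⟩ := str2 p1 hs1 k1
    obtain ⟨n, n', q2, f2, g2⟩ := str3 p2 hs2 k2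
    rw [f1] at h12 h13 h14
    rw [f2] at h12 h23 h24
    obtain ⟨c, c1, c2, c3, c4, c5, c6, c7⟩ := finB h hdeg q1 q2 q3 q4 h12 h13 h14 h23 h24 h34
    refine ⟨v, c, c1, c2, ?_, ?_⟩
    · rw [g1]; simp [c3, c4]
    · rw [g2]; simp [c5, c6, c7]
  · obtain ⟨m1, q1, f1, g1⟩ := str2 p2 hs2 k2
    obtain ⟨n, n', q2, f2, g2⟩ := str3 p1 hs1 k1
    rw [f1] at h12 h23 h24
    rw [f2] at h12 h13 h14
    obtain ⟨c, c1, c2, c3, c4, c5, c6, c7⟩ := finB h hdeg q1 q2 q3 q4 h12.symm h23 h24 h13 h14 h34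
    refine ⟨v, c, c1, c2, ?_, ?_⟩
    · rw [g2]; simp [c5, c6, c7]
    · rw [g1]; simp [c3, c4]
  · obtain ⟨s1, t1, q1, f1, -⟩ := str3 p1 hs1 k1
    obtain ⟨s2, t2, q2, f2, -⟩ := str3 p2 hs2 k2
    rw [f1] at h12 h13 h14
    rw [f2] at h12 h23 h24
    exact (finC h hdeg q1 q2 q3 q4 h12 h13 h14 h23 h24 h34).elim
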